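/- Let n ≥ 2 and let λ₁, Λ₁, λ₂, Λ₂ be positive constants with λ_l ≤ Λ_l, and set N_l = (λ_l/Λ_l)(n−1) + 1 for l = 1, 2. Assume N₁ > 2, N₂ > 2, p ≥ 1, q ≥ 1 and pq > 1, and that either 2(p+1)/(pq−1) ≥ N₁−2 or 2(q+1)/(pq−1) ≥ N₂−2. Then there is no pair of bounded functions u₁, u₂ continuous on the closed half space, positive in ℝⁿ₊, vanishing on the boundary ∂ℝⁿ₊ = {xₙ = 0}, such that u₁ is a viscosity solution of M⁺_{λ₁,Λ₁}(D²u₁) + u₂^p = 0 in ℝⁿ₊ and u₂ is a viscosity solution of M⁺_{λ₂,Λ₂}(D²u₂) + u₁^q = 0 in ℝⁿ₊. -/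

import Mathlib

open scoped BigOperators

/-- The Pucci maximal operator `M⁺_{λ,Λ}`: for a symmetric matrix it equals
`Λ · (sum of positive eigenvalues) + λ · (sum of negative eigenvalues)`. -/
noncomputable def pucciMax (lam Lam : ℝ) {n : ℕ} (M : Matrix (Fin n) (Fin n) ℝ) : ℝ :=
  if h : M.IsHermitian then
    ∑ i, (Lam * max (h.eigenvalues i) 0 + lam * min (h.eigenvalues i) 0)
  else 0

/-- The Hessian matrix of `φ` at `x`. -/
noncomputable def hess {n : ℕ} (φ : EuclideanSpace ℝ (Fin n) → ℝ)
    (x : EuclideanSpace ℝ (Fin n)) : Matrix (Fin n) (Fin n) ℝ :=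
  fun i j => iteratedFDeriv ℝ 2 φ x ![EuclideanSpace.single i 1, EuclideanSpace.single j 1]

/-- `u` is a viscosity supersolution of `M⁺_{λ,Λ}(D²u) + g = 0` in `Ω`. -/
def PucciSupersol (lam Lam : ℝ) {n : ℕ} (Ω : Set (EuclideanSpace ℝ (Fin n)))
    (u g : EuclideanSpace ℝ (Fin n) → ℝ) : Prop :=
  ∀ x₀ ∈ Ω, ∀ φ : EuclideanSpace ℝ (Fin n) → ℝ, ContDiff ℝ 2 φ →
    IsLocalMin (fun x => u x - φ x) x₀ → pucciMax lam Lam (hess φ x₀) + g x₀ ≤ 0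

/-- `u` is a viscosity subsolution of `M⁺_{λ,Λ}(D²u) + g = 0` in `Ω`. -/
def PucciSubsol (lam Lam : ℝ) {n : ℕ} (Ω : Set (EuclideanSpace ℝ (Fin n)))
    (u g : EuclideanSpace ℝ (Fin n) → ℝ) : Prop :=
  ∀ x₀ ∈ Ω, ∀ φ : EuclideanSpace ℝ (Fin n) → ℝ, ContDiff ℝ 2 φ →
    IsLocalMax (fun x => u x - φ x) x₀ → 0 ≤ pucciMax lam Lam (hess φ x₀) + g x₀

open Filter Topology Set Metric

/-- The second derivative of `φ` at `x` evaluated on `(v, v)`. -/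
noncomputable def quadD2 {E : Type*} [NormedAddCommGroup E] [NormedSpace ℝ E]
    (φ : E → ℝ) (x v : E) : ℝ :=
  fderiv ℝ (fderiv ℝ φ) x v v

section SecondDerivative

variable {E : Type*} [NormedAddCommGroup E] [NormedSpace ℝ E]

lemma differentiableAt_fderiv_of_contDiffAt {φ : E → ℝ} {x : E} (h : ContDiffAt ℝ 2 φ x) :
    DifferentiableAt ℝ (fderiv ℝ φ) x :=
  (h.fderiv_right (m := 1) (by norm_num)).differentiableAt (by norm_num)

lemma eventually_differentiableAt_of_contDiffAt {φ : E → ℝ} {x : E} (h : ContDiffAt ℝ 2 φ x) :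
    ∀ᶠ y in 𝓝 x, DifferentiableAt ℝ φ y :=
  (h.eventually (by simp)).mono fun _ hy => hy.differentiableAt (by norm_num)

lemma quadD2_add {φ ψ : E → ℝ} {x : E} (hφ : ContDiffAt ℝ 2 φ x) (hψ : ContDiffAt ℝ 2 ψ x)
    (v : E) : quadD2 (fun y => φ y + ψ y) x v = quadD2 φ x v + quadD2 ψ x v := by
  unfold quadD2
  have h1 : fderiv ℝ (fun y => φ y + ψ y) =ᶠ[𝓝 x] fun y => fderiv ℝ φ y + fderiv ℝ ψ y := by
    filter_upwards [eventually_differentiableAt_of_contDiffAt hφ,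
      eventually_differentiableAt_of_contDiffAt hψ] with y h1 h2
    exact fderiv_fun_add h1 h2
  rw [h1.fderiv_eq, fderiv_fun_add (differentiableAt_fderiv_of_contDiffAt hφ)
    (differentiableAt_fderiv_of_contDiffAt hψ)]
  simp

lemma quadD2_const_mul {φ : E → ℝ} {x : E} (hφ : ContDiffAt ℝ 2 φ x) (c : ℝ) (v : E) :
    quadD2 (fun y => c * φ y) x v = c * quadD2 φ x v := by
  unfold quadD2
  have h1 : fderiv ℝ (fun y => c * φ y) =ᶠ[𝓝 x] fun y => c • fderiv ℝ φ y := by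
    filter_upwards [eventually_differentiableAt_of_contDiffAt hφ] with y h1
    exact fderiv_const_mul h1 c
  rw [h1.fderiv_eq, fderiv_fun_const_smul (differentiableAt_fderiv_of_contDiffAt hφ)]
  simp

lemma quadD2_congr {φ ψ : E → ℝ} {x : E} (h : φ =ᶠ[𝓝 x] ψ) (v : E) :
    quadD2 φ x v = quadD2 ψ x v := by
  unfold quadD2
  rw [h.fderiv.fderiv_eq]

lemma quadD2_const (c : ℝ) (x v : E) : quadD2 (fun _ => c) x v = 0 := by
  unfold quadD2
  simp

lemma quadD2_add_const {φ : E → ℝ} {x : E} (hφ : ContDiffAt ℝ 2 φ x) (c : ℝ) (v : E) :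
    quadD2 (fun y => φ y + c) x v = quadD2 φ x v := by
  rw [quadD2_add hφ contDiffAt_const, quadD2_const, add_zero]

lemma quadD2_neg {φ : E → ℝ} (x v : E) : quadD2 (fun y => -φ y) x v = -quadD2 φ x v := by
  unfold quadD2
  have h1 : fderiv ℝ (fun y => -φ y) = fun y => -fderiv ℝ φ y := by
    ext1 y
    exact fderiv_fun_neg
  rw [h1, fderiv_fun_neg]
  simp

/-- Second derivatives computed along a line. -/
lemma hasDerivAt_deriv_line {φ : E → ℝ} {x : E} (hφ : ContDiffAt ℝ 2 φ x) (v : E) :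
    (∀ᶠ t in 𝓝 (0 : ℝ), HasDerivAt (fun t : ℝ => φ (x + t • v)) (fderiv ℝ φ (x + t • v) v) t) ∧
      HasDerivAt (fun t : ℝ => fderiv ℝ φ (x + t • v) v) (quadD2 φ x v) 0 := by
  have hl : ∀ t : ℝ, HasDerivAt (fun t : ℝ => x + t • v) v t := fun t => by
    simpa using ((hasDerivAt_id t).smul_const v).const_add x
  have hc : Tendsto (fun t : ℝ => x + t • v) (𝓝 0) (𝓝 x) := by
    have := (hl 0).continuousAt.tendsto
    simpa using this
  constructor
  · filter_upwards [hc.eventually (eventually_differentiableAt_of_contDiffAt hφ)] with t ht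
    exact ht.hasFDerivAt.comp_hasDerivAt t (hl t)
  · have h0 : x + (0 : ℝ) • v = x := by simp
    have h1 : HasFDerivAt (fderiv ℝ φ) (fderiv ℝ (fderiv ℝ φ) x) (x + (0 : ℝ) • v) := by
      rw [h0]
      exact (differentiableAt_fderiv_of_contDiffAt hφ).hasFDerivAt
    have h2 := h1.comp_hasDerivAt (0 : ℝ) (hl 0)
    exact h2.clm_apply (hasDerivAt_const (0 : ℝ) v) |>.congr_deriv (by simp [quadD2])

lemma quadD2_eq_of_hasDerivAt {φ : E → ℝ} {x v : E} (hφ : ContDiffAt ℝ 2 φ x) {g' : ℝ → ℝ} {c : ℝ}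
    (h1 : ∀ᶠ t in 𝓝 (0 : ℝ), HasDerivAt (fun t : ℝ => φ (x + t • v)) (g' t) t)
    (h2 : HasDerivAt g' c 0) : quadD2 φ x v = c := by
  obtain ⟨k1, k2⟩ := hasDerivAt_deriv_line hφ v
  have : g' =ᶠ[𝓝 0] fun t : ℝ => fderiv ℝ φ (x + t • v) v := by
    filter_upwards [h1, k1] with t a b using a.unique b
  exact k2.unique (h2.congr_of_eventuallyEq this.symm)

end SecondDerivative

section InnerProduct

variable {E : Type*} [NormedAddCommGroup E] [InnerProductSpace ℝ E]

/-- The second derivative of a radial function, written as a function of the squared distance. -/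
lemma quadD2_radial {F F' : ℝ → ℝ} {F'' : ℝ} {x y : E}
    (hφ : ContDiffAt ℝ 2 (fun z => F (‖z - y‖ ^ 2)) x)
    (h1 : ∀ᶠ s in 𝓝 (‖x - y‖ ^ 2), HasDerivAt F (F' s) s)
    (h2 : HasDerivAt F' F'' (‖x - y‖ ^ 2)) (v : E) :
    quadD2 (fun z => F (‖z - y‖ ^ 2)) x v =
      4 * F'' * inner ℝ v (x - y) ^ 2 + 2 * F' (‖x - y‖ ^ 2) * ‖v‖ ^ 2 := by
  set s : ℝ → ℝ := fun t => ‖x - y‖ ^ 2 + 2 * t * inner ℝ v (x - y) + t ^ 2 * ‖v‖ ^ 2 with hs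
  have hs0 : s 0 = ‖x - y‖ ^ 2 := by simp [hs]
  have hse : ∀ t : ℝ, ‖x + t • v - y‖ ^ 2 = s t := by
    intro t
    rw [show x + t • v - y = (x - y) + t • v by abel, norm_add_sq_real, norm_smul, inner_smul_right,
      real_inner_comm, hs]
    simp only [mul_pow, Real.norm_eq_abs, sq_abs]
    ring
  have hsd : ∀ t, HasDerivAt s (2 * inner ℝ v (x - y) + 2 * t * ‖v‖ ^ 2) t := by
    intro t
    have a1 : HasDerivAt (fun t : ℝ => 2 * t * inner ℝ v (x - y)) (2 * inner ℝ v (x - y)) t := by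
      simpa using ((hasDerivAt_id t).const_mul 2).mul_const (inner ℝ v (x - y))
    have a2 : HasDerivAt (fun t : ℝ => t ^ 2 * ‖v‖ ^ 2) (2 * t * ‖v‖ ^ 2) t := by
      simpa using (hasDerivAt_pow 2 t).mul_const (‖v‖ ^ 2)
    exact (a1.const_add (‖x - y‖ ^ 2)).add a2
  have hst : Tendsto s (𝓝 0) (𝓝 (‖x - y‖ ^ 2)) := by
    rw [← hs0]
    exact (hsd 0).continuousAt.tendsto
  refine quadD2_eq_of_hasDerivAt hφ
    (g' := fun t => F' (s t) * (2 * inner ℝ v (x - y) + 2 * t * ‖v‖ ^ 2)) ?_ ?_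
  · filter_upwards [hst.eventually h1] with t ht
    simp only [hse]
    exact ht.comp t (hsd t)
  · have b1 : HasDerivAt (fun t => F' (s t))
        (F'' * (2 * inner ℝ v (x - y) + 2 * 0 * ‖v‖ ^ 2)) 0 := by
      rw [← hs0] at h2
      exact h2.comp 0 (hsd 0)
    have b2 : HasDerivAt (fun t : ℝ => 2 * inner ℝ v (x - y) + 2 * t * ‖v‖ ^ 2)
        (2 * ‖v‖ ^ 2) 0 := by
      simpa using (((hasDerivAt_id (0 : ℝ)).const_mul 2).mul_const (‖v‖ ^ 2)).const_add
        (2 * inner ℝ v (x - y))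
    refine (b1.mul b2).congr_deriv ?_
    rw [hs0]
    ring

lemma contDiff_norm_sub_sq (y : E) : ContDiff ℝ 2 (fun z : E => ‖z - y‖ ^ 2) :=
  (contDiff_id.sub contDiff_const).norm_sq ℝ

lemma quadD2_norm_sub_sq (x y v : E) : quadD2 (fun z => ‖z - y‖ ^ 2) x v = 2 * ‖v‖ ^ 2 := by
  have := quadD2_radial (F := fun s => s) (F' := fun _ => 1) (F'' := 0) (x := x) (y := y)
    (contDiff_norm_sub_sq y).contDiffAt (Eventually.of_forall fun s => hasDerivAt_id s)
    (hasDerivAt_const _ _) v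
  rw [this]
  ring

/-- The second derivative of a function of one linear coordinate. -/
lemma quadD2_comp_inner {F F' : ℝ → ℝ} {F'' : ℝ} {x e : E}
    (hφ : ContDiffAt ℝ 2 (fun z => F (inner ℝ z e)) x)
    (h1 : ∀ s, HasDerivAt F (F' s) s) (h2 : HasDerivAt F' F'' (inner ℝ x e)) (v : E) :
    quadD2 (fun z => F (inner ℝ z e)) x v = F'' * inner ℝ v e ^ 2 := by
  have hl : ∀ t : ℝ, HasDerivAt (fun t : ℝ => inner ℝ (x + t • v) e) (inner ℝ v e) t := by
    intro t
    have := ((hasDerivAt_id t).mul_const (inner ℝ v e)).const_add (inner ℝ x e)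
    simpa [inner_add_left, inner_smul_left] using this
  refine quadD2_eq_of_hasDerivAt hφ
    (g' := fun t => F' (inner ℝ (x + t • v) e) * inner ℝ v e) ?_ ?_
  · exact Eventually.of_forall fun t => (h1 _).comp t (hl t)
  · have h3 : HasDerivAt F' F'' (inner ℝ (x + (0 : ℝ) • v) e) := by simpa using h2
    exact ((h3.comp (0 : ℝ) (hl 0)).mul_const _).congr_deriv (by ring)

end InnerProduct

/-- Euclidean space of dimension `n`. -/
abbrev Euc (n : ℕ) : Type := EuclideanSpace ℝ (Fin n)

/-- Orthonormal bases of `ℝⁿ`. -/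
abbrev EucBasis (n : ℕ) : Type := OrthonormalBasis (Fin n) ℝ (Euc n)

/-- The coefficients `a` all lie between `lam` and `Lam`. -/
def IsCoef (lam Lam : ℝ) {n : ℕ} (a : Fin n → ℝ) : Prop := ∀ i, lam ≤ a i ∧ a i ≤ Lam

/-- The constant coefficient operator with eigenbasis `b` and eigenvalues `a`. -/
noncomputable def linOp {n : ℕ} (b : EucBasis n) (a : Fin n → ℝ) (φ : Euc n → ℝ) (x : Euc n) : ℝ :=
  ∑ i, a i * quadD2 φ x (b i)

section LinOp

variable {n : ℕ} {b : EucBasis n} {a : Fin n → ℝ} {φ ψ : Euc n → ℝ} {x : Euc n}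

lemma linOp_add (hφ : ContDiffAt ℝ 2 φ x) (hψ : ContDiffAt ℝ 2 ψ x) :
    linOp b a (fun y => φ y + ψ y) x = linOp b a φ x + linOp b a ψ x := by
  simp [linOp, quadD2_add hφ hψ, mul_add, Finset.sum_add_distrib]

lemma linOp_const_mul (hφ : ContDiffAt ℝ 2 φ x) (c : ℝ) :
    linOp b a (fun y => c * φ y) x = c * linOp b a φ x := by
  simp only [linOp, quadD2_const_mul hφ, Finset.mul_sum]
  exact Finset.sum_congr rfl fun i _ => by ring

lemma linOp_add_const (hφ : ContDiffAt ℝ 2 φ x) (c : ℝ) :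
    linOp b a (fun y => φ y + c) x = linOp b a φ x := by
  simp only [linOp, quadD2_add_const hφ]

lemma linOp_const (c : ℝ) : linOp b a (fun _ => c) x = 0 := by
  simp [linOp, quadD2_const]

lemma linOp_neg : linOp b a (fun y => -φ y) x = -linOp b a φ x := by
  simp [linOp, quadD2_neg]

lemma linOp_congr (h : φ =ᶠ[𝓝 x] ψ) : linOp b a φ x = linOp b a ψ x := by
  simp only [linOp, quadD2_congr h]

lemma sum_inner_sq (b : EucBasis n) (y : Euc n) : ∑ i, inner ℝ (b i) y ^ 2 = ‖y‖ ^ 2 := by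
  simpa using b.sum_sq_norm_inner_right y

lemma IsCoef.sum_le {lam Lam : ℝ} (ha : IsCoef lam Lam a) : ∑ i, a i ≤ n * Lam := by
  simpa using Finset.sum_le_card_nsmul Finset.univ a Lam fun i _ => (ha i).2

lemma IsCoef.le_sum {lam Lam : ℝ} (ha : IsCoef lam Lam a) : n * lam ≤ ∑ i, a i := by
  simpa using Finset.card_nsmul_le_sum Finset.univ a lam fun i _ => (ha i).1

lemma IsCoef.le_sum_inner {lam Lam : ℝ} (ha : IsCoef lam Lam a) (b : EucBasis n) (y : Euc n) :
    lam * ‖y‖ ^ 2 ≤ ∑ i, a i * inner ℝ (b i) y ^ 2 := by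
  rw [← sum_inner_sq b, Finset.mul_sum]
  exact Finset.sum_le_sum fun i _ => mul_le_mul_of_nonneg_right (ha i).1 (sq_nonneg _)

lemma IsCoef.sum_inner_le {lam Lam : ℝ} (ha : IsCoef lam Lam a) (b : EucBasis n) (y : Euc n) :
    ∑ i, a i * inner ℝ (b i) y ^ 2 ≤ Lam * ‖y‖ ^ 2 := by
  rw [← sum_inner_sq b, Finset.mul_sum]
  exact Finset.sum_le_sum fun i _ => mul_le_mul_of_nonneg_right (ha i).2 (sq_nonneg _)

lemma linOp_norm_sub_sq (y : Euc n) : linOp b a (fun z => ‖z - y‖ ^ 2) x = 2 * ∑ i, a i := by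
  simp [linOp, quadD2_norm_sub_sq, ← Finset.sum_mul, mul_comm]

lemma linOp_radial {F F' : ℝ → ℝ} {F'' : ℝ} {y : Euc n}
    (hφ : ContDiffAt ℝ 2 (fun z => F (‖z - y‖ ^ 2)) x)
    (h1 : ∀ᶠ s in 𝓝 (‖x - y‖ ^ 2), HasDerivAt F (F' s) s)
    (h2 : HasDerivAt F' F'' (‖x - y‖ ^ 2)) :
    linOp b a (fun z => F (‖z - y‖ ^ 2)) x =
      4 * F'' * ∑ i, a i * inner ℝ (b i) (x - y) ^ 2 + 2 * F' (‖x - y‖ ^ 2) * ∑ i, a i := by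
  simp only [linOp, quadD2_radial hφ h1 h2, Finset.mul_sum, ← Finset.sum_add_distrib]
  exact Finset.sum_congr rfl fun i _ => by simp; ring

lemma linOp_comp_inner {F F' : ℝ → ℝ} {F'' : ℝ} {e : Euc n}
    (hφ : ContDiffAt ℝ 2 (fun z => F (inner ℝ z e)) x)
    (h1 : ∀ s, HasDerivAt F (F' s) s) (h2 : HasDerivAt F' F'' (inner ℝ x e)) :
    linOp b a (fun z => F (inner ℝ z e)) x = F'' * ∑ i, a i * inner ℝ (b i) e ^ 2 := by
  simp only [linOp, quadD2_comp_inner hφ h1 h2, Finset.mul_sum]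
  exact Finset.sum_congr rfl fun i _ => by ring

end LinOp

section Pucci

variable {n : ℕ} {lam Lam : ℝ} {φ : Euc n → ℝ} {x : Euc n}

lemma hess_apply (i j : Fin n) :
    hess φ x i j =
      fderiv ℝ (fderiv ℝ φ) x (EuclideanSpace.single i 1) (EuclideanSpace.single j 1) := by
  simp [hess, iteratedFDeriv_two_apply]

lemma hess_isHermitian (hφ : ContDiffAt ℝ 2 φ x) : (hess φ x).IsHermitian := by
  ext i j
  simp only [Matrix.conjTranspose_apply, hess_apply, star_trivial]
  exact (hφ.isSymmSndFDerivAt (by simp)).eq _ _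

lemma fderiv_fderiv_eq_dotProduct (v w : Euc n) :
    fderiv ℝ (fderiv ℝ φ) x v w = ∑ i, v i * (Matrix.mulVec (hess φ x) w) i := by
  have hv : ∀ v : Euc n, v = ∑ i, v i • EuclideanSpace.single i (1 : ℝ) := fun v => by
    ext j
    simp [Finset.sum_apply, Pi.single_apply]
  conv_lhs => rw [hv v, hv w]
  simp only [map_sum, map_smul, sum_apply, smul_apply,
    smul_eq_mul, Matrix.mulVec, dotProduct, hess_apply, Finset.mul_sum]
  rw [Finset.sum_comm]
  exact Finset.sum_congr rfl fun i _ => Finset.sum_congr rfl fun j _ => by ring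

lemma quadD2_eq_sum_eigenvalues (hφ : ContDiffAt ℝ 2 φ x) (v : Euc n) :
    quadD2 φ x v = ∑ j, (hess_isHermitian hφ).eigenvalues j *
      inner ℝ v ((hess_isHermitian hφ).eigenvectorBasis j) ^ 2 := by
  set h := hess_isHermitian hφ
  set e := h.eigenvectorBasis
  have hj : ∀ w : Euc n, ∀ j, fderiv ℝ (fderiv ℝ φ) x w (e j) =
      h.eigenvalues j * inner ℝ w (e j) := by
    intro w j
    rw [fderiv_fderiv_eq_dotProduct, h.mulVec_eigenvectorBasis j]
    simp only [Pi.smul_apply, smul_eq_mul, PiLp.inner_apply, Finset.mul_sum]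
    exact Finset.sum_congr rfl fun i _ => by simp; ring
  have : quadD2 φ x v = fderiv ℝ (fderiv ℝ φ) x v (∑ j, inner ℝ (e j) v • e j) := by
    rw [e.sum_repr' v, quadD2]
  rw [this]
  simp only [map_sum, map_smul, smul_eq_mul, hj]
  exact Finset.sum_congr rfl fun j _ => by rw [real_inner_comm]; ring

lemma linOp_le_pucciMax (hφ : ContDiffAt ℝ 2 φ x) (b : EucBasis n)
    {a : Fin n → ℝ} (ha : IsCoef lam Lam a) : linOp b a φ x ≤ pucciMax lam Lam (hess φ x) := by
  set h := hess_isHermitian hφ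
  rw [pucciMax, dif_pos h]
  simp only [linOp, quadD2_eq_sum_eigenvalues hφ, Finset.mul_sum]
  rw [Finset.sum_comm]
  refine Finset.sum_le_sum fun j _ => ?_
  set w := h.eigenvectorBasis j
  have hw : ‖w‖ = 1 := h.eigenvectorBasis.orthonormal.1 j
  have h1 := ha.le_sum_inner b w
  have h2 := ha.sum_inner_le b w
  rw [hw] at h1 h2
  have h3 : ∑ i, a i * (h.eigenvalues j * inner ℝ (b i) w ^ 2) =
      h.eigenvalues j * ∑ i, a i * inner ℝ (b i) w ^ 2 := by
    rw [Finset.mul_sum]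
    exact Finset.sum_congr rfl fun i _ => by ring
  rw [h3]
  rcases le_total 0 (h.eigenvalues j) with h0 | h0
  · rw [max_eq_left h0, min_eq_right h0]
    nlinarith
  · rw [max_eq_right h0, min_eq_left h0]
    nlinarith

lemma exists_linOp_eq_pucciMax (hlL : lam ≤ Lam) (hφ : ContDiffAt ℝ 2 φ x) :
    ∃ b : EucBasis n, ∃ a : Fin n → ℝ, IsCoef lam Lam a ∧
      linOp b a φ x = pucciMax lam Lam (hess φ x) := by
  set h := hess_isHermitian hφ
  refine ⟨h.eigenvectorBasis, fun i => if 0 ≤ h.eigenvalues i then Lam else lam, fun i => ?_, ?_⟩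
  · dsimp only
    split_ifs <;> simp [hlL]
  · rw [pucciMax, dif_pos h]
    refine Finset.sum_congr rfl fun i _ => ?_
    have : quadD2 φ x (h.eigenvectorBasis i) = h.eigenvalues i := by
      rw [quadD2_eq_sum_eigenvalues hφ, Finset.sum_eq_single i]
      · simp
      · intro j _ hj
        rw [h.eigenvectorBasis.orthonormal.2 hj.symm]
        simp
      · simp
    rw [this]
    dsimp only
    split_ifs with h0
    · rw [max_eq_left h0, min_eq_right h0]
      ring
    · push Not at h0
      rw [max_eq_right h0.le, min_eq_left h0.le]
      ring

end Pucci

/-- A function which is `C²` near a point agrees near that point with a globally `C²` function. -/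
lemma ContDiffAt.exists_contDiff_eventuallyEq {n : ℕ} {φ : Euc n → ℝ} {x : Euc n}
    (hφ : ContDiffAt ℝ 2 φ x) : ∃ ψ : Euc n → ℝ, ContDiff ℝ 2 ψ ∧ ψ =ᶠ[𝓝 x] φ := by
  obtain ⟨r, hr, hball⟩ := Metric.eventually_nhds_iff_ball.1 (hφ.eventually (by simp))
  let χ : ContDiffBump x := ⟨r / 4, r / 2, by positivity, by linarith⟩
  refine ⟨fun y => χ y * φ y, contDiff_iff_contDiffAt.2 fun y => ?_, ?_⟩
  · by_cases hy : y ∈ ball x r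
    · exact χ.contDiff.contDiffAt.mul (hball y hy)
    · have hy' : y ∉ tsupport χ := by
        rw [χ.tsupport_eq]
        simp only [mem_closedBall, mem_ball, not_lt, not_le] at hy ⊢
        exact lt_of_lt_of_le (by change r / 2 < r; linarith) hy
      have : (fun y => χ y * φ y) =ᶠ[𝓝 y] fun _ => 0 := by
        filter_upwards [notMem_tsupport_iff_eventuallyEq.1 hy'] with z hz
        rw [hz]
        simp
      exact contDiffAt_const.congr_of_eventuallyEq this
  · filter_upwards [χ.eventuallyEq_one] with y hy
    simp [hy]

section Viscosity

variable {n : ℕ} {lam Lam : ℝ} {Ω : Set (Euc n)} {u g : Euc n → ℝ} {x : Euc n} {φ : Euc n → ℝ}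

lemma PucciSupersol.linOp_le (hu : PucciSupersol lam Lam Ω u g) (hx : x ∈ Ω)
    (hφ : ContDiffAt ℝ 2 φ x) (hmin : IsLocalMin (fun y => u y - φ y) x) (b : EucBasis n)
    {a : Fin n → ℝ} (ha : IsCoef lam Lam a) : linOp b a φ x + g x ≤ 0 := by
  obtain ⟨ψ, hψ, he⟩ := hφ.exists_contDiff_eventuallyEq
  have h1 : IsLocalMin (fun y => u y - ψ y) x :=
    IsLocalMin.congr hmin (he.mono fun y hy => by simp only [hy])
  have h2 := hu x hx ψ hψ h1
  have h3 := linOp_le_pucciMax hψ.contDiffAt b ha (x := x)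
  rw [linOp_congr he] at h3
  linarith

lemma pucciSupersol_of_linOp_le (hlL : lam ≤ Lam)
    (h : ∀ x ∈ Ω, ∀ φ : Euc n → ℝ, ContDiff ℝ 2 φ → IsLocalMin (fun y => u y - φ y) x →
      ∀ b : EucBasis n, ∀ a : Fin n → ℝ, IsCoef lam Lam a → linOp b a φ x + g x ≤ 0) :
    PucciSupersol lam Lam Ω u g := by
  intro x hx φ hφ hmin
  obtain ⟨b, a, ha, he⟩ := exists_linOp_eq_pucciMax hlL (hφ.contDiffAt (x := x))
  rw [← he]
  exact h x hx φ hφ hmin b a ha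

lemma PucciSubsol.exists_linOp_ge (hlL : lam ≤ Lam) (hu : PucciSubsol lam Lam Ω u g) (hx : x ∈ Ω)
    (hφ : ContDiffAt ℝ 2 φ x) (hmax : IsLocalMax (fun y => u y - φ y) x) :
    ∃ b : EucBasis n, ∃ a : Fin n → ℝ, IsCoef lam Lam a ∧ 0 ≤ linOp b a φ x + g x := by
  obtain ⟨ψ, hψ, he⟩ := hφ.exists_contDiff_eventuallyEq
  have h1 : IsLocalMax (fun y => u y - ψ y) x :=
    IsLocalMax.congr hmax (he.mono fun y hy => by simp only [hy])
  obtain ⟨b, a, ha, h3⟩ := exists_linOp_eq_pucciMax hlL (hψ.contDiffAt (x := x))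
  refine ⟨b, a, ha, ?_⟩
  rw [← linOp_congr he, h3]
  exact hu x hx ψ hψ h1

lemma pucciSubsol_of_exists_linOp
    (h : ∀ x ∈ Ω, ∀ φ : Euc n → ℝ, ContDiff ℝ 2 φ → IsLocalMax (fun y => u y - φ y) x →
      ∃ b : EucBasis n, ∃ a : Fin n → ℝ, IsCoef lam Lam a ∧ 0 ≤ linOp b a φ x + g x) :
    PucciSubsol lam Lam Ω u g := by
  intro x hx φ hφ hmax
  obtain ⟨b, a, ha, he⟩ := h x hx φ hφ hmax
  exact he.trans (add_le_add_left (linOp_le_pucciMax hφ.contDiffAt b ha) _)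

end Viscosity

section Walk

variable {n : ℕ} {d : Fin n → Euc n} {h K : ℝ} {f g : Euc n → ℝ} {x : Euc n}

/-- One step of the symmetric random walk with increments `± h • d i`. -/
noncomputable def walkStep (d : Fin n → Euc n) (h : ℝ) (f : Euc n → ℝ) (x : Euc n) : ℝ :=
  (2 * n : ℝ)⁻¹ * ∑ i, (f (x + h • d i) + f (x - h • d i))

/-- The sum of the second derivatives in the directions `d i`. -/
noncomputable def dirLap (d : Fin n → Euc n) (f : Euc n → ℝ) (x : Euc n) : ℝ :=
  ∑ i, quadD2 f x (d i)

/-- `f` is `C²` and its second derivatives in the directions `d i` are `K`-Lipschitz. -/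
def SmoothDir (d : Fin n → Euc n) (K : ℝ) (f : Euc n → ℝ) : Prop :=
  ContDiff ℝ 2 f ∧ ∀ i x y, |quadD2 f x (d i) - quadD2 f y (d i)| ≤ K * ‖x - y‖

lemma walkStep_mono (hfg : ∀ x, f x ≤ g x) (x : Euc n) : walkStep d h f x ≤ walkStep d h g x := by
  unfold walkStep
  gcongr with i
  · exact hfg _
  · exact hfg _

lemma walkStep_iterate_mono (hfg : ∀ x, f x ≤ g x) (j : ℕ) :
    ∀ x, (walkStep d h)^[j] f x ≤ (walkStep d h)^[j] g x := by
  induction j with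
  | zero => simpa using hfg
  | succ j ih =>
    intro x
    simp only [Function.iterate_succ_apply']
    exact walkStep_mono ih x

lemma walkStep_add_const (hn : 0 < n) (c : ℝ) :
    walkStep d h (fun x => f x + c) = fun x => walkStep d h f x + c := by
  ext x
  have : (n : ℝ) ≠ 0 := by positivity
  simp only [walkStep, Finset.sum_add_distrib, Finset.sum_const, Finset.card_univ, Fintype.card_fin,
    nsmul_eq_mul]
  field_simp
  ring

lemma walkStep_iterate_add_const (hn : 0 < n) (c : ℝ) (j : ℕ) :
    (walkStep d h)^[j] (fun x => f x + c) = fun x => (walkStep d h)^[j] f x + c := by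
  induction j with
  | zero => rfl
  | succ j ih =>
    rw [Function.iterate_succ_apply', ih, walkStep_add_const hn, Function.iterate_succ_apply']

lemma walkStep_quadratic (hn : 0 < n) (C₀ C₁ : ℝ) (x : Euc n) :
    walkStep d h (fun y => C₀ + C₁ * ‖y - x‖ ^ 2) =
      fun y => (C₀ + C₁ * (h ^ 2 / n * ∑ i, ‖d i‖ ^ 2)) + C₁ * ‖y - x‖ ^ 2 := by
  ext y
  have hn0 : (n : ℝ) ≠ 0 := by positivity
  have key : ∀ i, (C₀ + C₁ * ‖y + h • d i - x‖ ^ 2) + (C₀ + C₁ * ‖y - h • d i - x‖ ^ 2) =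
      2 * (C₀ + C₁ * ‖y - x‖ ^ 2) + 2 * C₁ * h ^ 2 * ‖d i‖ ^ 2 := by
    intro i
    have h1 : y + h • d i - x = (y - x) + h • d i := by abel
    have h2 : y - h • d i - x = (y - x) - h • d i := by abel
    rw [h1, h2, norm_add_sq_real (y - x), norm_sub_sq_real (y - x) (h • d i), norm_smul, mul_pow,
      Real.norm_eq_abs, sq_abs]
    ring
  simp only [walkStep, key, Finset.sum_add_distrib, Finset.sum_const, Finset.card_univ,
    Fintype.card_fin, nsmul_eq_mul, ← Finset.mul_sum]
  field_simp
  ring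

lemma walkStep_iterate_quadratic (hn : 0 < n) (C₀ C₁ : ℝ) (x : Euc n) (j : ℕ) :
    (walkStep d h)^[j] (fun y => C₀ + C₁ * ‖y - x‖ ^ 2) =
      fun y => (C₀ + j * (C₁ * (h ^ 2 / n * ∑ i, ‖d i‖ ^ 2))) + C₁ * ‖y - x‖ ^ 2 := by
  induction j with
  | zero => ext y; simp
  | succ j ih =>
    rw [Function.iterate_succ_apply', ih, walkStep_quadratic hn]
    ext y
    push_cast
    ring

lemma quadD2_comp_add_right (f : Euc n → ℝ) (w x v : Euc n) :
    quadD2 (fun y => f (y + w)) x v = quadD2 f (x + w) v := by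
  unfold quadD2
  have : fderiv ℝ (fun y => f (y + w)) = fun y => fderiv ℝ f (y + w) := by
    ext1 y
    exact fderiv_comp_add_right w
  rw [this, fderiv_comp_add_right]

lemma quadD2_sum {ι : Type*} (s : Finset ι) (F : ι → Euc n → ℝ)
    (hF : ∀ i ∈ s, ContDiffAt ℝ 2 (F i) x) (v : Euc n) :
    quadD2 (fun y => ∑ i ∈ s, F i y) x v = ∑ i ∈ s, quadD2 (F i) x v := by
  classical
  induction s using Finset.induction_on with
  | empty => simp [quadD2_const]
  | insert i s hi ih =>
    simp only [Finset.sum_insert hi]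
    rw [quadD2_add (hF i (by simp)) (ContDiffAt.sum fun j hj => hF j (by simp [hj])),
      ih fun j hj => hF j (by simp [hj])]

lemma ContDiff.walkStep (hf : ContDiff ℝ 2 f) : ContDiff ℝ 2 (walkStep d h f) := by
  unfold _root_.walkStep
  fun_prop

lemma Continuous.walkStep (hf : Continuous f) : Continuous (walkStep d h f) := by
  unfold _root_.walkStep
  fun_prop

lemma Continuous.walkStep_iterate (hf : Continuous f) (j : ℕ) :
    Continuous ((_root_.walkStep d h)^[j] f) := by
  induction j with
  | zero => simpa using hf
  | succ j ih => rw [Function.iterate_succ_apply']; exact ih.walkStep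

lemma quadD2_walkStep (hf : ContDiff ℝ 2 f) (x v : Euc n) :
    quadD2 (walkStep d h f) x v = walkStep d h (fun y => quadD2 f y v) x := by
  have h1 : ∀ w : Euc n, ContDiff ℝ 2 fun y => f (y + w) := fun w => by fun_prop
  unfold walkStep
  simp only [sub_eq_add_neg]
  rw [quadD2_const_mul (ContDiffAt.sum fun i _ => ((h1 _).add (h1 _)).contDiffAt), quadD2_sum]
  · congr 1
    refine Finset.sum_congr rfl fun i _ => ?_
    rw [quadD2_add (h1 _).contDiffAt (h1 _).contDiffAt, quadD2_comp_add_right,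
      quadD2_comp_add_right]
  · exact fun i _ => ((h1 _).add (h1 _)).contDiffAt

lemma dirLap_walkStep (hf : ContDiff ℝ 2 f) :
    dirLap d (walkStep d h f) = walkStep d h (dirLap d f) := by
  ext x
  simp only [dirLap, quadD2_walkStep hf, walkStep, ← Finset.mul_sum]
  rw [Finset.sum_comm]
  simp [Finset.sum_add_distrib]

lemma abs_walkStep_sub_le (hn : 0 < n) {F G : Euc n → ℝ} {B : ℝ} {x y : Euc n}
    (hB : ∀ i, |F (x + h • d i) - G (y + h • d i)| ≤ B ∧ |F (x - h • d i) - G (y - h • d i)| ≤ B) :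
    |walkStep d h F x - walkStep d h G y| ≤ B := by
  have hn0 : (0 : ℝ) < n := by positivity
  unfold walkStep
  rw [← mul_sub, ← Finset.sum_sub_distrib, abs_mul, abs_of_pos (by positivity)]
  have : |∑ i, (F (x + h • d i) + F (x - h • d i) - (G (y + h • d i) + G (y - h • d i)))| ≤
      ∑ _i : Fin n, 2 * B := by
    refine (Finset.abs_sum_le_sum_abs _ _).trans (Finset.sum_le_sum fun i _ => ?_)
    have e : F (x + h • d i) + F (x - h • d i) - (G (y + h • d i) + G (y - h • d i)) =
      (F (x + h • d i) - G (y + h • d i)) + (F (x - h • d i) - G (y - h • d i)) := by ring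
    rw [e]
    refine (abs_add_le _ _).trans ?_
    linarith [(hB i).1, (hB i).2]
  rw [Finset.sum_const, Finset.card_univ, Fintype.card_fin, nsmul_eq_mul] at this
  calc _ ≤ (2 * (n : ℝ))⁻¹ * (n * (2 * B)) := by gcongr
    _ = B := by field_simp

lemma SmoothDir.walkStep (hn : 0 < n) (hf : SmoothDir d K f) : SmoothDir d K (walkStep d h f) := by
  refine ⟨hf.1.walkStep, fun i x y => ?_⟩
  rw [quadD2_walkStep hf.1, quadD2_walkStep hf.1]
  refine abs_walkStep_sub_le hn fun k => ⟨?_, ?_⟩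
  · simpa using hf.2 i (x + h • d k) (y + h • d k)
  · simpa using hf.2 i (x - h • d k) (y - h • d k)

lemma SmoothDir.walkStep_iterate (hn : 0 < n) (hf : SmoothDir d K f) (j : ℕ) :
    SmoothDir d K ((_root_.walkStep d h)^[j] f) := by
  induction j with
  | zero => simpa using hf
  | succ j ih => rw [Function.iterate_succ_apply']; exact ih.walkStep hn

lemma dirLap_walkStep_iterate (hn : 0 < n) (hf : SmoothDir d K f) (j : ℕ) :
    dirLap d ((walkStep d h)^[j] f) = (walkStep d h)^[j] (dirLap d f) := by
  induction j with
  | zero => rfl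
  | succ j ih =>
    rw [Function.iterate_succ_apply', dirLap_walkStep (hf.walkStep_iterate hn j).1, ih,
      Function.iterate_succ_apply']

lemma SmoothDir.abs_dirLap_sub_le (hf : SmoothDir d K f) (x y : Euc n) :
    |dirLap d f x - dirLap d f y| ≤ n * K * ‖x - y‖ := by
  unfold dirLap
  rw [← Finset.sum_sub_distrib]
  refine (Finset.abs_sum_le_sum_abs _ _).trans ?_
  refine (Finset.sum_le_sum fun i _ => hf.2 i x y).trans ?_
  simp [mul_assoc]

lemma SmoothDir.abs_dirLap_walkStep_sub_le (hn : 0 < n) (hK : 0 ≤ K) (hh : 0 ≤ h)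
    (hf : SmoothDir d K f) (x : Euc n) :
    |dirLap d (_root_.walkStep d h f) x - dirLap d f x| ≤ n * K * (∑ i, ‖d i‖) * h := by
  rw [dirLap_walkStep hf.1]
  have hc : _root_.walkStep d h (fun _ => dirLap d f x) x = dirLap d f x := by
    have : (n : ℝ) ≠ 0 := by positivity
    simp [_root_.walkStep]
    field_simp
    ring
  rw [← hc]
  have hd : ∀ i, ‖d i‖ ≤ ∑ i, ‖d i‖ := fun i =>
    Finset.single_le_sum (f := fun i => ‖d i‖) (fun i _ => norm_nonneg _) (Finset.mem_univ i)
  refine abs_walkStep_sub_le hn fun i => ?_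
  have h1 := hf.abs_dirLap_sub_le (x + h • d i) x
  have h2 := hf.abs_dirLap_sub_le (x - h • d i) x
  simp only [add_sub_cancel_left, norm_smul, Real.norm_eq_abs, abs_of_nonneg hh] at h1
  rw [show x - h • d i - x = -(h • d i) by abel, norm_neg, norm_smul, Real.norm_eq_abs,
    abs_of_nonneg hh] at h2
  have h3 : n * K * (h * ‖d i‖) ≤ n * K * (∑ i, ‖d i‖) * h := by
    rw [mul_assoc, mul_assoc, mul_assoc, mul_comm _ h]
    have := hd i
    gcongr
  exact ⟨h1.trans h3, h2.trans h3⟩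

/-- Second order Taylor expansion along a line with Lipschitz second derivative. -/
lemma abs_symm_diff_le {g g' g'' : ℝ → ℝ} {M h : ℝ} (hh : 0 ≤ h) (hM : 0 ≤ M)
    (h1 : ∀ t, HasDerivAt g (g' t) t) (h2 : ∀ t, HasDerivAt g' (g'' t) t)
    (hL : ∀ t, |g'' t - g'' 0| ≤ M * |t|) :
    |g h + g (-h) - 2 * g 0 - h ^ 2 * g'' 0| ≤ 2 * M * h ^ 3 := by
  set w : ℝ → ℝ := fun s => g s + g (-s) - 2 * g 0 - s ^ 2 * g'' 0
  set w' : ℝ → ℝ := fun s => g' s - g' (-s) - 2 * s * g'' 0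
  have hw : ∀ s, HasDerivAt w (w' s) s := fun s => by
    have a1 := (h1 (-s)).comp s (hasDerivAt_neg s)
    have a2 := (hasDerivAt_pow 2 s).mul_const (g'' 0)
    refine ((((h1 s).add a1).sub_const (2 * g 0)).sub a2).congr_deriv ?_
    simp [w']
    ring
  have hw' : ∀ s, HasDerivAt w' (g'' s + g'' (-s) - 2 * g'' 0) s := fun s => by
    have a1 := (h2 (-s)).comp s (hasDerivAt_neg s)
    have a2 := ((hasDerivAt_id s).const_mul 2).mul_const (g'' 0)
    refine (((h2 s).sub a1).sub a2).congr_deriv ?_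
    simp
  have b1 : ∀ s ∈ Icc 0 h, ‖w' s‖ ≤ 2 * M * h * h := by
    intro s hs
    have := (convex_Icc (0 : ℝ) h).norm_image_sub_le_of_norm_hasDerivWithin_le (C := 2 * M * h)
      (fun t _ => (hw' t).hasDerivWithinAt) (fun t ht => ?_) (left_mem_Icc.2 hh) hs
    · have e : w' 0 = 0 := by simp [w']
      rw [e, sub_zero, sub_zero, Real.norm_eq_abs s, abs_of_nonneg hs.1] at this
      refine this.trans ?_
      have := hs.2
      gcongr
    · have c1 := hL t
      have c2 := hL (-t)
      rw [abs_neg] at c2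
      rw [abs_of_nonneg ht.1] at c1 c2
      have e : g'' t + g'' (-t) - 2 * g'' 0 = (g'' t - g'' 0) + (g'' (-t) - g'' 0) := by ring
      rw [e, Real.norm_eq_abs]
      refine (abs_add_le _ _).trans ?_
      have : M * t ≤ M * h := mul_le_mul_of_nonneg_left ht.2 hM
      linarith
  have := (convex_Icc (0 : ℝ) h).norm_image_sub_le_of_norm_hasDerivWithin_le
      (fun t _ => (hw t).hasDerivWithinAt) b1 (left_mem_Icc.2 hh) (right_mem_Icc.2 hh)
  have e : w 0 = 0 := by simp [w]; ring
  rw [e, sub_zero, sub_zero, Real.norm_eq_abs, Real.norm_eq_abs, abs_of_nonneg hh] at this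
  refine this.trans (le_of_eq ?_)
  ring

lemma SmoothDir.abs_walkStep_sub_le (hn : 0 < n) (hK : 0 ≤ K) (hh : 0 ≤ h)
    (hf : SmoothDir d K f) (x : Euc n) :
    |_root_.walkStep d h f x - f x - h ^ 2 / (2 * n) * dirLap d f x| ≤
      h ^ 2 / (2 * n) * (2 * K * (∑ i, ‖d i‖) * h) := by
  have hn0 : (n : ℝ) ≠ 0 := by positivity
  have key : ∀ i, |f (x + h • d i) + f (x - h • d i) - 2 * f x - h ^ 2 * quadD2 f x (d i)| ≤
      2 * (K * ‖d i‖) * h ^ 3 := by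
    intro i
    have l1 : ∀ t : ℝ, HasDerivAt (fun t : ℝ => f (x + t • d i)) (fderiv ℝ f (x + t • d i) (d i)) t
        ∧ HasDerivAt (fun t : ℝ => fderiv ℝ f (x + t • d i) (d i)) (quadD2 f (x + t • d i) (d i))
          t := by
      intro t
      obtain ⟨k1, k2⟩ := hasDerivAt_deriv_line (hf.1.contDiffAt (x := x + t • d i)) (d i)
      have k1' := k1.self_of_nhds
      have e : ∀ s : ℝ, x + t • d i + (s - t) • d i = x + s • d i := fun s => by
        rw [sub_smul]; abel
      constructor
      · have := HasDerivAt.comp_sub_const (x := t) (a := t) (f' := fderiv ℝ f (x + t • d i) (d i))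
          (f := fun s : ℝ => f (x + t • d i + s • d i)) (by simpa using k1')
        simpa only [e] using this
      · have := HasDerivAt.comp_sub_const (x := t) (a := t)
          (f := fun s : ℝ => fderiv ℝ f (x + t • d i + s • d i) (d i)) (by simpa using k2)
        simpa only [e] using this
    have := abs_symm_diff_le hh (mul_nonneg hK (norm_nonneg (d i))) (fun t => (l1 t).1)
      (fun t => (l1 t).2) (fun t => by
        have := hf.2 i (x + t • d i) (x + (0 : ℝ) • d i)
        refine this.trans (le_of_eq ?_)
        simp [norm_smul]
        ring)
    simpa [sub_eq_add_neg] using this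
  have e : _root_.walkStep d h f x - f x - h ^ 2 / (2 * n) * dirLap d f x =
      (2 * (n : ℝ))⁻¹ * ∑ i, (f (x + h • d i) + f (x - h • d i) - 2 * f x
        - h ^ 2 * quadD2 f x (d i)) := by
    simp only [_root_.walkStep, dirLap, Finset.sum_sub_distrib, ← Finset.mul_sum, Finset.sum_const,
      Finset.card_univ, Fintype.card_fin, nsmul_eq_mul]
    field_simp
  rw [e, abs_mul, abs_of_pos (by positivity : (0 : ℝ) < (2 * n : ℝ)⁻¹)]
  calc _ ≤ (2 * (n : ℝ))⁻¹ * ∑ i, 2 * (K * ‖d i‖) * h ^ 3 := by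
        gcongr
        exact (Finset.abs_sum_le_sum_abs _ _).trans (Finset.sum_le_sum fun i _ => key i)
    _ = _ := by
        rw [← Finset.sum_mul, ← Finset.mul_sum, ← Finset.mul_sum]
        field_simp

end Walk

section Comparison

variable {n : ℕ} {d : Fin n → Euc n} {h K r c : ℝ} {f v w : Euc n → ℝ} {x₀ : Euc n}

/-- `v` satisfies `dirLap d v ≤ -c` in the viscosity sense in `Ω`. -/
def DirSupersol (d : Fin n → Euc n) (c : ℝ) (Ω : Set (Euc n)) (v : Euc n → ℝ) : Prop :=
  ∀ x ∈ Ω, ∀ φ : Euc n → ℝ, ContDiff ℝ 2 φ → IsLocalMin (fun y => v y - φ y) x → dirLap d φ x ≤ -c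

lemma walk_comparison (hn : 0 < n) (hK : 0 ≤ K) (hh : 0 ≤ h) (hv : ContinuousOn v (closedBall x₀ r))
    (hsup : DirSupersol d c (ball x₀ r) v) (hf : SmoothDir d K f)
    (hfv : ∀ x ∈ closedBall x₀ r, f x ≤ v x) (J : ℕ)
    (hsph : ∀ j ≤ J, ∀ x ∈ sphere x₀ r,
      (walkStep d h)^[j] f x + c * (j * (h ^ 2 / (2 * n))) ≤ v x) :
    ∀ j ≤ J, ∀ x ∈ closedBall x₀ r, (walkStep d h)^[j] f x + c * (j * (h ^ 2 / (2 * n))) ≤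
      v x + j * (h ^ 2 / (2 * n)) * ((n + 2) * K * (∑ i, ‖d i‖) * h) := by
  intro j
  induction j with
  | zero => simpa using hfv
  | succ j ih =>
    intro hj x hx
    have ih := ih (by omega)
    set τ := h ^ 2 / (2 * (n : ℝ))
    have hτ : 0 ≤ τ := by positivity
    set S := ∑ i, ‖d i‖
    have hS : 0 ≤ S := Finset.sum_nonneg fun i _ => norm_nonneg _
    set f' := (walkStep d h)^[j] f
    have hf' : SmoothDir d K f' := hf.walkStep_iterate hn j
    rw [Function.iterate_succ_apply']
    obtain ⟨y, hy, hmax⟩ := (isCompact_closedBall x₀ r).exists_isMaxOn ⟨x, hx⟩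
      ((hf'.walkStep (h := h) hn).1.continuous.continuousOn.sub hv)
    have hxy : walkStep d h f' x - v x ≤ walkStep d h f' y - v y := hmax hx
    have herr : 0 ≤ (n + 2) * K * S * h := by positivity
    have hgoal : walkStep d h f' y - v y + c * ((j + 1 : ℕ) * τ) ≤
        (j + 1 : ℕ) * τ * ((n + 2) * K * S * h) := by
      by_cases hys : y ∈ sphere x₀ r
      · have := hsph (j + 1) hj y hys
        rw [Function.iterate_succ_apply'] at this
        have h2 : 0 ≤ ((j + 1 : ℕ) : ℝ) * τ * ((n + 2) * K * S * h) := by positivity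
        linarith
      · have hyb : y ∈ ball x₀ r := by
          rw [mem_ball]
          exact lt_of_le_of_ne (mem_closedBall.1 hy) hys
        have hloc : IsLocalMin (fun z => v z - walkStep d h f' z) y := by
          filter_upwards [isOpen_ball.mem_nhds hyb] with z hz
          have : walkStep d h f' z - v z ≤ walkStep d h f' y - v y :=
            hmax (ball_subset_closedBall hz)
          linarith
        have h1 := hsup y hyb _ (hf'.walkStep hn).1 hloc
        have h2 := (abs_le.1 (hf'.abs_walkStep_sub_le hn hK hh y)).2
        have h3 := (abs_le.1 (hf'.abs_dirLap_walkStep_sub_le hn hK hh y)).1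
        have h4 := ih y hy
        have h5 : τ * dirLap d f' y ≤ τ * (-c + n * K * S * h) :=
          mul_le_mul_of_nonneg_left (by linarith) hτ
        push_cast
        nlinarith
    linarith

lemma walkStep_iterate_le_quadratic (hn : 0 < n) {C₀ C₁ : ℝ} {x : Euc n}
    (hf : ∀ y, f y ≤ C₀ + C₁ * ‖y - x‖ ^ 2) (j : ℕ) :
    (walkStep d h)^[j] f x ≤ C₀ + C₁ * (j * (h ^ 2 / n * ∑ i, ‖d i‖ ^ 2)) := by
  have := walkStep_iterate_mono (d := d) (h := h) hf j x
  rw [walkStep_iterate_quadratic hn] at this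
  simp only [sub_self, norm_zero] at this
  linarith

lemma le_walkStep_iterate_quadratic (hn : 0 < n) {C₀ C₁ : ℝ} {x : Euc n}
    (hf : ∀ y, C₀ + C₁ * ‖y - x‖ ^ 2 ≤ f y) (j : ℕ) :
    C₀ + C₁ * (j * (h ^ 2 / n * ∑ i, ‖d i‖ ^ 2)) ≤ (walkStep d h)^[j] f x := by
  have := walkStep_iterate_mono (d := d) (h := h) hf j x
  rw [walkStep_iterate_quadratic hn] at this
  simp only [sub_self, norm_zero] at this
  linarith

/-- Lower bound for the iterates of the walk in terms of the generator at the starting point. -/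
lemma SmoothDir.le_walkStep_iterate (hn : 0 < n) (hK : 0 ≤ K) (hh : 0 ≤ h) (hf : SmoothDir d K f)
    (x : Euc n) {δ : ℝ} (hδ : 0 < δ) {T : ℝ} (j : ℕ) (hj : j * (h ^ 2 / (2 * n)) ≤ T) :
    f x + j * (h ^ 2 / (2 * n)) * (dirLap d f x - δ - (n * K) ^ 2 / δ * (T * ∑ i, ‖d i‖ ^ 2)
      - 2 * K * (∑ i, ‖d i‖) * h) ≤ (_root_.walkStep d h)^[j] f x := by
  set τ := h ^ 2 / (2 * (n : ℝ)) with hτd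
  have hτ : 0 ≤ τ := by positivity
  set S := ∑ i, ‖d i‖
  set S2 := ∑ i, ‖d i‖ ^ 2
  have hS2 : 0 ≤ S2 := Finset.sum_nonneg fun i _ => sq_nonneg _
  have hn0 : (0 : ℝ) < n := by positivity
  have hL : ∀ y, (dirLap d f x - δ) + (-((n * K) ^ 2 / (2 * δ))) * ‖y - x‖ ^ 2 ≤ dirLap d f y := by
    intro y
    have h1 := (abs_le.1 (hf.abs_dirLap_sub_le y x)).1
    have h2 : n * K * ‖y - x‖ ≤ δ + (n * K) ^ 2 / (2 * δ) * ‖y - x‖ ^ 2 := by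
      have : δ + (n * K) ^ 2 / (2 * δ) * ‖y - x‖ ^ 2 - n * K * ‖y - x‖ =
          (δ ^ 2 + (δ - n * K * ‖y - x‖) ^ 2) / (2 * δ) := by
        field_simp
        ring
      have : 0 ≤ (δ ^ 2 + (δ - n * K * ‖y - x‖) ^ 2) / (2 * δ) := by positivity
      linarith
    linarith
  have hτ2 : h ^ 2 / n = 2 * τ := by rw [hτd]; field_simp
  induction j with
  | zero => simp
  | succ j ih =>
    push_cast at hj
    have hjT : j * τ ≤ T := by nlinarith
    have ih := ih hjT
    rw [Function.iterate_succ_apply']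
    have h1 := (abs_le.1 ((hf.walkStep_iterate (h := h) hn j).abs_walkStep_sub_le hn hK hh x)).1
    rw [dirLap_walkStep_iterate hn hf] at h1
    have h2 := le_walkStep_iterate_quadratic (d := d) (h := h) hn hL j
    have h3 : (n * K) ^ 2 / (2 * δ) * (j * (h ^ 2 / n * S2)) ≤ (n * K) ^ 2 / δ * (T * S2) := by
      rw [hτ2]
      calc (n * K) ^ 2 / (2 * δ) * (j * (2 * τ * S2)) = (n * K) ^ 2 / δ * ((j * τ) * S2) := by
            field_simp
        _ ≤ _ := by gcongr
    have h4 : τ * (dirLap d f x - δ - (n * K) ^ 2 / δ * (T * S2)) ≤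
        τ * (_root_.walkStep d h)^[j] (dirLap d f) x := mul_le_mul_of_nonneg_left (by linarith) hτ
    push_cast
    nlinarith

end Comparison

section Mollify

variable {n : ℕ} {d : Fin n → Euc n} {h ρ : ℝ} {w w₁ w₂ : Euc n → ℝ} {x : Euc n}

/-- A normalized smooth bump function supported in the ball of radius `ρ`. -/
noncomputable def mollKernel (n : ℕ) (ρ : ℝ) (hρ : 0 < ρ) : Euc n → ℝ :=
  (⟨ρ / 2, ρ, by positivity, by linarith⟩ : ContDiffBump (0 : Euc n)).normed MeasureTheory.volume

open MeasureTheory Convolution in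
/-- Mollification at scale `ρ`. -/
noncomputable def mollify (ρ : ℝ) (hρ : 0 < ρ) (w : Euc n → ℝ) : Euc n → ℝ :=
  mollKernel n ρ hρ ⋆[ContinuousLinearMap.lsmul ℝ ℝ, volume] w

lemma mollKernel_continuous (hρ : 0 < ρ) : Continuous (mollKernel n ρ hρ) :=
  ContDiffBump.continuous_normed _

lemma mollKernel_hasCompactSupport (hρ : 0 < ρ) : HasCompactSupport (mollKernel n ρ hρ) :=
  ContDiffBump.hasCompactSupport_normed _

lemma mollify_apply (hρ : 0 < ρ) (w : Euc n → ℝ) (x : Euc n) :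
    mollify ρ hρ w x = ∫ y, mollKernel n ρ hρ y * w (x - y) := by
  simp [mollify, MeasureTheory.convolution_def]

lemma mollify_integrable (hρ : 0 < ρ) (hw : Continuous w) (x : Euc n) :
    MeasureTheory.Integrable fun y => mollKernel n ρ hρ y * w (x - y) :=
  ((mollKernel_continuous hρ).mul (by fun_prop)).integrable_of_hasCompactSupport
    (mollKernel_hasCompactSupport hρ).mul_right

lemma mollify_le_add (hρ : 0 < ρ) (h₁ : Continuous w₁) (h₂ : Continuous w₂) {e : ℝ}
    (hle : ∀ y ∈ ball x ρ, w₁ y ≤ w₂ y + e) : mollify ρ hρ w₁ x ≤ mollify ρ hρ w₂ x + e := by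
  have h3 : mollify ρ hρ w₂ x + e = ∫ y, mollKernel n ρ hρ y * (w₂ (x - y) + e) := by
    simp only [mul_add]
    rw [MeasureTheory.integral_add (mollify_integrable hρ h₂ x)
      (mollify_integrable hρ (w := fun _ => e) continuous_const x), mollify_apply,
      MeasureTheory.integral_mul_const]
    congr 1
    rw [mollKernel, ContDiffBump.integral_normed, one_mul]
  rw [h3, mollify_apply]
  refine MeasureTheory.integral_mono (mollify_integrable hρ h₁ x)
    (mollify_integrable hρ (w := fun y => w₂ y + e) (by fun_prop) x) fun y => ?_
  by_cases hy : y ∈ ball (0 : Euc n) ρ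
  · refine mul_le_mul_of_nonneg_left (hle _ ?_) (ContDiffBump.nonneg_normed _ _)
    simpa [mem_ball, dist_eq_norm] using hy
  · have : mollKernel n ρ hρ y = 0 := by
      by_contra h0
      have : y ∈ Function.support (mollKernel n ρ hρ) := h0
      rw [mollKernel, ContDiffBump.support_normed_eq] at this
      exact hy this
    simp [this]

lemma mollify_walkStep (hρ : 0 < ρ) (hw : Continuous w) :
    mollify ρ hρ (walkStep d h w) = walkStep d h (mollify ρ hρ w) := by
  ext x
  have e : ∀ z : Euc n, mollify ρ hρ w (x + z) = ∫ y, mollKernel n ρ hρ y * w (x - y + z) := by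
    intro z
    rw [mollify_apply]
    congr 1
    ext y
    rw [show x + z - y = x - y + z by abel]
  have hi : ∀ z : Euc n, MeasureTheory.Integrable fun y => mollKernel n ρ hρ y * w (x - y + z) :=
    fun z => mollify_integrable hρ (w := fun y => w (y + z)) (by fun_prop) x
  simp only [mollify_apply hρ (walkStep d h w), walkStep, sub_eq_add_neg _ (h • _), e]
  have : ∀ y, mollKernel n ρ hρ y * ((2 * (n : ℝ))⁻¹ * ∑ i, (w (x - y + h • d i) +
      w (x - y + -(h • d i)))) = (2 * (n : ℝ))⁻¹ * ∑ i, (mollKernel n ρ hρ y * w (x - y + h • d i) +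
        mollKernel n ρ hρ y * w (x - y + -(h • d i))) := by
    intro y
    simp only [← mul_add, ← Finset.mul_sum]
    ring
  simp only [this]
  rw [MeasureTheory.integral_const_mul, MeasureTheory.integral_finsetSum]
  · congr 1
    exact Finset.sum_congr rfl fun i _ => MeasureTheory.integral_add (hi _) (hi _)
  · exact fun i _ => (hi _).add (hi _)

lemma mollify_walkStep_iterate (hρ : 0 < ρ) (hw : Continuous w) (j : ℕ) :
    mollify ρ hρ ((walkStep d h)^[j] w) = (walkStep d h)^[j] (mollify ρ hρ w) := by
  induction j with
  | zero => rfl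
  | succ j ih =>
    rw [Function.iterate_succ_apply', mollify_walkStep hρ (hw.walkStep_iterate j), ih,
      Function.iterate_succ_apply']

lemma mollify_contDiff (hρ : 0 < ρ) (hw : Continuous w) : ContDiff ℝ 3 (mollify ρ hρ w) := by
  refine (mollKernel_hasCompactSupport hρ).contDiff_convolution_left _ ?_ hw.locallyIntegrable
  exact ContDiffBump.contDiff_normed (n := 3) _

lemma HasCompactSupport.exists_lipschitzWith_fderiv_fderiv {V : Euc n → ℝ}
    (hVc : HasCompactSupport V)
    (hV : ContDiff ℝ 3 V) : ∃ C : NNReal, LipschitzWith C (fderiv ℝ (fderiv ℝ V)) := by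
  have h1 : ContDiff ℝ 1 (fderiv ℝ (fderiv ℝ V)) :=
    (hV.fderiv_right (m := 2) (by norm_num)).fderiv_right (m := 1) (by norm_num)
  have h2 : HasCompactSupport (fderiv ℝ (fderiv ℝ V)) := (hVc.fderiv ℝ).fderiv ℝ
  exact h1.lipschitzWith_of_hasCompactSupport h2 (by norm_num)
lemma abs_quadD2_sub_le {V : Euc n → ℝ} {C : NNReal}
    (hC : LipschitzWith C (fderiv ℝ (fderiv ℝ V))) (i : Fin n) (x y : Euc n) :
    |quadD2 V x (d i) - quadD2 V y (d i)| ≤ (C * ∑ i, ‖d i‖ ^ 2) * ‖x - y‖ := by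
  unfold quadD2
  have h2 : fderiv ℝ (fderiv ℝ V) x (d i) (d i) - fderiv ℝ (fderiv ℝ V) y (d i) (d i) =
    (fderiv ℝ (fderiv ℝ V) x - fderiv ℝ (fderiv ℝ V) y) (d i) (d i) := by simp
  have h3 := hC.dist_le_mul x y
  rw [dist_eq_norm, dist_eq_norm] at h3
  have h4 : ‖d i‖ ^ 2 ≤ ∑ i, ‖d i‖ ^ 2 :=
    Finset.single_le_sum (f := fun i => ‖d i‖ ^ 2) (fun i _ => sq_nonneg _) (Finset.mem_univ i)
  rw [h2, ← Real.norm_eq_abs]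
  calc _ ≤ ‖fderiv ℝ (fderiv ℝ V) x - fderiv ℝ (fderiv ℝ V) y‖ * ‖d i‖ * ‖d i‖ :=
        ContinuousLinearMap.le_opNorm₂ _ _ _
    _ = ‖fderiv ℝ (fderiv ℝ V) x - fderiv ℝ (fderiv ℝ V) y‖ * ‖d i‖ ^ 2 := by ring
    _ ≤ (C * ‖x - y‖) * ∑ i, ‖d i‖ ^ 2 := by gcongr
    _ = _ := by ring

lemma HasCompactSupport.exists_smoothDir {V : Euc n → ℝ} (hVc : HasCompactSupport V)
    (hV : ContDiff ℝ 3 V) (d : Fin n → Euc n) : ∃ K, 0 ≤ K ∧ SmoothDir d K V := by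
  obtain ⟨C, hC⟩ := hVc.exists_lipschitzWith_fderiv_fderiv hV
  have h0 : (0 : ℝ) ≤ C * ∑ i, ‖d i‖ ^ 2 :=
    mul_nonneg C.2 (Finset.sum_nonneg fun i _ => sq_nonneg _)
  have h2 : ContDiff ℝ 2 V := hV.of_le (by norm_num)
  exact ⟨_, h0, h2, abs_quadD2_sub_le hC⟩

lemma mollify_hasCompactSupport (hρ : 0 < ρ) (hc : HasCompactSupport w) :
    HasCompactSupport (mollify ρ hρ w) :=
  HasCompactSupport.convolution _ (mollKernel_hasCompactSupport hρ) hc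

lemma mollify_smoothDir (hρ : 0 < ρ) (hw : Continuous w) (hc : HasCompactSupport w)
    (d : Fin n → Euc n) : ∃ K, 0 ≤ K ∧ SmoothDir d K (mollify ρ hρ w) :=
  (mollify_hasCompactSupport hρ hc).exists_smoothDir (mollify_contDiff hρ hw) d

lemma abs_mollify_sub_le (hρ : 0 < ρ) (hw : Continuous w) {e : ℝ}
    (he : ∀ y ∈ ball x ρ, |w y - w x| ≤ e) : |mollify ρ hρ w x - w x| ≤ e := by
  have := ContDiffBump.dist_normed_convolution_le
    (φ := (⟨ρ / 2, ρ, by positivity, by linarith⟩ : ContDiffBump (0 : Euc n)))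
    (μ := MeasureTheory.volume) (g := w) (x₀ := x) (ε := e) hw.aestronglyMeasurable
    (fun y hy => by rw [Real.dist_eq]; exact he y hy)
  rwa [Real.dist_eq] at this

lemma exists_mollify_approx (hw : Continuous w) (hc : HasCompactSupport w) {e : ℝ} (he : 0 < e) :
    ∃ ρ₀ > 0, ∀ ρ, ∀ hρ : 0 < ρ, ρ ≤ ρ₀ → ∀ x, |mollify ρ hρ w x - w x| ≤ e := by
  obtain ⟨δ, hδ, H⟩ := Metric.uniformContinuous_iff.1 (hc.uniformContinuous_of_continuous hw)
    e he
  refine ⟨δ, hδ, fun ρ hρ hle x => abs_mollify_sub_le hρ hw fun y hy => ?_⟩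
  have := H (lt_of_lt_of_le (mem_ball.1 hy) hle)
  rw [Real.dist_eq] at this
  exact this.le

end Mollify

section SmoothApproximation

variable {n : ℕ} {d : Fin n → Euc n} {r c : ℝ} {v w : Euc n → ℝ} {x₀ : Euc n}

lemma exists_walk_iterate_le (hn : 0 < n) {r' M : ℝ} (hr' : r' < r)
    (hv : ContinuousOn v (closedBall x₀ r)) (hsup : DirSupersol d c (ball x₀ r) v)
    (hw : Continuous w) (hwc : HasCompactSupport w) (hM : 0 ≤ M) (hwM : ∀ y, w y ≤ M)
    (hw0 : ∀ y, y ∉ closedBall x₀ r' → w y = 0) (hwv : ∀ y ∈ closedBall x₀ r, w y ≤ v y)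
    (hv1 : ∀ y ∈ closedBall x₀ r, 1 ≤ v y) :
    ∃ T > (0 : ℝ), ∀ ε > (0 : ℝ), ∃ h₀ > (0 : ℝ), ∀ h : ℝ, 0 ≤ h → h ≤ h₀ → ∀ j : ℕ,
      j * (h ^ 2 / (2 * n)) ≤ T →
      ∀ x ∈ closedBall x₀ r, (walkStep d h)^[j] w x + c * (j * (h ^ 2 / (2 * n))) ≤ v x + ε := by
  set S2 := ∑ i, ‖d i‖ ^ 2
  set S := ∑ i, ‖d i‖
  have hS : 0 ≤ S := Finset.sum_nonneg fun i _ => norm_nonneg _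
  have hS2 : 0 ≤ S2 := Finset.sum_nonneg fun i _ => sq_nonneg _
  have hn0 : (0 : ℝ) < n := by positivity
  have hrr : 0 < r - r' := by linarith
  set C₁ := M / (r - r') ^ 2
  have hC₁ : 0 ≤ C₁ := by positivity
  set T := 1 / (2 * C₁ * S2 + |c| + 1)
  have hT : 0 < T := by positivity
  refine ⟨T, hT, fun ε hε => ?_⟩
  obtain ⟨ρ, hρ, happ⟩ := exists_mollify_approx hw hwc (e := ε / 4) (by linarith)
  have happ := happ ρ hρ le_rfl
  obtain ⟨K, hK, hsm⟩ := mollify_smoothDir hρ hw hwc d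
  set f : Euc n → ℝ := fun x => mollify ρ hρ w x + (-(ε / 4))
  have hf : SmoothDir d K f :=
    ⟨hsm.1.add contDiff_const, fun i x y => by
      simp only [f]
      rw [quadD2_add_const hsm.1.contDiffAt, quadD2_add_const hsm.1.contDiffAt]
      exact hsm.2 i x y⟩
  have hfw : ∀ x, f x ≤ w x := fun x => by
    have := (abs_le.1 (happ x)).2
    simp only [f]
    linarith
  have hwf : ∀ x, w x ≤ f x + ε / 2 := fun x => by
    have := (abs_le.1 (happ x)).1
    simp only [f]
    linarith
  set Q := T * ((n + 2) * K * S)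
  have hQ : 0 ≤ Q := by positivity
  refine ⟨ε / (2 * (Q + 1)), by positivity, fun h hh hh0 j hj x hx => ?_⟩
  have hτ2 : h ^ 2 / n = 2 * (h ^ 2 / (2 * n)) := by field_simp
  set τ := h ^ 2 / (2 * (n : ℝ))
  have hτ : 0 ≤ τ := by positivity
  have hcmp := walk_comparison hn hK hh hv hsup hf (fun y hy => (hfw y).trans (hwv y hy)) j ?_ j
    le_rfl x hx
  · have h1 : (walkStep d h)^[j] w x ≤ (walkStep d h)^[j] f x + ε / 2 := by
      have := walkStep_iterate_mono (d := d) (h := h) hwf j x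
      rwa [walkStep_iterate_add_const hn] at this
    have h2 : j * τ * ((n + 2) * K * S * h) ≤ ε / 2 := by
      calc j * τ * ((n + 2) * K * S * h) ≤ T * ((n + 2) * K * S * (ε / (2 * (Q + 1)))) := by gcongr
        _ = Q / (Q + 1) * (ε / 2) := by simp only [Q]; field_simp
        _ ≤ 1 * (ε / 2) := by
            gcongr
            rw [div_le_one (by positivity)]
            linarith
        _ = ε / 2 := one_mul _
    linarith
  · intro i hi y hy
    have hiT : i * τ ≤ T := by
      refine le_trans ?_ hj
      have : (i : ℝ) ≤ j := by exact_mod_cast hi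
      gcongr
    have hi0 : 0 ≤ i * τ := by positivity
    have hquad : ∀ z, f z ≤ 0 + C₁ * ‖z - y‖ ^ 2 := by
      intro z
      refine (hfw z).trans ?_
      by_cases hz : z ∈ closedBall x₀ r'
      · have h3 : r - r' ≤ ‖z - y‖ := by
          have h4 := dist_triangle y z x₀
          rw [mem_sphere.1 hy] at h4
          rw [← dist_eq_norm, dist_comm]
          have := mem_closedBall.1 hz
          linarith
        calc w z ≤ M := hwM z
          _ = C₁ * (r - r') ^ 2 := by simp only [C₁]; field_simp
          _ ≤ 0 + C₁ * ‖z - y‖ ^ 2 := by rw [zero_add]; gcongr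
      · rw [hw0 z hz]
        positivity
    have h5 := walkStep_iterate_le_quadratic (d := d) (h := h) hn hquad i
    rw [hτ2] at h5
    have h6 := hv1 y (sphere_subset_closedBall hy)
    have h7 : T * (2 * C₁ * S2 + |c| + 1) = 1 := by
      simp only [T]
      field_simp
    have h8 : (i * τ) * (2 * C₁ * S2 + |c|) ≤ T * (2 * C₁ * S2 + |c|) := by gcongr
    have h9 : c * (i * τ) ≤ |c| * (i * τ) := mul_le_mul_of_nonneg_right (le_abs_self c) hi0
    nlinarith

/-- A continuous viscosity supersolution of all the linear inequalities `dirLap d v ≤ -c` can be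
approximated by a smooth function satisfying the same inequalities. -/
theorem exists_smooth_dirSupersol_approx (hn : 0 < n) (hr : 0 < r)
    (hv : ContinuousOn v (closedBall x₀ r)) {e : ℝ} (he : 0 < e) :
    ∃ V : Euc n → ℝ, ContDiff ℝ 2 V ∧ (∀ x ∈ ball x₀ (r / 4), |V x - v x| ≤ e) ∧
      ∀ (d : Fin n → Euc n) (c : ℝ), DirSupersol d c (ball x₀ r) v →
        ∀ x ∈ ball x₀ (r / 4), dirLap d V x ≤ -c := by
  obtain ⟨m, hm⟩ := (isCompact_closedBall x₀ r).exists_bound_of_continuousOn hv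
  have hm0 : 0 ≤ m := (norm_nonneg _).trans (hm x₀ (mem_closedBall_self hr.le))
  set v₁ : Euc n → ℝ := fun x => v x + (m + 1)
  have hv₁ : ContinuousOn v₁ (closedBall x₀ r) := hv.add continuousOn_const
  have hv₁1 : ∀ y ∈ closedBall x₀ r, 1 ≤ v₁ y := fun y hy => by
    have := (abs_le.1 (hm y hy)).1
    simp only [v₁]
    linarith
  have hv₁M : ∀ y ∈ closedBall x₀ r, v₁ y ≤ 2 * m + 1 := fun y hy => by
    have := (abs_le.1 (hm y hy)).2
    simp only [v₁]
    linarith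
  let χ : ContDiffBump x₀ := ⟨r / 2, 3 * r / 4, by positivity, by linarith⟩
  have hsupp : ∀ y, y ∉ closedBall x₀ (3 * r / 4) → χ y = 0 := fun y hy => by
    by_contra h0
    have : y ∈ tsupport χ := subset_tsupport _ h0
    rw [χ.tsupport_eq] at this
    exact hy this
  set w : Euc n → ℝ := fun y => χ y * v₁ y
  have hw0 : ∀ y, y ∉ closedBall x₀ (3 * r / 4) → w y = 0 := fun y hy => by simp [w, hsupp y hy]
  have hwc : HasCompactSupport w := χ.hasCompactSupport.mul_right
  have hw : Continuous w := by
    rw [continuous_iff_continuousAt]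
    intro y
    by_cases hy : y ∈ ball x₀ r
    · exact χ.continuous.continuousAt.mul
        ((hv₁.mono ball_subset_closedBall).continuousAt (isOpen_ball.mem_nhds hy))
    · have : w =ᶠ[𝓝 y] fun _ => 0 := by
        have : y ∈ (closedBall x₀ (3 * r / 4))ᶜ := by
          simp only [mem_ball, not_lt, mem_compl_iff, mem_closedBall, not_le] at hy ⊢
          linarith
        filter_upwards [isClosed_closedBall.isOpen_compl.mem_nhds this] with z hz using hw0 z hz
      exact continuousAt_const.congr this.symm
  have hsub : closedBall x₀ (3 * r / 4) ⊆ closedBall x₀ r :=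
    closedBall_subset_closedBall (by linarith)
  have hwv : ∀ y ∈ closedBall x₀ r, w y ≤ v₁ y := fun y hy => by
    have := hv₁1 y hy
    exact mul_le_of_le_one_left (by linarith) χ.le_one
  have hwM : ∀ y, w y ≤ 2 * m + 1 := fun y => by
    by_cases hy : y ∈ closedBall x₀ (3 * r / 4)
    · exact (hwv y (hsub hy)).trans (hv₁M y (hsub hy))
    · rw [hw0 y hy]
      linarith
  have hwe : ∀ y ∈ closedBall x₀ (r / 2), w y = v₁ y := fun y hy => by
    simp [w, χ.one_of_mem_closedBall hy]
  obtain ⟨ρ₀, hρ₀, happ⟩ := exists_mollify_approx hw hwc he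
  set ρ := min ρ₀ (r / 4)
  have hρ : 0 < ρ := by positivity
  have happ := happ ρ hρ (min_le_left _ _)
  set V₁ := mollify ρ hρ w
  have hV₁ : ContDiff ℝ 2 V₁ := (mollify_contDiff hρ hw).of_le (by norm_num)
  refine ⟨fun x => V₁ x + (-(m + 1)), hV₁.add contDiff_const, fun x hx => ?_, ?_⟩
  · have h1 := happ x
    rw [hwe x (ball_subset_closedBall (ball_subset_ball (by linarith) hx))] at h1
    simp only [v₁] at h1
    rwa [show V₁ x + -(m + 1) - v x = V₁ x - (v x + (m + 1)) by ring]
  intro d c hsup x hx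
  have hdl : dirLap d (fun x => V₁ x + (-(m + 1))) x = dirLap d V₁ x := by
    simp only [dirLap, quadD2_add_const hV₁.contDiffAt]
  rw [hdl]
  have hsup₁ : DirSupersol d c (ball x₀ r) v₁ := by
    intro y hy φ hφ hmin
    refine hsup y hy φ hφ ?_
    filter_upwards [hmin] with z hz
    simp only [v₁] at hz
    linarith
  obtain ⟨T, hT, hwalk⟩ := exists_walk_iterate_le hn (by linarith : 3 * r / 4 < r) hv₁ hsup₁ hw hwc
    (by linarith) hwM hw0 hwv hv₁1
  obtain ⟨K, hK, hsm⟩ := mollify_smoothDir hρ hw hwc d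
  by_contra! hD
  set D := dirLap d V₁ x + c with hDdef
  have hD0 : 0 < D := by linarith
  set S2 := ∑ i, ‖d i‖ ^ 2
  set S := ∑ i, ‖d i‖
  have hS : 0 ≤ S := Finset.sum_nonneg fun i _ => norm_nonneg _
  have hS2 : 0 ≤ S2 := Finset.sum_nonneg fun i _ => sq_nonneg _
  set δ := D / 4
  have hδ : 0 < δ := by positivity
  set t := min T (δ ^ 2 / ((n * K) ^ 2 * S2 + 1))
  have ht : 0 < t := by positivity
  obtain ⟨h₀, hh₀, hwalk⟩ := hwalk (t * D / 8) (by positivity)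
  set h₁ := min h₀ (δ / (2 * K * S + 1))
  have hh₁ : 0 < h₁ := by positivity
  have hn0 : (0 : ℝ) < n := by positivity
  obtain ⟨j, hj⟩ := exists_nat_gt (2 * n * t / h₁ ^ 2)
  have hj0 : (0 : ℝ) < j := lt_of_le_of_lt (by positivity) hj
  set h := Real.sqrt (2 * n * t / j)
  have hh : 0 ≤ h := Real.sqrt_nonneg _
  have hsq : h ^ 2 = 2 * n * t / j := Real.sq_sqrt (by positivity)
  have hτ : j * (h ^ 2 / (2 * n)) = t := by
    rw [hsq]
    field_simp
  have hhle : h ≤ h₁ := by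
    refine Real.sqrt_le_iff.2 ⟨hh₁.le, ?_⟩
    rw [div_le_iff₀ hj0]
    rw [div_lt_iff₀ (by positivity)] at hj
    linarith
  have hlow := hsm.le_walkStep_iterate hn hK hh x hδ (T := t) j hτ.le
  have hup := hwalk h hh (hhle.trans (min_le_left _ _)) j (by rw [hτ]; exact min_le_left _ _)
  rw [hτ] at hlow hup
  have hmol : mollify ρ hρ ((walkStep d h)^[j] w) x ≤ V₁ x + (t * D / 8 - c * t) := by
    refine mollify_le_add hρ (hw.walkStep_iterate j) hw fun y hy => ?_
    have hyr : y ∈ closedBall x₀ (r / 2) := by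
      have h1 := dist_triangle y x x₀
      have h2 := mem_ball.1 hx
      have h3 := (mem_ball.1 hy).le.trans (min_le_right ρ₀ (r / 4))
      rw [mem_closedBall]
      linarith
    have := hup y (closedBall_subset_closedBall (by linarith) hyr)
    rw [hwe y hyr]
    linarith
  rw [mollify_walkStep_iterate hρ hw] at hmol
  have e1 : (n * K) ^ 2 / δ * (t * S2) ≤ δ := by
    have h1 : t ≤ δ ^ 2 / ((n * K) ^ 2 * S2 + 1) := min_le_right _ _
    rw [le_div_iff₀ (by positivity)] at h1
    rw [div_mul_eq_mul_div, div_le_iff₀ hδ]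
    nlinarith
  have e2 : 2 * K * S * h ≤ δ := by
    have h1 : h ≤ δ / (2 * K * S + 1) := hhle.trans (min_le_right _ _)
    rw [le_div_iff₀ (by positivity)] at h1
    nlinarith
  have e3 : t * (D / 4 - c) ≤
        t * (dirLap d V₁ x - δ - (n * K) ^ 2 / δ * (t * S2) - 2 * K * S * h) := by
    refine mul_le_mul_of_nonneg_left ?_ ht.le
    simp only [δ] at *
    linarith
  have e4 : t * (D / 4 - c) ≤ t * D / 8 - c * t := by linarith
  nlinarith

end SmoothApproximation

section PucciApproximation

variable {n : ℕ} {lam Lam r c : ℝ} {v g : Euc n → ℝ} {x₀ : Euc n}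

lemma quadD2_smul (φ : Euc n → ℝ) (x v : Euc n) (t : ℝ) :
    quadD2 φ x (t • v) = t ^ 2 * quadD2 φ x v := by
  simp only [quadD2, map_smul, smul_apply, smul_eq_mul]
  ring

lemma dirLap_sqrt_smul (hlam : 0 ≤ lam) {b : EucBasis n} {a : Fin n → ℝ} (ha : IsCoef lam Lam a)
    (φ : Euc n → ℝ) (x : Euc n) : dirLap (fun i => √(a i) • b i) φ x = linOp b a φ x := by
  simp only [dirLap, linOp, quadD2_smul]
  exact Finset.sum_congr rfl fun i _ => by rw [Real.sq_sqrt (hlam.trans (ha i).1)]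

/-- Smooth approximation of viscosity supersolutions. -/
theorem PucciSupersol.exists_smooth_approx (hn : 0 < n) (hlam : 0 ≤ lam) (hr : 0 < r)
    (hv : ContinuousOn v (closedBall x₀ r)) (hsup : PucciSupersol lam Lam (ball x₀ r) v g)
    (hg : ∀ x ∈ ball x₀ r, c ≤ g x) {e : ℝ} (he : 0 < e) :
    ∃ V : Euc n → ℝ, ContDiff ℝ 2 V ∧ (∀ x ∈ ball x₀ (r / 4), |V x - v x| ≤ e) ∧
      ∀ (b : EucBasis n) (a : Fin n → ℝ), IsCoef lam Lam a →
        ∀ x ∈ ball x₀ (r / 4), linOp b a V x ≤ -c := by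
  obtain ⟨V, hV, h1, h2⟩ := exists_smooth_dirSupersol_approx hn hr hv he
  refine ⟨V, hV, h1, fun b a ha x hx => ?_⟩
  rw [← dirLap_sqrt_smul hlam ha]
  refine h2 _ c (fun y hy φ hφ hmin => ?_) x hx
  rw [dirLap_sqrt_smul hlam ha]
  have h3 := hsup.linOp_le hy hφ.contDiffAt hmin b ha
  have h4 := hg y hy
  linarith

end PucciApproximation

section Operations

variable {n : ℕ} {lam Lam : ℝ} {Ω D : Set (Euc n)} {u v f g h h' : Euc n → ℝ} {x : Euc n}

lemma PucciSubsol.mono_set (hu : PucciSubsol lam Lam Ω u h) (hD : D ⊆ Ω) :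
    PucciSubsol lam Lam D u h := fun x hx => hu x (hD hx)

lemma PucciSupersol.mono_set (hu : PucciSupersol lam Lam Ω u h) (hD : D ⊆ Ω) :
    PucciSupersol lam Lam D u h := fun x hx => hu x (hD hx)

lemma PucciSubsol.mono_rhs (hu : PucciSubsol lam Lam Ω u h) (hh : ∀ x ∈ Ω, h x ≤ h' x) :
    PucciSubsol lam Lam Ω u h' := fun x hx φ hφ hmax => by
  have h1 := hu x hx φ hφ hmax
  have h2 := hh x hx
  linarith

lemma PucciSubsol.congr (hΩ : IsOpen Ω) (hu : PucciSubsol lam Lam Ω u h)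
    (huv : ∀ x ∈ Ω, u x = v x) (hh : ∀ x ∈ Ω, h x = h' x) : PucciSubsol lam Lam Ω v h' :=
  fun x hx φ hφ hmax => by
  rw [← hh x hx]
  refine hu x hx φ hφ (IsLocalMax.congr hmax ?_)
  filter_upwards [hΩ.mem_nhds hx] with y hy
  rw [huv y hy]

lemma PucciSupersol.congr (hΩ : IsOpen Ω) (hu : PucciSupersol lam Lam Ω u h)
    (huv : ∀ x ∈ Ω, u x = v x) (hh : ∀ x ∈ Ω, h x = h' x) : PucciSupersol lam Lam Ω v h' :=
  fun x hx φ hφ hmin => by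
  rw [← hh x hx]
  refine hu x hx φ hφ (IsLocalMin.congr hmin ?_)
  filter_upwards [hΩ.mem_nhds hx] with y hy
  rw [huv y hy]

lemma PucciSupersol.neg_subsol (hlL : lam ≤ Lam) (hu : PucciSupersol lam Lam Ω u g)
    (hg : ∀ x ∈ Ω, 0 ≤ g x) : PucciSubsol lam Lam Ω (fun x => -u x) (fun _ => 0) := by
  refine pucciSubsol_of_exists_linOp fun x hx φ hφ hmax => ?_
  refine ⟨EuclideanSpace.basisFun (Fin n) ℝ, fun _ => lam, fun _ => ⟨le_rfl, hlL⟩, ?_⟩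
  have hmin : IsLocalMin (fun y => u y - (-φ y)) x := by
    filter_upwards [hmax] with y hy
    linarith
  have h1 := hu.linOp_le hx hφ.neg.contDiffAt hmin (EuclideanSpace.basisFun (Fin n) ℝ)
    (a := fun _ => lam) (fun _ => ⟨le_rfl, hlL⟩)
  rw [linOp_neg] at h1
  have h2 := hg x hx
  linarith

lemma eventually_abs_linOp_sub_le (hlam : 0 ≤ lam) {φ : Euc n → ℝ} {x₀ : Euc n}
    (hφ : ContDiffAt ℝ 2 φ x₀) {ε : ℝ} (hε : 0 < ε) :
    ∀ᶠ x in 𝓝 x₀, ∀ (b : EucBasis n) (a : Fin n → ℝ), IsCoef lam Lam a →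
      |linOp b a φ x - linOp b a φ x₀| ≤ ε := by
  have hc := ((hφ.fderiv_right (m := 1) (by norm_num)).fderiv_right (m := 0)
    (by norm_num)).continuousAt
  set δ := ε / (n * |Lam| + 1)
  have hδ : 0 < δ := by positivity
  have hc' := (hc.sub (continuousAt_const (y := fderiv ℝ (fderiv ℝ φ) x₀))).norm
  have hlt := hc'.eventually_lt_const (u := δ) (by simpa using hδ)
  filter_upwards [hlt] with x hx b a ha
  unfold linOp
  rw [← Finset.sum_sub_distrib]
  have hLam : ∀ i : Fin n, |a i| ≤ |Lam| := fun i => by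
    rw [abs_of_nonneg (hlam.trans (ha i).1)]
    exact (ha i).2.trans (le_abs_self _)
  have key : ∀ i, |a i * quadD2 φ x (b i) - a i * quadD2 φ x₀ (b i)| ≤ |Lam| * δ := by
    intro i
    rw [← mul_sub, abs_mul]
    have h1 : |quadD2 φ x (b i) - quadD2 φ x₀ (b i)| ≤ δ := by
      have h2 : quadD2 φ x (b i) - quadD2 φ x₀ (b i) =
        (fderiv ℝ (fderiv ℝ φ) x - fderiv ℝ (fderiv ℝ φ) x₀) (b i) (b i) := by simp [quadD2]
      rw [h2, ← Real.norm_eq_abs]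
      refine (ContinuousLinearMap.le_opNorm₂ _ _ _).trans ?_
      rw [b.orthonormal.1 i, mul_one, mul_one]
      exact hx.le
    exact mul_le_mul (hLam i) h1 (abs_nonneg _) (abs_nonneg _)
  refine (Finset.abs_sum_le_sum_abs _ _).trans ((Finset.sum_le_sum fun i _ => key i).trans ?_)
  simp only [Finset.sum_const, Finset.card_univ, Fintype.card_fin, nsmul_eq_mul]
  have : (n * |Lam| + 1) * δ = ε := by
    simp only [δ]
    field_simp
  nlinarith

/-- The difference of a subsolution and a supersolution is a subsolution. -/
theorem PucciSubsol.sub_supersol (hn : 0 < n) (hlam : 0 ≤ lam) (hlL : lam ≤ Lam) (hΩ : IsOpen Ω)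
    (hu : PucciSubsol lam Lam Ω u f) (hv : PucciSupersol lam Lam Ω v g)
    (huc : ContinuousOn u Ω) (hvc : ContinuousOn v Ω) (hfc : ContinuousOn f Ω)
    (hgc : ContinuousOn g Ω) :
    PucciSubsol lam Lam Ω (fun x => u x - v x) (fun x => f x - g x) := by
  intro x₀ hx₀ φ hφ hmax
  by_contra! hneg
  set M := -(pucciMax lam Lam (hess φ x₀) + (f x₀ - g x₀)) with hM
  have hM0 : 0 < M := by linarith
  have hn0 : (0 : ℝ) < n := by positivity
  have hLam : 0 ≤ Lam := hlam.trans hlL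
  set κ := M / (16 * (n * Lam + 1))
  have hκ : 0 < κ := by positivity
  have hM8 : 0 < M / 8 := by positivity
  have hev : ∀ᶠ x in 𝓝 x₀, x ∈ Ω ∧ u x - v x - φ x ≤ u x₀ - v x₀ - φ x₀ ∧ |f x - f x₀| < M / 8 ∧
      |g x - g x₀| < M / 8 ∧ ∀ (b : EucBasis n) (a : Fin n → ℝ), IsCoef lam Lam a →
      |linOp b a φ x - linOp b a φ x₀| ≤ M / 8 := by
    have e1 := Metric.continuousAt_iff'.1 (hfc.continuousAt (hΩ.mem_nhds hx₀)) _ hM8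
    have e2 := Metric.continuousAt_iff'.1 (hgc.continuousAt (hΩ.mem_nhds hx₀)) _ hM8
    filter_upwards [hΩ.mem_nhds hx₀, hmax, e1, e2,
      eventually_abs_linOp_sub_le hlam hφ.contDiffAt hM8] with x a1 a2 a3 a4 a5
    exact ⟨a1, a2, a3, a4, a5⟩
  obtain ⟨R, hR, hball⟩ := Metric.eventually_nhds_iff_ball.1 hev
  set r := R / 2
  have hr : 0 < r := by positivity
  have hball : ∀ x ∈ closedBall x₀ r, _ := fun x hx =>
    hball x (closedBall_subset_ball (by simp only [r]; linarith) hx)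
  have hsubΩ : closedBall x₀ r ⊆ Ω := fun x hx => (hball x hx).1
  obtain ⟨V, hV, hVv, hVL⟩ := PucciSupersol.exists_smooth_approx (c := g x₀ - M / 8)
    (e := κ * r ^ 2 / 256) hn hlam hr (hvc.mono hsubΩ)
    (hv.mono_set (ball_subset_closedBall.trans hsubΩ))
    (fun x hx => by
      have := (abs_lt.1 (hball x (ball_subset_closedBall hx)).2.2.2.1).1
      linarith) (by positivity)
  have hs1 : closedBall x₀ (r / 8) ⊆ closedBall x₀ r := closedBall_subset_closedBall (by linarith)
  have hs2 : closedBall x₀ (r / 8) ⊆ ball x₀ (r / 4) := closedBall_subset_ball (by linarith)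
  set φ' : Euc n → ℝ := fun x => V x + (φ x + κ * ‖x - x₀‖ ^ 2)
  have hκc : ContDiff ℝ 2 fun x : Euc n => κ * ‖x - x₀‖ ^ 2 :=
    contDiff_const.mul (contDiff_norm_sub_sq x₀)
  have hφ' : ContDiff ℝ 2 φ' := hV.add (hφ.add hκc)
  obtain ⟨x₁, hx₁, hm⟩ := (isCompact_closedBall x₀ (r / 8)).exists_isMaxOn
    ⟨x₀, mem_closedBall_self (by positivity)⟩
    ((huc.mono (hs1.trans hsubΩ)).sub hφ'.continuous.continuousOn)
  have hx₁s : x₁ ∈ ball x₀ (r / 8) := by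
    by_contra hb
    have hd : ‖x₁ - x₀‖ = r / 8 := by
      rw [← dist_eq_norm]
      exact le_antisymm (mem_closedBall.1 hx₁) (not_lt.1 hb)
    have h1 : u x₀ - φ' x₀ ≤ u x₁ - φ' x₁ := hm (mem_closedBall_self (by positivity))
    simp only [φ', hd, sub_self, norm_zero] at h1
    have h2 := (hball x₁ (hs1 hx₁)).2.1
    have h3 := (abs_le.1 (hVv x₁ (hs2 hx₁))).1
    have h4 := (abs_le.1 (hVv x₀ (mem_ball_self (by positivity)))).2
    have : 0 < κ * r ^ 2 := by positivity
    nlinarith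
  have hloc : IsLocalMax (fun y => u y - φ' y) x₁ := by
    filter_upwards [isOpen_ball.mem_nhds hx₁s] with y hy using hm (ball_subset_closedBall hy)
  obtain ⟨b, a, ha, h0⟩ := hu.exists_linOp_ge hlL (hsubΩ (hs1 hx₁)) hφ'.contDiffAt hloc
  simp only [φ'] at h0
  rw [linOp_add hV.contDiffAt (hφ.add hκc).contDiffAt, linOp_add hφ.contDiffAt hκc.contDiffAt,
    linOp_const_mul (contDiff_norm_sub_sq x₀).contDiffAt, linOp_norm_sub_sq] at h0
  have h1 := hVL b a ha x₁ (hs2 hx₁)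
  obtain ⟨-, -, h2, -, h3⟩ := hball x₁ (hs1 hx₁)
  have h3 := (abs_le.1 (h3 b a ha)).2
  have h2 := (abs_lt.1 h2).2
  have h4 := linOp_le_pucciMax (hφ.contDiffAt (x := x₀)) b ha
  have h5 : κ * (2 * ∑ i, a i) ≤ M / 8 := by
    have h6 := ha.sum_le
    have h7 : κ * (16 * (n * Lam + 1)) = M := by
      simp only [κ]
      field_simp
    nlinarith
  linarith

end Operations

section Reflection

variable {n : ℕ} {lam Lam : ℝ} {Ω : Set (Euc n)} {u h : Euc n → ℝ}

lemma quadD2_comp_isometry (A : Euc n ≃ₗᵢ[ℝ] Euc n) (w : Euc n) {φ : Euc n → ℝ}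
    (hφ : ContDiff ℝ 2 φ) (x v : Euc n) :
    quadD2 (fun y => φ (A y + w)) x v = quadD2 φ (A x + w) (A v) := by
  have hc : ContDiff ℝ 2 fun y => φ (A y + w) :=
    hφ.comp ((A.toContinuousLinearEquiv.contDiff (n := 2)).add contDiff_const)
  obtain ⟨h1, h2⟩ := hasDerivAt_deriv_line (hφ.contDiffAt (x := A x + w)) (A v)
  refine quadD2_eq_of_hasDerivAt hc.contDiffAt ?_ h2
  filter_upwards [h1] with t ht
  have e : ∀ t : ℝ, A (x + t • v) + w = A x + w + t • A v := fun t => by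
    rw [map_add, map_smul]
    abel
  simpa only [e] using ht

lemma linOp_comp_isometry (A : Euc n ≃ₗᵢ[ℝ] Euc n) (w : Euc n) {φ : Euc n → ℝ}
    (hφ : ContDiff ℝ 2 φ) (b : EucBasis n) (a : Fin n → ℝ) (x : Euc n) :
    linOp b a (fun y => φ (A y + w)) x = linOp (b.map A) a φ (A x + w) := by
  simp [linOp, quadD2_comp_isometry A w hφ]

lemma contDiff_comp_isometry (A : Euc n ≃ₗᵢ[ℝ] Euc n) (w : Euc n) {φ : Euc n → ℝ}
    (hφ : ContDiff ℝ 2 φ) : ContDiff ℝ 2 fun y => φ (A y + w) :=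
  hφ.comp ((A.toContinuousLinearEquiv.contDiff (n := 2)).add contDiff_const)

lemma PucciSupersol.comp_isometry (hlL : lam ≤ Lam) (A : Euc n ≃ₗᵢ[ℝ] Euc n) (w : Euc n)
    (hu : PucciSupersol lam Lam Ω u h) :
    PucciSupersol lam Lam {x | A x + w ∈ Ω} (fun x => u (A x + w)) (fun x => h (A x + w)) := by
  refine pucciSupersol_of_linOp_le hlL fun x hx φ hφ hmin b a ha => ?_
  set ψ : Euc n → ℝ := fun y => φ (A.symm y + (-A.symm w))
  have hψ : ContDiff ℝ 2 ψ := contDiff_comp_isometry A.symm _ hφ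
  have hφψ : φ = fun y => ψ (A y + w) := by
    ext y
    simp [ψ]
  have hlim : Tendsto (fun y => A.symm y + (-A.symm w)) (𝓝 (A x + w)) (𝓝 x) := by
    have : Continuous fun y => A.symm y + (-A.symm w) := by fun_prop
    convert this.tendsto (A x + w) using 2
    simp
  have h0 := hu.linOp_le hx hψ.contDiffAt (by
    filter_upwards [hlim.eventually hmin] with y hy
    simpa [ψ] using hy) (b.map A) ha
  rw [hφψ, linOp_comp_isometry A w hψ]
  exact h0

/-- Reflection across the hyperplane `⟪x, e⟫ = m`, for a unit vector `e`. -/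
noncomputable def hyperRefl (e : Euc n) (m : ℝ) (x : Euc n) : Euc n :=
  x + (2 * (m - inner ℝ x e)) • e

lemma hyperRefl_eq {e : Euc n} (he : ‖e‖ = 1) (m : ℝ) (x : Euc n) :
    hyperRefl e m x = Submodule.reflection (Submodule.span ℝ {e})ᗮ x + (2 * m) • e := by
  rw [Submodule.reflection_orthogonal_apply, Submodule.reflection_singleton_apply]
  simp only [hyperRefl, he, real_inner_comm x e]
  module

lemma continuous_hyperRefl (e : Euc n) (m : ℝ) : Continuous (hyperRefl e m) := by
  unfold hyperRefl
  fun_prop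

lemma PucciSupersol.comp_hyperRefl (hlL : lam ≤ Lam) {e : Euc n} (he : ‖e‖ = 1) (m : ℝ)
    (hu : PucciSupersol lam Lam Ω u h) :
    PucciSupersol lam Lam {x | hyperRefl e m x ∈ Ω} (fun x => u (hyperRefl e m x))
      (fun x => h (hyperRefl e m x)) := by
  simp only [hyperRefl_eq he]
  exact hu.comp_isometry hlL _ _

end Reflection

section Comparison

variable {n : ℕ} {lam Lam : ℝ} {D Ω : Set (Euc n)} {u g Z h ψ : Euc n → ℝ}

/-- Maximum principle for a subsolution, bounded above by a strict supersolution up to a constant,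
in a possibly unbounded domain. -/
theorem PucciSubsol.le_of_strict {M ν : ℝ} (hlam : 0 ≤ lam) (hlL : lam ≤ Lam) (hD : IsOpen D)
    (hZ : PucciSubsol lam Lam D Z h) (hZc : ContinuousOn Z (closure D))
    (hψc : ContinuousOn ψ (closure D)) (hψ : ∀ x ∈ D, ContDiffAt ℝ 2 ψ x)
    (hM : ∀ x ∈ D, Z x - ψ x ≤ M) (hν : 0 < ν)
    (hstrict : ∀ x ∈ D, ψ x < Z x → ∀ (b : EucBasis n) (a : Fin n → ℝ), IsCoef lam Lam a →
      linOp b a ψ x + h x ≤ -ν)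
    (hfr : ∀ x ∈ frontier D, Z x ≤ ψ x) : ∀ x ∈ D, Z x ≤ ψ x := by
  intro x₁ hx₁
  by_contra! hlt
  have hLam : 0 ≤ Lam := hlam.trans hlL
  set ε := ν / (4 * (n * Lam + 1)) with hε
  have hnL : 0 ≤ n * Lam := by positivity
  have hε0 : 0 < ε := by positivity
  have hεν : 2 * ε * (n * Lam) < ν := by
    have : 4 * (n * Lam + 1) * ε = ν := by rw [hε]; field_simp
    nlinarith
  set R := |M| / ε + 1 with hR
  have hR1 : 1 ≤ R := by
    have : 0 ≤ |M| / ε := by positivity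
    linarith
  have hRM : M < ε * R ^ 2 := by
    have h1 : ε * R = |M| + ε := by rw [hR]; field_simp
    have h2 := le_abs_self M
    nlinarith [mul_nonneg (mul_nonneg hε0.le (zero_le_one.trans hR1)) (sub_nonneg.2 hR1)]
  obtain ⟨x₀, ⟨hx₀D, hx₀R⟩, hmax⟩ :=
    ((isCompact_closedBall x₁ R).inter_left isClosed_closure).exists_isMaxOn
      ⟨x₁, subset_closure hx₁, mem_closedBall_self (by linarith)⟩
      (f := fun x => Z x - (ψ x + ε * ‖x - x₁‖ ^ 2))
      ((hZc.sub (hψc.add ((contDiff_norm_sub_sq x₁).continuous.const_smul ε).continuousOn)).mono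
        inter_subset_left)
  have h1 := hmax (show x₁ ∈ closure D ∩ closedBall x₁ R from
    ⟨subset_closure hx₁, mem_closedBall_self (by linarith)⟩)
  simp only [mem_ofPred_eq, sub_self, norm_zero] at h1
  have hpos : ε * ‖x₀ - x₁‖ ^ 2 < Z x₀ - ψ x₀ := by linarith
  have hgt : ψ x₀ < Z x₀ := by
    have : 0 ≤ ε * ‖x₀ - x₁‖ ^ 2 := by positivity
    linarith
  have hx₀ : x₀ ∈ D := by
    by_contra hx
    exact absurd (hfr x₀ ⟨hx₀D, by rwa [hD.interior_eq]⟩) (not_le.2 hgt)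
  have hball : x₀ ∈ ball x₁ R := by
    rw [mem_ball, dist_eq_norm]
    have h2 := hM x₀ hx₀
    by_contra! hge
    have : R ^ 2 ≤ ‖x₀ - x₁‖ ^ 2 := by gcongr
    nlinarith
  have hloc : IsLocalMax (fun x => Z x - (ψ x + ε * ‖x - x₁‖ ^ 2)) x₀ := by
    filter_upwards [hD.mem_nhds hx₀, isOpen_ball.mem_nhds hball] with x hx hx'
    exact hmax ⟨subset_closure hx, ball_subset_closedBall hx'⟩
  have hq : ContDiff ℝ 2 fun x : Euc n => ε * ‖x - x₁‖ ^ 2 :=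
    contDiff_const.mul (contDiff_norm_sub_sq x₁)
  obtain ⟨b, a, ha, h3⟩ := hZ.exists_linOp_ge hlL hx₀ ((hψ x₀ hx₀).add hq.contDiffAt) hloc
  have h4 := hstrict x₀ hx₀ hgt b a ha
  have h5 : linOp b a (ψ + fun x => ε * ‖x - x₁‖ ^ 2) x₀ =
      linOp b a ψ x₀ + ε * (2 * ∑ i, a i) := by
    rw [← linOp_norm_sub_sq x₁, ← linOp_const_mul (contDiff_norm_sub_sq x₁).contDiffAt]
    exact linOp_add (hψ x₀ hx₀) hq.contDiffAt
  have h6 := ha.sum_le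
  have h7 : 0 ≤ linOp b a (ψ + fun x => ε * ‖x - x₁‖ ^ 2) x₀ + h x₀ := h3
  rw [h5] at h7
  nlinarith

/-- Comparison of a supersolution with a smooth function in a bounded domain. -/
theorem PucciSupersol.ge_of_linOp (hn : 0 < n) (hlam : 0 < lam) (hD : IsOpen D)
    (hb : Bornology.IsBounded D) (hu : PucciSupersol lam Lam D u g)
    (huc : ContinuousOn u (closure D)) (hψc : ContinuousOn ψ (closure D))
    (hψ : ∀ x ∈ D, ContDiffAt ℝ 2 ψ x)
    (hop : ∀ x ∈ D, ∃ (b : EucBasis n) (a : Fin n → ℝ), IsCoef lam Lam a ∧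
      0 ≤ linOp b a ψ x + g x)
    (hfr : ∀ x ∈ frontier D, ψ x ≤ u x) : ∀ x ∈ D, ψ x ≤ u x := by
  intro x₁ hx₁
  by_contra! hlt
  obtain ⟨R, hR⟩ := hb.subset_closedBall x₁
  have hRc : closure D ⊆ closedBall x₁ R := closure_minimal hR isClosed_closedBall
  set ε := (ψ x₁ - u x₁) / (R ^ 2 + 1) with hε
  have hε0 : 0 < ε := div_pos (by linarith) (by positivity)
  have hεR : ε * R ^ 2 < ψ x₁ - u x₁ := by
    have : (R ^ 2 + 1) * ε = ψ x₁ - u x₁ := by rw [hε]; field_simp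
    nlinarith
  have hq : ContDiff ℝ 2 fun x : Euc n => ε * ‖x - x₁‖ ^ 2 :=
    contDiff_const.mul (contDiff_norm_sub_sq x₁)
  obtain ⟨x₀, hx₀D, hmin⟩ := (hb.isCompact_closure).exists_isMinOn ⟨x₁, subset_closure hx₁⟩
    (f := fun x => u x - (ψ x + ε * ‖x - x₁‖ ^ 2)) (huc.sub (hψc.add hq.continuous.continuousOn))
  have h1 := hmin (subset_closure hx₁)
  simp only [mem_ofPred_eq, sub_self, norm_zero] at h1
  have h2 : ‖x₀ - x₁‖ ^ 2 ≤ R ^ 2 := by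
    have := hRc hx₀D
    rw [mem_closedBall, dist_eq_norm] at this
    gcongr
  have hgt : u x₀ < ψ x₀ := by nlinarith
  have hx₀ : x₀ ∈ D := by
    by_contra hx
    exact absurd (hfr x₀ ⟨hx₀D, by rwa [hD.interior_eq]⟩) (not_le.2 hgt)
  have hloc : IsLocalMin (fun x => u x - (ψ x + ε * ‖x - x₁‖ ^ 2)) x₀ := by
    filter_upwards [hD.mem_nhds hx₀] with x hx
    exact hmin (subset_closure hx)
  obtain ⟨b, a, ha, h3⟩ := hop x₀ hx₀
  have h4 := hu.linOp_le hx₀ ((hψ x₀ hx₀).add hq.contDiffAt) hloc b ha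
  have h5 : linOp b a (ψ + fun x => ε * ‖x - x₁‖ ^ 2) x₀ =
      linOp b a ψ x₀ + ε * (2 * ∑ i, a i) := by
    rw [← linOp_norm_sub_sq x₁, ← linOp_const_mul (contDiff_norm_sub_sq x₁).contDiffAt]
    exact linOp_add (hψ x₀ hx₀) hq.contDiffAt
  have h6 := ha.le_sum
  have h7 : linOp b a (ψ + fun x => ε * ‖x - x₁‖ ^ 2) x₀ + g x₀ ≤ 0 := h4
  rw [h5] at h7
  have : (0 : ℝ) < n * lam := by positivity
  nlinarith [mul_pos hε0 this]

/-- A supersolution with right-hand side at least `c` lies above a paraboloid. -/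
theorem PucciSupersol.ge_paraboloid {x : Euc n} {ρ c : ℝ} (hn : 0 < n) (hlam : 0 < lam)
    (hlL : lam ≤ Lam) (hc : 0 ≤ c) (hρ : 0 < ρ) (hu : PucciSupersol lam Lam (ball x ρ) u g)
    (huc : ContinuousOn u (closedBall x ρ)) (hu0 : ∀ z ∈ closedBall x ρ, 0 ≤ u z)
    (hg : ∀ z ∈ ball x ρ, c ≤ g z) :
    ∀ z ∈ ball x ρ, c / (2 * n * Lam) * (ρ ^ 2 - ‖z - x‖ ^ 2) ≤ u z := by
  have hLam : 0 < Lam := hlam.trans_le hlL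
  have hn' : (0 : ℝ) < n := by positivity
  set k := c / (2 * n * Lam) with hk
  have hkc : k * (2 * n * Lam) = c := by rw [hk]; field_simp
  have hk0 : 0 ≤ k := by positivity
  have hsq := contDiff_norm_sub_sq x
  have e : (fun z : Euc n => k * (ρ ^ 2 - ‖z - x‖ ^ 2)) =
      fun z => (-k) * ‖z - x‖ ^ 2 + k * ρ ^ 2 := by
    ext z
    ring
  have hsm : ContDiff ℝ 2 fun z : Euc n => k * (ρ ^ 2 - ‖z - x‖ ^ 2) :=
    contDiff_const.mul (contDiff_const.sub hsq)
  refine hu.ge_of_linOp hn hlam isOpen_ball isBounded_ball (by rwa [closure_ball x hρ.ne'])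
    hsm.continuous.continuousOn (fun _ _ => hsm.contDiffAt) (fun z hz => ?_) fun z hz => ?_
  · refine ⟨EuclideanSpace.basisFun (Fin n) ℝ, fun _ => Lam, fun _ => ⟨hlL, le_rfl⟩, ?_⟩
    rw [e, linOp_add_const (contDiff_const.mul hsq).contDiffAt, linOp_const_mul hsq.contDiffAt,
      linOp_norm_sub_sq]
    have := hg z hz
    simp only [Finset.sum_const, Finset.card_univ, Fintype.card_fin, nsmul_eq_mul]
    nlinarith
  · rw [frontier_ball x hρ.ne', mem_sphere, dist_eq_norm] at hz
    rw [hz, sub_self, mul_zero]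
    exact hu0 z (by rw [mem_closedBall, dist_eq_norm, hz])

/-- The constant in the growth lemma `PucciSubsol.le_on_double`. -/
noncomputable def growthConst (n : ℕ) (lam Lam : ℝ) : ℝ :=
  Real.exp (-(4 * (n * Lam / lam))) - Real.exp (-(16 * (n * Lam / lam)))

lemma growthConst_pos (hn : 0 < n) (hlam : 0 < lam) (hlL : lam ≤ Lam) :
    0 < growthConst n lam Lam := by
  have hLam : 0 < Lam := hlam.trans_le hlL
  have : (0 : ℝ) < n * Lam / lam := by positivity
  exact sub_pos.2 (Real.exp_lt_exp.2 (by linarith))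

lemma growthConst_le_one (hlam : 0 < lam) (hlL : lam ≤ Lam) : growthConst n lam Lam ≤ 1 := by
  have hLam : 0 < Lam := hlam.trans_le hlL
  have h0 : (0 : ℝ) ≤ n * Lam / lam := by positivity
  have h1 := Real.exp_le_one_iff.2 (show -(4 * (n * Lam / lam)) ≤ 0 by linarith)
  have h2 := Real.exp_pos (-(16 * (n * Lam / lam)))
  unfold growthConst
  linarith

/-- Negativity of a subsolution on a ball propagates to the concentric ball of twice the radius. -/
theorem PucciSubsol.le_on_double {y : Euc n} {ρ c : ℝ} (hn : 0 < n) (hlam : 0 < lam)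
    (hlL : lam ≤ Lam) (hρ : 0 < ρ) (hc : 0 < c)
    (hZ : PucciSubsol lam Lam (ball y (4 * ρ)) Z (fun _ => 0))
    (hZc : ContinuousOn Z (closedBall y (4 * ρ))) (hZ0 : ∀ x ∈ closedBall y (4 * ρ), Z x ≤ 0)
    (hZ1 : ∀ x ∈ closedBall y ρ, Z x ≤ -c) :
    ∀ x ∈ closedBall y (2 * ρ), Z x ≤ -(growthConst n lam Lam * c) := by
  have hLam : 0 < Lam := hlam.trans_le hlL
  have hn' : (0 : ℝ) < n := by positivity
  set γ := n * Lam / lam / ρ ^ 2 with hγ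
  have hγ0 : 0 < γ := by positivity
  have hγρ : γ * ρ ^ 2 = n * Lam / lam := by rw [hγ]; field_simp
  have hγl : γ * ρ ^ 2 * lam = n * Lam := by rw [hγρ]; field_simp
  set D : Set (Euc n) := {x | ρ ^ 2 < ‖x - y‖ ^ 2 ∧ ‖x - y‖ ^ 2 < (4 * ρ) ^ 2} with hDdef
  have hsq := contDiff_norm_sub_sq y
  have hD : IsOpen D := (isOpen_lt continuous_const hsq.continuous).inter
    (isOpen_lt hsq.continuous continuous_const)
  have hDc : closure D ⊆ {x | ρ ^ 2 ≤ ‖x - y‖ ^ 2 ∧ ‖x - y‖ ^ 2 ≤ (4 * ρ) ^ 2} :=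
    closure_minimal (fun x hx => ⟨hx.1.le, hx.2.le⟩)
      ((isClosed_le continuous_const hsq.continuous).inter
        (isClosed_le hsq.continuous continuous_const))
  have hcb : ∀ {r : ℝ}, 0 < r → ∀ x : Euc n, x ∈ closedBall y r ↔ ‖x - y‖ ^ 2 ≤ r ^ 2 :=
    fun hr x => by rw [mem_closedBall, dist_eq_norm, sq_le_sq₀ (norm_nonneg _) hr.le]
  have hDcb : closure D ⊆ closedBall y (4 * ρ) := fun x hx =>
    (hcb (by positivity) x).2 (hDc hx).2
  have hDb : D ⊆ ball y (4 * ρ) := fun x hx => by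
    rw [mem_ball, dist_eq_norm, ← sq_lt_sq₀ (norm_nonneg _) (by positivity)]
    exact hx.2
  set E := Real.exp (-(γ * (4 * ρ) ^ 2)) with hE
  set F : ℝ → ℝ := fun s => -c * Real.exp (-(γ * s)) + c * E with hF
  set F' : ℝ → ℝ := fun s => c * γ * Real.exp (-(γ * s)) with hF'
  have hexp : ∀ s, HasDerivAt (fun s => Real.exp (-(γ * s))) (Real.exp (-(γ * s)) * -γ) s :=
    fun s => (((hasDerivAt_id s).const_mul γ).fun_neg.congr_deriv (by ring)).exp
  have hF1 : ∀ s, HasDerivAt F (F' s) s := fun s =>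
    (((hexp s).const_mul (-c)).add_const (c * E)).congr_deriv (by simp only [hF']; ring)
  have hF2 : ∀ s, HasDerivAt F' (-(c * γ ^ 2 * Real.exp (-(γ * s)))) s := fun s =>
    ((hexp s).const_mul (c * γ)).congr_deriv (by ring)
  have hFc : ContDiff ℝ 2 F := by
    rw [hF]
    fun_prop
  have hψ : ContDiff ℝ 2 fun x => F (‖x - y‖ ^ 2) := hFc.comp hsq
  have hanti : ∀ {s t : ℝ}, s ≤ t → F s ≤ F t := fun {s t} hst => by
    have : Real.exp (-(γ * t)) ≤ Real.exp (-(γ * s)) := Real.exp_le_exp.2 (by nlinarith)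
    simp only [hF]
    nlinarith
  have hF4 : F ((4 * ρ) ^ 2) = 0 := by simp only [hF, hE]; ring
  have hle : ∀ x ∈ D, Z x ≤ F (‖x - y‖ ^ 2) := by
    refine PucciSubsol.le_of_strict (M := c) (ν := c * γ * E * (2 * (n * Lam))) hlam.le hlL hD
      (hZ.mono_set hDb) (hZc.mono hDcb) hψ.continuous.continuousOn (fun x _ => hψ.contDiffAt)
      (fun x hx => ?_) (by positivity) (fun x hx _ b a ha => ?_) fun x hx => ?_
    · have h1 := hZ0 x (hDcb (subset_closure hx))
      have h2 : Real.exp (-(γ * ‖x - y‖ ^ 2)) ≤ 1 := Real.exp_le_one_iff.2 (by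
        have : 0 ≤ γ * ‖x - y‖ ^ 2 := by positivity
        linarith)
      have h3 : 0 < c * E := by positivity
      simp only [hF]
      nlinarith
    · rw [linOp_radial hψ.contDiffAt (Eventually.of_forall hF1) (hF2 _)]
      have h1 := ha.le_sum_inner b (x - y)
      have h2 := ha.sum_le
      have h3 : E ≤ Real.exp (-(γ * ‖x - y‖ ^ 2)) :=
        Real.exp_le_exp.2 (by nlinarith [hx.2])
      simp only [hF']
      set X := Real.exp (-(γ * ‖x - y‖ ^ 2))
      have hE0 : 0 < E := Real.exp_pos _
      have hX0 : 0 < X := Real.exp_pos _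
      have h4 : n * Lam ≤ γ * ∑ i, a i * inner ℝ (b i) (x - y) ^ 2 := by
        calc n * Lam = γ * (lam * ρ ^ 2) := by rw [← hγl]; ring
          _ ≤ γ * (lam * ‖x - y‖ ^ 2) := by
            have := hx.1.le
            gcongr
          _ ≤ _ := by gcongr
      have h5 : c * γ * X * (-4 * (γ * ∑ i, a i * inner ℝ (b i) (x - y) ^ 2) + 2 * ∑ i, a i) ≤
          c * γ * X * (-(2 * (n * Lam))) := by
        gcongr
        linarith
      have h6 : c * γ * E * (2 * (n * Lam)) ≤ c * γ * X * (2 * (n * Lam)) := by gcongr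
      linarith
    · have hxc := hDc (frontier_subset_closure hx)
      have hxD : x ∉ D := fun h => hx.2 (by rwa [hD.interior_eq])
      rcases eq_or_lt_of_le hxc.1 with h1 | h1
      · refine (hZ1 x ((hcb hρ x).2 h1.ge)).trans ?_
        rw [← h1]
        have h2 : Real.exp (-(γ * ρ ^ 2)) ≤ 1 := Real.exp_le_one_iff.2 (by
          have : 0 ≤ γ * ρ ^ 2 := by positivity
          linarith)
        have h3 : 0 < c * E := by positivity
        simp only [hF]
        nlinarith
      · have h2 : ‖x - y‖ ^ 2 = (4 * ρ) ^ 2 := le_antisymm hxc.2 (not_lt.1 fun h => hxD ⟨h1, h⟩)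
        rw [h2, hF4]
        exact hZ0 x ((hcb (by positivity) x).2 h2.le)
  have hval : F ((2 * ρ) ^ 2) = -(growthConst n lam Lam * c) := by
    have e1 : γ * (2 * ρ) ^ 2 = 4 * (n * Lam / lam) := by rw [← hγρ]; ring
    have e2 : γ * (4 * ρ) ^ 2 = 16 * (n * Lam / lam) := by rw [← hγρ]; ring
    simp only [hF, hE, growthConst, e1, e2]
    ring
  intro x hx
  rw [hcb (by positivity)] at hx
  rcases le_or_gt (‖x - y‖ ^ 2) (ρ ^ 2) with h1 | h1
  · refine (hZ1 x ((hcb hρ x).2 h1)).trans ?_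
    have := growthConst_le_one (n := n) hlam hlL
    nlinarith
  · rw [← hval]
    exact (hle x ⟨h1, hx.trans_lt (by nlinarith)⟩).trans (hanti hx)

/-- Propagation of negativity along a segment. -/
theorem PucciSubsol.le_along_segment {x e : Euc n} {ρ c ℓ : ℝ} (hn : 0 < n) (hlam : 0 < lam)
    (hlL : lam ≤ Lam) (hρ : 0 < ρ) (hc : 0 < c) (he : ‖e‖ = 1)
    (hZ : PucciSubsol lam Lam Ω Z (fun _ => 0)) (hZc : ContinuousOn Z Ω)
    (hZ0 : ∀ z ∈ Ω, Z z ≤ 0) (hZ1 : ∀ z ∈ closedBall x ρ, Z z ≤ -c) (hℓ : 0 ≤ ℓ)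
    (hsub : ∀ s ∈ Icc 0 ℓ, closedBall (x + s • e) (4 * ρ) ⊆ Ω) (N : ℕ) (hN : ℓ ≤ N * ρ) :
    ∀ z ∈ closedBall (x + ℓ • e) ρ, Z z ≤ -(growthConst n lam Lam ^ N * c) := by
  have hκ := growthConst_pos hn hlam hlL
  have hκ1 := growthConst_le_one (n := n) hlam hlL
  induction N generalizing ℓ with
  | zero =>
    have : ℓ = 0 := le_antisymm (by simpa using hN) hℓ
    simpa [this] using hZ1
  | succ N ih =>
    have hpow : 0 < growthConst n lam Lam ^ N := by positivity
    rcases le_or_gt ℓ (N * ρ) with h | h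
    · intro z hz
      refine (ih hℓ hsub h z hz).trans ?_
      rw [pow_succ]
      have : 0 < growthConst n lam Lam ^ N * c := by positivity
      nlinarith
    · have h0 : 0 ≤ ℓ - ρ ∨ ℓ < ρ := (le_or_gt ρ ℓ).imp_left sub_nonneg.2
      set m := max (ℓ - ρ) 0 with hm
      have hm0 : 0 ≤ m := le_max_right _ _
      have hmℓ : m ≤ ℓ := max_le (by linarith) hℓ
      have hmN : m ≤ N * ρ := max_le (by push_cast at hN; linarith) (by positivity)
      have hm' : ℓ - ρ ≤ m := le_max_left _ _
      have hs := hsub m ⟨hm0, hmℓ⟩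
      have h1 := PucciSubsol.le_on_double (c := growthConst n lam Lam ^ N * c) hn hlam hlL hρ
        (by positivity) (hZ.mono_set (ball_subset_closedBall.trans hs)) (hZc.mono hs)
        (fun z hz => hZ0 z (hs hz)) (ih hm0 (fun s h => hsub s ⟨h.1, h.2.trans hmℓ⟩) hmN)
      intro z hz
      rw [pow_succ, mul_comm (_ ^ N), mul_assoc]
      refine h1 z ?_
      rw [mem_closedBall] at hz ⊢
      have h2 : dist (x + ℓ • e) (x + m • e) ≤ ρ := by
        rw [dist_eq_norm, add_sub_add_left_eq_sub, ← sub_smul, norm_smul, he, mul_one,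
          Real.norm_eq_abs, abs_of_nonneg (by linarith)]
        linarith
      linarith [dist_triangle z (x + ℓ • e) (x + m • e)]

end Comparison

/-- A bounded positive solution of `M⁺(D²u) + g = 0` in the half space `{x k > 0}`, extended by zero
to the complement. -/
structure HalfSpaceSol {n : ℕ} (k : Fin n) (lam Lam C : ℝ) (u g : Euc n → ℝ) : Prop where
  cont : Continuous u
  le : ∀ x, u x ≤ C
  zero : ∀ x, x k ≤ 0 → u x = 0
  pos : ∀ x, 0 < x k → 0 < u x
  sub : PucciSubsol lam Lam {x | 0 < x k} u g
  super : PucciSupersol lam Lam {x | 0 < x k} u g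

section Lipschitz

variable {n : ℕ} {k : Fin n} {lam Lam C C₀ : ℝ} {u g : Euc n → ℝ}

lemma HalfSpaceSol.nonneg (hu : HalfSpaceSol k lam Lam C u g) (x : Euc n) : 0 ≤ u x := by
  rcases le_or_gt (x k) 0 with h | h
  · exact (hu.zero x h).ge
  · exact (hu.pos x h).le

lemma inner_single_one_right (x : Euc n) (k : Fin n) :
    inner ℝ x (EuclideanSpace.single k (1 : ℝ)) = x k := by
  simp [EuclideanSpace.inner_single_right]

lemma norm_single_one (k : Fin n) : ‖EuclideanSpace.single k (1 : ℝ)‖ = 1 := by simp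

lemma continuous_coord (k : Fin n) : Continuous fun x : Euc n => x k :=
  (EuclideanSpace.proj (𝕜 := ℝ) k).continuous

lemma abs_coord_le_norm (x : Euc n) (k : Fin n) : |x k| ≤ ‖x‖ := by
  simpa using PiLp.norm_apply_le x k

lemma isOpen_halfSpace (k : Fin n) : IsOpen {x : Euc n | 0 < x k} :=
  isOpen_lt continuous_const (continuous_coord k)

lemma contDiff_slabQuadratic (A B m : ℝ) (e : Euc n) :
    ContDiff ℝ 2 fun x : Euc n => A * (inner ℝ x e - m) - B * (inner ℝ x e - m) ^ 2 := by
  have : ContDiff ℝ 2 fun x : Euc n => inner ℝ x e := contDiff_id.inner ℝ contDiff_const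
  fun_prop

lemma linOp_slabQuadratic_le {A B m : ℝ} {e : Euc n} (hB : 0 ≤ B) (he : ‖e‖ = 1)
    (b : EucBasis n) {a : Fin n → ℝ} (ha : IsCoef lam Lam a) (x : Euc n) :
    linOp b a (fun x => A * (inner ℝ x e - m) - B * (inner ℝ x e - m) ^ 2) x ≤ -(2 * B * lam) := by
  have h1 : ∀ s : ℝ, HasDerivAt (fun s => A * (s - m) - B * (s - m) ^ 2)
      (A - 2 * B * (s - m)) s := fun s => by
    have h := (hasDerivAt_id s).sub_const m
    exact ((h.const_mul A).sub ((h.pow 2).const_mul B)).congr_deriv (by simp; ring)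
  have h2 : HasDerivAt (fun s => A - 2 * B * (s - m)) (-(2 * B)) (inner ℝ x e) :=
    ((((hasDerivAt_id _).sub_const m).const_mul (2 * B)).const_sub A).congr_deriv (by ring)
  rw [linOp_comp_inner (F := fun s => A * (s - m) - B * (s - m) ^ 2)
    (contDiff_slabQuadratic A B m e).contDiffAt h1 h2]
  have h3 := ha.le_sum_inner b e
  rw [he] at h3
  nlinarith

lemma HalfSpaceSol.exists_le_coord (hu : HalfSpaceSol k lam Lam C u g) (hlam : 0 < lam)
    (hlL : lam ≤ Lam) (hC : 0 ≤ C) (hC₀ : 0 ≤ C₀) (hg : ∀ x, g x ≤ C₀) :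
    ∃ K, 0 < K ∧ ∀ x : Euc n, 0 ≤ x k → u x ≤ K * x k := by
  set B := (C₀ + 1) / (2 * lam) with hB
  have hB0 : 0 < B := by positivity
  have hBl : 2 * B * lam = C₀ + 1 := by rw [hB]; field_simp
  refine ⟨C + B, by positivity, fun x hx => ?_⟩
  set e : Euc n := EuclideanSpace.single k (1 : ℝ) with he
  have hin : ∀ z : Euc n, inner ℝ z e = z k := fun z => inner_single_one_right z k
  set D : Set (Euc n) := {x | 0 < x k ∧ x k < 1}
  have hD : IsOpen D := (isOpen_halfSpace k).inter (isOpen_lt (continuous_coord k) continuous_const)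
  have hDc : closure D ⊆ {x | 0 ≤ x k ∧ x k ≤ 1} :=
    closure_minimal (fun x hx => ⟨hx.1.le, hx.2.le⟩)
      ((isClosed_le continuous_const (continuous_coord k)).inter
        (isClosed_le (continuous_coord k) continuous_const))
  have hsm := contDiff_slabQuadratic (C + B) B 0 e
  have key := PucciSubsol.le_of_strict (M := C) (ν := 1) hlam.le hlL hD
    (hu.sub.mono_set fun x hx => hx.1) hu.cont.continuousOn hsm.continuous.continuousOn
    (fun x _ => hsm.contDiffAt) (fun x hx => ?_) one_pos (fun x hx _ b a ha => ?_) fun x hx => ?_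
  · rcases eq_or_lt_of_le hx with h0 | h0
    · rw [hu.zero x h0.ge, ← h0, mul_zero]
    · rcases le_or_gt 1 (x k) with h1 | h1
      · have := hu.le x
        nlinarith
      · have := key x ⟨h0, h1⟩
        simp only [hin, sub_zero] at this
        nlinarith [sq_nonneg (x k)]
  · simp only [hin, sub_zero]
    have := hu.le x
    have h0 := hx.1
    have h1 := hx.2
    nlinarith [mul_nonneg hC h0.le, mul_nonneg (mul_nonneg hB0.le h0.le) (sub_nonneg.2 h1.le)]
  · have h1 := linOp_slabQuadratic_le (A := C + B) (m := 0) hB0.le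
      (norm_single_one k) b ha x
    have h2 := hg x
    rw [← he] at h1
    linarith
  · have hxc := hDc (frontier_subset_closure hx)
    have hxD : x ∉ D := fun h => hx.2 (by rwa [hD.interior_eq])
    simp only [hin, sub_zero]
    rcases eq_or_lt_of_le hxc.1 with h0 | h0
    · rw [hu.zero x h0.ge, ← h0]
      simp
    · have h1 : x k = 1 := le_antisymm hxc.2 (not_lt.1 fun h => hxD ⟨h0, h⟩)
      rw [h1]
      have := hu.le x
      linarith

lemma HalfSpaceSol.exists_lipschitz (hu : HalfSpaceSol k lam Lam C u g) (hlam : 0 < lam)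
    (hlL : lam ≤ Lam) (hC : 0 ≤ C) (hC₀ : 0 ≤ C₀) (hgc : Continuous g) (hg0 : ∀ x, 0 ≤ g x)
    (hg : ∀ x, g x ≤ C₀) : ∃ K, 0 < K ∧ ∀ x y, u x - u y ≤ K * ‖x - y‖ := by
  obtain ⟨K, hK, hKu⟩ := hu.exists_le_coord hlam hlL hC hC₀ hg
  have hn : 0 < n := k.pos
  set B := (C₀ + 1) / (2 * lam) with hB
  have hB0 : 0 < B := by positivity
  have hBl : 2 * B * lam = C₀ + 1 := by rw [hB]; field_simp
  set A := B + (C + 2 * K) with hA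
  have hA0 : 0 < A := by positivity
  refine ⟨A, hA0, fun x y => ?_⟩
  rcases le_or_gt (y k) 0 with hy | hy
  · rw [hu.zero y hy, sub_zero]
    rcases le_or_gt (x k) 0 with hx | hx
    · rw [hu.zero x hx]
      positivity
    · have h1 := hKu x hx.le
      have h2 : x k ≤ ‖x - y‖ := by
        have h3 := (le_abs_self _).trans (abs_coord_le_norm (x - y) k)
        rw [PiLp.sub_apply] at h3
        linarith
      nlinarith
  rcases le_or_gt (x k) 0 with hx | hx
  · have := hu.nonneg y
    rw [hu.zero x hx]
    have : 0 ≤ A * ‖x - y‖ := by positivity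
    linarith
  rcases eq_or_ne x y with hxy | hxy
  · simp [hxy]
  have hd : 0 < ‖x - y‖ := norm_pos_iff.2 (sub_ne_zero.2 hxy)
  rcases le_or_gt 2 ‖x - y‖ with h2 | h2
  · have := hu.le x
    have := hu.nonneg y
    nlinarith
  set e : Euc n := ‖x - y‖⁻¹ • (x - y) with he
  have he1 : ‖e‖ = 1 := by
    rw [he, norm_smul, norm_inv, norm_norm, inv_mul_cancel₀ hd.ne']
  have hde : ‖x - y‖ • e = x - y := by
    rw [he, smul_smul, mul_inv_cancel₀ hd.ne', one_smul]
  have hee : inner ℝ e e = (1 : ℝ) := by rw [real_inner_self_eq_norm_sq, he1, one_pow]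
  set m : ℝ := inner ℝ x e - ‖x - y‖ / 2 with hm
  have hRx : hyperRefl e m x = y := by
    have : 2 * (m - inner ℝ x e) = -‖x - y‖ := by rw [hm]; ring
    rw [hyperRefl, this, neg_smul, hde]
    abel
  have hek : |e k| ≤ 1 := he1 ▸ abs_coord_le_norm e k
  have hRk : ∀ z : Euc n, hyperRefl e m z k = z k - 2 * (inner ℝ z e - m) * e k := fun z => by
    simp only [hyperRefl, PiLp.add_apply, PiLp.smul_apply, smul_eq_mul]
    ring
  have hic : Continuous fun z : Euc n => inner ℝ z e := continuous_id.inner continuous_const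
  have hRc : Continuous fun z : Euc n => hyperRefl e m z k :=
    (continuous_coord k).comp (continuous_hyperRefl e m)
  set D : Set (Euc n) := {z | (m < inner ℝ z e ∧ inner ℝ z e < m + 1) ∧
    (0 < z k ∧ 0 < hyperRefl e m z k)}
  have hD : IsOpen D := ((isOpen_lt continuous_const hic).inter
    (isOpen_lt hic continuous_const)).inter ((isOpen_halfSpace k).inter
      (isOpen_lt continuous_const hRc))
  have hDc : closure D ⊆ {z | (m ≤ inner ℝ z e ∧ inner ℝ z e ≤ m + 1) ∧
      (0 ≤ z k ∧ 0 ≤ hyperRefl e m z k)} :=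
    closure_minimal (fun z hz => ⟨⟨hz.1.1.le, hz.1.2.le⟩, hz.2.1.le, hz.2.2.le⟩)
      (((isClosed_le continuous_const hic).inter
        (isClosed_le hic continuous_const)).inter
          ((isClosed_le continuous_const (continuous_coord k)).inter
            (isClosed_le continuous_const hRc)))
  have hRu := hu.cont.comp (continuous_hyperRefl e m)
  have hsub : PucciSubsol lam Lam D (fun z => u z - u (hyperRefl e m z)) fun _ => C₀ := by
    refine (PucciSubsol.sub_supersol hn hlam.le hlL hD (hu.sub.mono_set fun z hz => hz.2.1)
      ((hu.super.comp_hyperRefl hlL he1 m).mono_set fun z hz => hz.2.2) hu.cont.continuousOn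
      hRu.continuousOn hgc.continuousOn
      (hgc.comp (continuous_hyperRefl e m)).continuousOn).mono_rhs fun z _ => ?_
    have h1 := hg z
    have h2 := hg0 (hyperRefl e m z)
    linarith
  have hsm := contDiff_slabQuadratic A B m e
  have hψ : ∀ z ∈ closure D, (A - B) * (inner ℝ z e - m) ≤
      A * (inner ℝ z e - m) - B * (inner ℝ z e - m) ^ 2 := fun z hz => by
    have h0 := (hDc hz).1
    nlinarith [mul_nonneg (sub_nonneg.2 h0.1)
      (show 0 ≤ 1 - (inner ℝ z e - m) by linarith [h0.2])]
  have key := PucciSubsol.le_of_strict (M := C) (ν := 1) hlam.le hlL hD hsub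
    (hu.cont.sub hRu).continuousOn hsm.continuous.continuousOn (fun z _ => hsm.contDiffAt)
    (fun z hz => ?_) one_pos (fun z hz _ b a ha => ?_) (fun z hz => ?_) x
    ⟨⟨by linarith, by linarith⟩, hx, by rwa [hRx]⟩
  · simp only [hRx] at key
    refine key.trans ?_
    have : inner ℝ x e - m = ‖x - y‖ / 2 := by rw [hm]; ring
    rw [this]
    nlinarith [sq_nonneg (‖x - y‖ / 2)]
  · have h1 := hψ z (subset_closure hz)
    have h2 := hu.le z
    have h3 := hu.nonneg (hyperRefl e m z)
    have h4 : 0 ≤ (A - B) * (inner ℝ z e - m) :=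
      mul_nonneg (by rw [hA]; linarith) (by linarith [hz.1.1])
    linarith
  · have h1 := linOp_slabQuadratic_le (A := A) (m := m) hB0.le he1 b ha z
    linarith
  · have hzc := hDc (frontier_subset_closure hz)
    have hzD : z ∉ D := fun h => hz.2 (by rwa [hD.interior_eq])
    refine le_trans ?_ (hψ z (frontier_subset_closure hz))
    have hs0 : 0 ≤ inner ℝ z e - m := by linarith [hzc.1.1]
    have hAB : A - B = C + 2 * K := by rw [hA]; ring
    rw [hAB]
    have hpos := mul_nonneg (show 0 ≤ C + 2 * K by linarith) hs0
    rcases eq_or_lt_of_le hzc.1.1 with h1 | h1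
    · have : hyperRefl e m z = z := by simp [hyperRefl, ← h1]
      rw [this, sub_self]
      exact hpos
    rcases eq_or_lt_of_le hzc.1.2 with h2 | h2
    · rw [h2]
      have h3 := hu.le z
      have h4 := hu.nonneg (hyperRefl e m z)
      linarith
    rcases eq_or_lt_of_le hzc.2.1 with h3 | h3
    · rw [hu.zero z h3.ge]
      have h4 := hu.nonneg (hyperRefl e m z)
      linarith
    have h4 : hyperRefl e m z k = 0 :=
      le_antisymm (not_lt.1 fun h => hzD ⟨⟨h1, h2⟩, h3, h⟩) hzc.2.2
    rw [hu.zero _ h4.le, sub_zero]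
    refine (hKu z h3.le).trans ?_
    rw [hRk] at h4
    have h5 : z k ≤ 2 * (inner ℝ z e - m) := by
      have := (abs_le.1 hek).2
      nlinarith
    nlinarith [mul_nonneg hC hs0]

end Lipschitz

lemma rpow_sub_rpow_le {a b r : ℝ} (hr : 1 ≤ r) (ha : 0 ≤ a) (hb : 0 ≤ b) :
    a ^ r - b ^ r ≤ r * a ^ (r - 1) * max (a - b) 0 := by
  rcases le_or_gt a b with hab | hab
  · rw [max_eq_right (by linarith), mul_zero]
    exact sub_nonpos.2 (Real.rpow_le_rpow ha hab (by linarith))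
  · have ha0 : 0 < a := hb.trans_lt hab
    rw [max_eq_left (by linarith)]
    have h1 := one_add_mul_self_le_rpow_one_add (s := b / a - 1) (by
      have : 0 ≤ b / a := by positivity
      linarith) hr
    rw [add_sub_cancel, Real.div_rpow hb ha, le_div_iff₀ (by positivity)] at h1
    have h2 : a ^ r = a ^ (r - 1) * a := by
      rw [← Real.rpow_add_one ha0.ne', sub_add_cancel]
    have h3 : b / a * a = b := by field_simp
    have h4 : (1 + r * (b / a - 1)) * a ^ r = a ^ r - r * a ^ (r - 1) * (a - b) := by
      rw [h2]
      linear_combination (r * a ^ (r - 1)) * h3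
    linarith

section Strip

variable {n : ℕ} {k : Fin n} {lam Lam C : ℝ}

/-- Reflection in the hyperplane `{x k = t}`. -/
noncomputable abbrev planeRefl (k : Fin n) (t : ℝ) (x : Euc n) : Euc n :=
  hyperRefl (EuclideanSpace.single k (1 : ℝ)) t x

lemma planeRefl_eq (t : ℝ) (x : Euc n) :
    planeRefl k t x = x + (2 * (t - x k)) • EuclideanSpace.single k (1 : ℝ) := by
  rw [planeRefl, hyperRefl, inner_single_one_right]

lemma add_smul_single_apply (x : Euc n) (s : ℝ) :
    (x + s • EuclideanSpace.single k (1 : ℝ)) k = x k + s := by simp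

lemma planeRefl_apply (t : ℝ) (x : Euc n) : planeRefl k t x k = 2 * t - x k := by
  rw [planeRefl_eq, add_smul_single_apply]
  ring

lemma norm_planeRefl_sub (t : ℝ) (x y : Euc n) :
    ‖planeRefl k t x - planeRefl k t y‖ = ‖x - y‖ := by
  rw [planeRefl, planeRefl, hyperRefl_eq (norm_single_one k), hyperRefl_eq (norm_single_one k),
    add_sub_add_right_eq_sub, ← map_sub, LinearIsometryEquiv.norm_map]

/-- Barrier profile on the strip `{0 < x k < t}`. -/
noncomputable def stripBarrier (H Γ κ t s : ℝ) : ℝ :=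
  2 + H ^ 2 - s ^ 2 - Γ * κ ^ 2 * Real.exp ((s - t) / κ)

lemma one_le_stripBarrier {H Γ κ t s : ℝ} (hΓ : 0 ≤ Γ) (hκ : 0 < κ) (hΓκ : Γ * κ ^ 2 ≤ 1)
    (hs : 0 ≤ s) (hst : s ≤ t) (htH : t ≤ H) : 1 ≤ stripBarrier H Γ κ t s := by
  have h1 : Real.exp ((s - t) / κ) ≤ 1 :=
    Real.exp_le_one_iff.2 (div_nonpos_of_nonpos_of_nonneg (by linarith) hκ.le)
  have h2 : 0 ≤ Γ * κ ^ 2 := by positivity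
  unfold stripBarrier
  nlinarith [Real.exp_pos ((s - t) / κ)]

lemma stripBarrier_le {H Γ κ t s : ℝ} (hΓ : 0 ≤ Γ) :
    stripBarrier H Γ κ t s ≤ 2 + H ^ 2 := by
  have : 0 ≤ Γ * κ ^ 2 * Real.exp ((s - t) / κ) := by positivity
  unfold stripBarrier
  nlinarith [sq_nonneg s]

lemma isOpen_strip (k : Fin n) (t : ℝ) : IsOpen {x : Euc n | 0 < x k ∧ x k < t} :=
  (isOpen_halfSpace k).inter (isOpen_lt (continuous_coord k) continuous_const)

lemma PucciSubsol.le_stripBarrier {Z h : Euc n → ℝ} {H Γ κ t c ν : ℝ} (hlam : 0 ≤ lam)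
    (hlL : lam ≤ Lam) (hZ : PucciSubsol lam Lam {x | 0 < x k ∧ x k < t} Z h) (hZc : Continuous Z)
    (hΓ : 0 ≤ Γ) (hκ : 0 < κ) (hΓκ : Γ * κ ^ 2 ≤ 1) (htH : t ≤ H)
    (hM : ∀ x, Z x ≤ C) (h0 : ∀ x, x k = 0 → Z x ≤ 0) (ht : ∀ x, x k = t → Z x ≤ 0)
    (hc : 0 ≤ c) (hν : 0 < ν)
    (hop : ∀ x, 0 < x k → x k < t → 0 < Z x →
      c * -(2 + Γ * Real.exp ((x k - t) / κ)) * lam + h x ≤ -ν) :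
    ∀ x, 0 < x k → x k < t → Z x ≤ c * stripBarrier H Γ κ t (x k) := by
  have hD := isOpen_strip k t
  have hDc : closure {x : Euc n | 0 < x k ∧ x k < t} ⊆ {x | 0 ≤ x k ∧ x k ≤ t} :=
    closure_minimal (fun x hx => ⟨hx.1.le, hx.2.le⟩)
      ((isClosed_le continuous_const (continuous_coord k)).inter
        (isClosed_le (continuous_coord k) continuous_const))
  set e : Euc n := EuclideanSpace.single k (1 : ℝ) with he
  have hin : ∀ z : Euc n, inner ℝ z e = z k := fun z => inner_single_one_right z k
  set F : ℝ → ℝ := fun s => c * stripBarrier H Γ κ t s with hF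
  have hexp : ∀ s, HasDerivAt (fun s => Real.exp ((s - t) / κ))
      (Real.exp ((s - t) / κ) * κ⁻¹) s := fun s =>
    ((((hasDerivAt_id s).sub_const t).div_const κ).congr_deriv (one_div κ)).exp
  have hF1 : ∀ s, HasDerivAt F (c * (-(2 * s) - Γ * κ * Real.exp ((s - t) / κ))) s := fun s => by
    have h1 := ((hasDerivAt_pow 2 s).const_sub (2 + H ^ 2)).sub ((hexp s).const_mul (Γ * κ ^ 2))
    refine (h1.const_mul c).congr_deriv ?_
    field_simp
    ring
  have hF2 : ∀ s, HasDerivAt (fun s => c * (-(2 * s) - Γ * κ * Real.exp ((s - t) / κ)))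
      (c * -(2 + Γ * Real.exp ((s - t) / κ))) s := fun s => by
    have h1 := (((hasDerivAt_id s).const_mul 2).fun_neg).sub ((hexp s).const_mul (Γ * κ))
    refine (h1.const_mul c).congr_deriv ?_
    field_simp
    ring
  have hFs : ContDiff ℝ 2 F := by
    simp only [hF, stripBarrier]
    fun_prop
  have hψ : ContDiff ℝ 2 fun z : Euc n => F (inner ℝ z e) :=
    hFs.comp (contDiff_id.inner ℝ contDiff_const)
  have hpos : ∀ x ∈ closure {x : Euc n | 0 < x k ∧ x k < t}, 0 ≤ F (inner ℝ x e) := fun x hx => by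
    rw [hin]
    have := one_le_stripBarrier hΓ hκ hΓκ (hDc hx).1 (hDc hx).2 htH
    exact mul_nonneg hc (by linarith)
  have key := PucciSubsol.le_of_strict (M := C) hlam hlL hD hZ hZc.continuousOn
    hψ.continuous.continuousOn (fun x _ => hψ.contDiffAt)
    (fun x hx => by linarith [hM x, hpos x (subset_closure hx)]) hν
    (fun x hx hlt b a ha => ?_) (fun x hx => ?_)
  · intro x hx hxt
    have := key x ⟨hx, hxt⟩
    rwa [hin] at this
  · rw [linOp_comp_inner hψ.contDiffAt hF1 (hF2 _), hin]
    have h1 := hop x hx.1 hx.2 ((hpos x (subset_closure hx)).trans_lt hlt)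
    have h2 := ha.le_sum_inner b e
    rw [norm_single_one] at h2
    have h3 : 0 ≤ c * (2 + Γ * Real.exp ((x k - t) / κ)) := by positivity
    nlinarith
  · refine le_trans ?_ (hpos x (frontier_subset_closure hx))
    have hxc := hDc (frontier_subset_closure hx)
    have hxD : ¬(0 < x k ∧ x k < t) := fun h => hx.2 (by rwa [hD.interior_eq])
    rcases eq_or_lt_of_le hxc.1 with h1 | h1
    · exact h0 x h1.symm
    · exact ht x (le_antisymm hxc.2 (not_lt.1 fun h => hxD ⟨h1, h⟩))

lemma HalfSpaceSol.subsol_sub_planeRefl {u g : Euc n → ℝ} (hu : HalfSpaceSol k lam Lam C u g)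
    (hlam : 0 ≤ lam) (hlL : lam ≤ Lam) (hgc : Continuous g) (t : ℝ) :
    PucciSubsol lam Lam {x | 0 < x k ∧ x k < t} (fun z => u z - u (planeRefl k t z))
      (fun z => g z - g (planeRefl k t z)) := by
  refine PucciSubsol.sub_supersol k.pos hlam hlL (isOpen_strip k t)
    (hu.sub.mono_set fun z hz => hz.1)
    ((hu.super.comp_hyperRefl hlL (norm_single_one k) t).mono_set fun z hz => ?_)
    hu.cont.continuousOn (hu.cont.comp (continuous_hyperRefl _ _)).continuousOn
    hgc.continuousOn (hgc.comp (continuous_hyperRefl _ _)).continuousOn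
  have h1 := planeRefl_apply (k := k) t z
  have : 0 < 2 * t - z k := by linarith [hz.1, hz.2]
  simp only [mem_ofPred_eq]
  rwa [h1]

end Strip

section Propagation

variable {n : ℕ} {k : Fin n} {lam Lam C K q : ℝ} {u v : Euc n → ℝ}

/-- If `u` is bounded below at a point then `v` is bounded below above that point. -/
lemma HalfSpaceSol.exists_le_above (hv : HalfSpaceSol k lam Lam C v (fun x => u x ^ q))
    (hlam : 0 < lam) (hlL : lam ≤ Lam) (hq : 0 ≤ q) (hK : 0 < K) (hu0 : ∀ x, 0 ≤ u x)
    (huz : ∀ x, x k ≤ 0 → u x = 0)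
    (huK : ∀ x y, u x - u y ≤ K * ‖x - y‖) (hvK : ∀ x y, v x - v y ≤ K * ‖x - y‖)
    {ε : ℝ} (hε : 0 < ε) (T : ℝ) : ∃ δ, 0 < δ ∧ ∀ x, ε ≤ u x → ∀ ℓ ∈ Icc 0 T,
      δ ≤ v (x + ℓ • EuclideanSpace.single k (1 : ℝ)) := by
  have hn : 0 < n := k.pos
  have hLam : 0 < Lam := hlam.trans_le hlL
  set e : Euc n := EuclideanSpace.single k (1 : ℝ) with he
  set ρ := ε / K / 2 with hρ
  have hρ0 : 0 < ρ := by positivity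
  have hKρ : K * ρ = ε / 2 := by rw [hρ]; field_simp
  set ε₂ := (ε / 2) ^ q / (2 * n * Lam) * ρ ^ 2 with hε₂
  have hn' : (0 : ℝ) < n := by positivity
  have hε₂0 : 0 < ε₂ := by positivity
  set r := min (ε₂ / (2 * K)) (ρ / 8) with hr
  have hr0 : 0 < r := by positivity
  have hKr : K * r ≤ ε₂ / 2 := by
    calc K * r ≤ K * (ε₂ / (2 * K)) := by gcongr; exact min_le_left _ _
      _ = ε₂ / 2 := by field_simp
  have hrρ : r ≤ ρ / 8 := min_le_right _ _
  obtain ⟨N, hN⟩ := exists_nat_ge (T / r)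
  rw [div_le_iff₀ hr0] at hN
  have hκ := growthConst_pos hn hlam hlL
  refine ⟨growthConst n lam Lam ^ N * (ε₂ / 2), by positivity, fun x hx ℓ hℓ => ?_⟩
  have hxk : 2 * ρ ≤ x k := by
    rcases le_or_gt (x k) 0 with h | h
    · rw [huz x h] at hx
      linarith
    have h1 := huK x (x + (-x k) • e)
    rw [huz (x + (-x k) • e) (by rw [add_smul_single_apply]; linarith), sub_zero,
      sub_add_cancel_left, neg_smul, neg_neg, norm_smul, norm_single_one, mul_one,
      Real.norm_eq_abs, abs_of_pos h] at h1
    nlinarith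
  have hball : ∀ {y : Euc n} {s : ℝ}, s < y k → closedBall y s ⊆ {z | 0 < z k} := by
    intro y s hs z hz
    rw [mem_closedBall, dist_eq_norm] at hz
    have h1 := (neg_abs_le _).trans' (neg_le_neg (abs_coord_le_norm (z - y) k))
    rw [PiLp.sub_apply] at h1
    simp only [mem_ofPred_eq]
    linarith
  have hvx : ε₂ ≤ v x := by
    have := PucciSupersol.ge_paraboloid hn hlam hlL (c := (ε / 2) ^ q) (by positivity) hρ0
      (hv.super.mono_set (ball_subset_closedBall.trans (hball (by linarith : ρ < x k))))
      hv.cont.continuousOn (fun z _ => hv.nonneg z) (fun z hz => ?_) x (mem_ball_self hρ0)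
    · simpa using this
    · refine Real.rpow_le_rpow (by positivity) ?_ hq
      rw [mem_ball', dist_eq_norm] at hz
      have := huK x z
      nlinarith
  have hneg := (hv.super.neg_subsol hlL fun x _ => Real.rpow_nonneg (hu0 x) q).le_along_segment
    (x := x) (ρ := r) (c := ε₂ / 2) (ℓ := ℓ) hn hlam hlL hr0 (by positivity) (norm_single_one k)
    hv.cont.neg.continuousOn (fun z _ => neg_nonpos.2 (hv.nonneg z)) (fun z hz => ?_) hℓ.1
    (fun s hs => hball ?_) N (hℓ.2.trans hN) (x + ℓ • e) (mem_closedBall_self hr0.le)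
  · linarith
  · rw [mem_closedBall', dist_eq_norm] at hz
    have := hvK x z
    nlinarith
  · rw [add_smul_single_apply]
    linarith [hs.1]

/-- Where `u` is bounded below and away from the reflection plane, the monotonicity of `v` with
respect to reflection is strict, quantitatively. -/
lemma HalfSpaceSol.exists_le_refl_sub (hv : HalfSpaceSol k lam Lam C v (fun x => u x ^ q))
    (hlam : 0 < lam) (hlL : lam ≤ Lam) (hq : 0 ≤ q) (hK : 0 < K) (huc : Continuous u)
    (hu0 : ∀ x, 0 ≤ u x) (huz : ∀ x, x k ≤ 0 → u x = 0)
    (huK : ∀ x y, u x - u y ≤ K * ‖x - y‖) (hvK : ∀ x y, v x - v y ≤ K * ‖x - y‖)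
    {ε η t : ℝ} (hε : 0 < ε) (hη : 0 < η)
    (hPu : ∀ x, x k ≤ t → u x ≤ u (planeRefl k t x))
    (hPv : ∀ x, x k ≤ t → v x ≤ v (planeRefl k t x)) :
    ∃ δ, 0 < δ ∧ ∀ x, ε ≤ u x → x k ≤ t - η → δ ≤ v (planeRefl k t x) - v x := by
  have hn : 0 < n := k.pos
  set e : Euc n := EuclideanSpace.single k (1 : ℝ) with he
  obtain ⟨δ₀, hδ₀, hab⟩ := hv.exists_le_above hlam hlL hq hK hu0 huz huK hvK hε (2 * t)
  set r := min (min (ε / K / 8) (η / 8)) (δ₀ / (24 * K)) with hr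
  have hr0 : 0 < r := by positivity
  have hKr : 24 * K * r ≤ δ₀ := by
    calc 24 * K * r ≤ 24 * K * (δ₀ / (24 * K)) := by gcongr; exact min_le_right _ _
      _ = δ₀ := by field_simp
  have hrη : r ≤ η / 8 := (min_le_left _ _).trans (min_le_right _ _)
  have hrε : K * r ≤ ε / 8 := by
    calc K * r ≤ K * (ε / K / 8) := by
          gcongr
          exact (min_le_left _ _).trans (min_le_left _ _)
      _ = ε / 8 := by field_simp
  obtain ⟨N, hN⟩ := exists_nat_ge (t / r)
  rw [div_le_iff₀ hr0] at hN
  have hκ := growthConst_pos hn hlam hlL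
  refine ⟨growthConst n lam Lam ^ N * (δ₀ / 2), by positivity, fun x hx hxt => ?_⟩
  have hxk0 : 0 < x k := by
    by_contra! h
    rw [huz x h] at hx
    linarith
  set x₀ := x + (-x k) • e with hx₀
  have hx₀k : x₀ k = 0 := by rw [hx₀, add_smul_single_apply]; ring
  have hxk : 8 * r ≤ x k := by
    have h1 := huK x x₀
    rw [huz x₀ hx₀k.le, sub_zero, hx₀, sub_add_cancel_left,
      neg_smul, neg_neg, norm_smul, norm_single_one, mul_one, Real.norm_eq_abs,
      abs_of_pos hxk0] at h1
    nlinarith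
  have hcoord : ∀ {y z : Euc n} {s : ℝ}, z ∈ closedBall y s → y k - s ≤ z k ∧ z k ≤ y k + s := by
    intro y z s hz
    rw [mem_closedBall, dist_eq_norm] at hz
    have h1 := abs_le.1 ((abs_coord_le_norm (z - y) k).trans hz)
    rw [PiLp.sub_apply] at h1
    constructor <;> linarith
  set W : Euc n → ℝ := fun z => v z - v (planeRefl k t z) with hW
  have hWc : Continuous W := hv.cont.sub (hv.cont.comp (continuous_hyperRefl _ _))
  have hWx₀ : W x₀ ≤ -δ₀ := by
    have h1 : planeRefl k t x₀ = x + (2 * t - x k) • e := by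
      rw [planeRefl_eq, hx₀k, hx₀, add_assoc, ← add_smul]
      congr 2
      ring
    have h2 := hab x hx (2 * t - x k) ⟨by linarith, by linarith⟩
    simp only [hW]
    rw [h1, hv.zero x₀ hx₀k.le]
    linarith
  have hWlip : ∀ z, W z - W x₀ ≤ 2 * K * ‖z - x₀‖ := fun z => by
    have h1 := hvK z x₀
    have h2 := hvK (planeRefl k t x₀) (planeRefl k t z)
    rw [norm_planeRefl_sub, norm_sub_rev] at h2
    simp only [hW]
    linarith
  set Ω : Set (Euc n) := {z | 0 < z k ∧ z k < t} with hΩ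
  have hgc : Continuous fun x => u x ^ q := huc.rpow_const fun _ => Or.inr hq
  have hsub : PucciSubsol lam Lam Ω W (fun _ => 0) := by
    refine (hv.subsol_sub_planeRefl hlam.le hlL hgc t).mono_rhs fun z hz => ?_
    exact sub_nonpos.2 (Real.rpow_le_rpow (hu0 z) (hPu z hz.2.le) hq)
  have hend := hsub.le_along_segment (x := x₀ + (5 * r) • e) (ρ := r) (c := δ₀ / 2)
    (ℓ := x k - 5 * r) hn hlam hlL hr0 (by positivity) (norm_single_one k) hWc.continuousOn
    (fun z hz => sub_nonpos.2 (hPv z hz.2.le)) (fun z hz => ?_) (by linarith)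
    (fun s hs z hz => ?_) N (by linarith) x ?_
  · simp only [hW] at hend
    linarith
  · have h1 := hWlip z
    have h2 : ‖z - x₀‖ ≤ 6 * r := by
      rw [mem_closedBall, dist_eq_norm] at hz
      have h3 : z - x₀ = (z - (x₀ + (5 * r) • e)) + (5 * r) • e := by abel
      have h4 : ‖(5 * r) • e‖ = 5 * r := by
        rw [norm_smul, norm_single_one, mul_one, Real.norm_eq_abs, abs_of_pos (by positivity)]
      rw [h3]
      linarith [norm_add_le (z - (x₀ + (5 * r) • e)) ((5 * r) • e)]
    have h3 : 2 * K * ‖z - x₀‖ ≤ 2 * K * (6 * r) := by gcongr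
    linarith
  · have h1 := hcoord hz
    rw [add_smul_single_apply, add_smul_single_apply, hx₀k] at h1
    have h2 := hs.1
    have h3 := hs.2
    constructor <;> linarith
  · have : x₀ + (5 * r) • e + (x k - 5 * r) • e = x := by
      rw [hx₀, add_assoc, add_assoc, ← add_smul, ← add_smul]
      simp
    rw [this]
    exact mem_closedBall_self hr0.le

/-- After moving the plane slightly, `v` can fail to be monotone only near the plane or where `u`
is small. -/
lemma HalfSpaceSol.exists_near_plane (hv : HalfSpaceSol k lam Lam C v (fun x => u x ^ q))
    (hlam : 0 < lam) (hlL : lam ≤ Lam) (hq : 0 ≤ q) (hK : 0 < K) (huc : Continuous u)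
    (hu0 : ∀ x, 0 ≤ u x) (huz : ∀ x, x k ≤ 0 → u x = 0)
    (huK : ∀ x y, u x - u y ≤ K * ‖x - y‖) (hvK : ∀ x y, v x - v y ≤ K * ‖x - y‖)
    {ε κ t : ℝ} (hε : 0 < ε) (hκ : 0 < κ)
    (hPu : ∀ x, x k ≤ t → u x ≤ u (planeRefl k t x))
    (hPv : ∀ x, x k ≤ t → v x ≤ v (planeRefl k t x)) :
    ∃ δ, 0 < δ ∧ δ ≤ 1 ∧ ∀ t' ∈ Icc t (t + δ), ∀ x, 0 < x k → ε ≤ u x →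
      0 < v x - v (planeRefl k t' x) → t' - κ ≤ x k := by
  obtain ⟨δ₂, hδ₂, hδ⟩ := hv.exists_le_refl_sub hlam hlL hq hK huc hu0 huz huK hvK hε
    (half_pos hκ) hPu hPv
  refine ⟨min (min (κ / 2) 1) (δ₂ / (2 * K)), by positivity,
    (min_le_left _ _).trans (min_le_right _ _), fun t' ht' x hx hux hlt => ?_⟩
  by_contra! hcon
  have hd1 : t' - t ≤ κ / 2 := by
    have : min (min (κ / 2) 1) (δ₂ / (2 * K)) ≤ κ / 2 := (min_le_left _ _).trans (min_le_left _ _)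
    linarith [ht'.2]
  have hd2 : 2 * K * (t' - t) ≤ δ₂ := by
    have h1 := min_le_right (min (κ / 2) 1) (δ₂ / (2 * K))
    calc 2 * K * (t' - t) ≤ 2 * K * (δ₂ / (2 * K)) := by
          gcongr
          linarith [ht'.2]
      _ = δ₂ := by field_simp
  have h1 := hδ x hux (by linarith)
  have h2 := hvK (planeRefl k t x) (planeRefl k t' x)
  have h3 : ‖planeRefl k t x - planeRefl k t' x‖ = 2 * (t' - t) := by
    rw [planeRefl_eq, planeRefl_eq, add_sub_add_left_eq_sub, ← sub_smul, norm_smul,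
      norm_single_one, mul_one, Real.norm_eq_abs, abs_of_nonpos (by linarith [ht'.1])]
    ring
  rw [h3] at h2
  linarith

end Propagation

section MovingPlane

variable {n : ℕ} {k : Fin n} {lam₁ Lam₁ lam₂ Lam₂ C K p q : ℝ} {u v : Euc n → ℝ}

/-- The reflected function dominates on the left of the plane `{x k = t}`. -/
def ReflDominates (k : Fin n) (u : Euc n → ℝ) (t : ℝ) : Prop :=
  ∀ x, x k ≤ t → u x ≤ u (planeRefl k t x)

lemma HalfSpaceSol.reflDominates_of_strip {lam Lam : ℝ} {g : Euc n → ℝ} {t : ℝ}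
    (hu : HalfSpaceSol k lam Lam C u g)
    (h : ∀ x, 0 < x k → x k < t → u x - u (planeRefl k t x) ≤ 0) : ReflDominates k u t := by
  intro x hx
  rcases le_or_gt (x k) 0 with h0 | h0
  · rw [hu.zero x h0]
    exact hu.nonneg _
  rcases eq_or_lt_of_le hx with h1 | h1
  · rw [planeRefl_eq, h1]
    simp
  · linarith [h x h0 h1]

/-- Narrow-and-small-region iteration: the two differences with the reflected functions are
nonpositive on the strip as soon as the second one is controlled near the plane. -/
lemma HalfSpaceSol.sub_planeRefl_nonpos {H Γ κ t A ε : ℝ}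
    (hu : HalfSpaceSol k lam₁ Lam₁ C u (fun x => v x ^ p))
    (hv : HalfSpaceSol k lam₂ Lam₂ C v (fun x => u x ^ q))
    (hlam₁ : 0 < lam₁) (hL₁ : lam₁ ≤ Lam₁) (hlam₂ : 0 < lam₂) (hL₂ : lam₂ ≤ Lam₂)
    (hp : 1 ≤ p) (hq : 1 ≤ q) (hC : 0 ≤ C) (hΓ : 0 ≤ Γ) (hκ : 0 < κ) (hΓκ : Γ * κ ^ 2 ≤ 1)
    (htH : t ≤ H) (hA1 : 1 ≤ A)
    (hA : p * C ^ (p - 1) * (2 + H ^ 2) + 1 ≤ 3 / 2 * A * lam₁)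
    (hε : q * ε ^ (q - 1) * (A * (2 + H ^ 2)) ≤ lam₂)
    (hΓA : q * C ^ (q - 1) * (A * (2 + H ^ 2)) + 1 ≤ 3 / 4 * (Γ * Real.exp (-1)) * lam₂)
    (hnear : ∀ x, 0 < x k → ε ≤ u x → 0 < v x - v (planeRefl k t x) → t - κ ≤ x k) :
    (∀ x, 0 < x k → x k < t → u x - u (planeRefl k t x) ≤ 0) ∧
      ∀ x, 0 < x k → x k < t → v x - v (planeRefl k t x) ≤ 0 := by
  set φ := stripBarrier H Γ κ t with hφ
  have hgc₁ : Continuous fun x => v x ^ p := hv.cont.rpow_const fun _ => Or.inr (by linarith)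
  have hgc₂ : Continuous fun x => u x ^ q := hu.cont.rpow_const fun _ => Or.inr (by linarith)
  have hbdry : ∀ {w : Euc n → ℝ}, (∀ x, x k ≤ 0 → w x = 0) → (∀ x, 0 ≤ w x) →
      (∀ x, x k = 0 → w x - w (planeRefl k t x) ≤ 0) ∧
      ∀ x, x k = t → w x - w (planeRefl k t x) ≤ 0 := by
    intro w hz h0
    refine ⟨fun x hx => ?_, fun x hx => ?_⟩
    · rw [hz x hx.le]
      linarith [h0 (planeRefl k t x)]
    · rw [planeRefl_eq, hx]
      simp
  have hub : ∀ x, u x - u (planeRefl k t x) ≤ C := fun x => by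
    linarith [hu.le x, hu.nonneg (planeRefl k t x)]
  have hvb : ∀ x, v x - v (planeRefl k t x) ≤ C := fun x => by
    linarith [hv.le x, hv.nonneg (planeRefl k t x)]
  have hφ1 : ∀ {x : Euc n}, 0 < x k → x k < t → 1 ≤ φ (x k) := fun h0 h1 =>
    one_le_stripBarrier hΓ hκ hΓκ h0.le h1.le htH
  have hφB : ∀ s, φ s ≤ 2 + H ^ 2 := fun s => stripBarrier_le hΓ
  have hstep : ∀ j : ℕ,
      (∀ x, 0 < x k → x k < t →
        u x - u (planeRefl k t x) ≤ A * ((3 / 4) ^ j * (C + 1)) * φ (x k)) ∧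
      ∀ x, 0 < x k → x k < t → v x - v (planeRefl k t x) ≤ (3 / 4) ^ j * (C + 1) * φ (x k) := by
    intro j
    induction j with
    | zero =>
      refine ⟨fun x h0 h1 => ?_, fun x h0 h1 => ?_⟩
      · have h2 := hφ1 h0 h1
        have h3 := hub x
        have h4 : C + 1 ≤ A * (C + 1) := by nlinarith
        have h5 : A * (C + 1) ≤ A * (C + 1) * φ (x k) := by
          have : 0 ≤ A * (C + 1) := by linarith
          nlinarith
        simp only [pow_zero, one_mul]
        linarith
      · have h2 := hφ1 h0 h1
        have h3 := hvb x
        simp only [pow_zero, one_mul]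
        nlinarith
    | succ j ih =>
      set m := (3 / 4) ^ j * (C + 1) with hm
      have hm0 : 0 < m := by positivity
      have hm' : (3 / 4) ^ (j + 1) * (C + 1) = 3 / 4 * m := by rw [hm, pow_succ]; ring
      rw [hm']
      have hB0 : 0 < 2 + H ^ 2 := by positivity
      constructor
      · have := PucciSubsol.le_stripBarrier (c := A * (3 / 4 * m)) (ν := m) hlam₁.le hL₁
          (hu.subsol_sub_planeRefl hlam₁.le hL₁ hgc₁ t)
          (hu.cont.sub (hu.cont.comp (continuous_hyperRefl _ _))) hΓ hκ hΓκ htH hub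
          (hbdry hu.zero hu.nonneg).1 (hbdry hu.zero hu.nonneg).2 (by positivity) hm0
          (fun x h0 h1 _ => ?_)
        · exact this
        · have h2 := rpow_sub_rpow_le hp (hv.nonneg x) (hv.nonneg (planeRefl k t x))
          have h3 : max (v x - v (planeRefl k t x)) 0 ≤ m * (2 + H ^ 2) := by
            refine max_le ((ih.2 x h0 h1).trans ?_) (by positivity)
            gcongr
            exact hφB _
          have h4 : v x ^ (p - 1) ≤ C ^ (p - 1) :=
            Real.rpow_le_rpow (hv.nonneg x) (hv.le x) (by linarith)
          have h5 : p * v x ^ (p - 1) * max (v x - v (planeRefl k t x)) 0 ≤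
              p * C ^ (p - 1) * (m * (2 + H ^ 2)) := by
            gcongr
          have h6 : 0 ≤ A * (3 / 4 * m) * (Γ * Real.exp ((x k - t) / κ)) * lam₁ := by positivity
          have h7 : m * (p * C ^ (p - 1) * (2 + H ^ 2) + 1) ≤ m * (3 / 2 * A * lam₁) := by gcongr
          linarith
      · have := PucciSubsol.le_stripBarrier (c := 3 / 4 * m) (ν := m * min (lam₂ / 2) 1)
          hlam₂.le hL₂
          (hv.subsol_sub_planeRefl hlam₂.le hL₂ hgc₂ t)
          (hv.cont.sub (hv.cont.comp (continuous_hyperRefl _ _))) hΓ hκ hΓκ htH hvb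
          (hbdry hv.zero hv.nonneg).1 (hbdry hv.zero hv.nonneg).2 (by positivity) (by positivity)
          (fun x h0 h1 hpos => ?_)
        · exact this
        · have h2 := rpow_sub_rpow_le hq (hu.nonneg x) (hu.nonneg (planeRefl k t x))
          have h3 : max (u x - u (planeRefl k t x)) 0 ≤ A * m * (2 + H ^ 2) := by
            refine max_le ((ih.1 x h0 h1).trans ?_) (by positivity)
            gcongr
            exact hφB _
          have hbound : ∀ c, u x ≤ c → q * u x ^ (q - 1) * max (u x - u (planeRefl k t x)) 0 ≤
              q * c ^ (q - 1) * (A * m * (2 + H ^ 2)) := by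
            intro c hc
            have h4 : u x ^ (q - 1) ≤ c ^ (q - 1) :=
              Real.rpow_le_rpow (hu.nonneg x) hc (by linarith)
            have hc0 : 0 ≤ c := (hu.nonneg x).trans hc
            gcongr
          rcases le_or_gt ε (u x) with hux | hux
          · have h4 := hbound C (hu.le x)
            have h5 : Real.exp (-1) ≤ Real.exp ((x k - t) / κ) := by
              refine Real.exp_le_exp.2 ?_
              rw [le_div_iff₀ hκ]
              linarith [hnear x h0 hux hpos]
            have h6 : m * (3 / 4 * (Γ * Real.exp (-1)) * lam₂) ≤
                m * (3 / 4 * (Γ * Real.exp ((x k - t) / κ)) * lam₂) := by gcongr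
            have h7 : m * (q * C ^ (q - 1) * (A * (2 + H ^ 2)) + 1) ≤
              m * (3 / 4 * (Γ * Real.exp (-1)) * lam₂) := by gcongr
            have h8 : m * min (lam₂ / 2) 1 ≤ m * 1 := by
              gcongr
              exact min_le_right _ _
            have h9 : 0 ≤ m * lam₂ := by positivity
            linarith
          · have h4 := hbound ε hux.le
            have h6 : 0 ≤ m * (Γ * Real.exp ((x k - t) / κ) * lam₂) := by positivity
            have h7 : m * (q * ε ^ (q - 1) * (A * (2 + H ^ 2))) ≤ m * lam₂ := by gcongr
            have h8 : m * min (lam₂ / 2) 1 ≤ m * (lam₂ / 2) := by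
              gcongr
              exact min_le_left _ _
            linarith
  have hlim : ∀ c : ℝ, Tendsto (fun j : ℕ => (3 / 4 : ℝ) ^ j * c) atTop (𝓝 0) := fun c => by
    simpa using (tendsto_pow_atTop_nhds_zero_of_lt_one (r := (3 / 4 : ℝ)) (by norm_num)
      (by norm_num)).mul_const c
  refine ⟨fun x h0 h1 => ?_, fun x h0 h1 => ?_⟩
  · refine ge_of_tendsto' (hlim (A * (C + 1) * φ (x k))) fun j => ((hstep j).1 x h0 h1).trans ?_
    exact le_of_eq (by ring)
  · refine ge_of_tendsto' (hlim ((C + 1) * φ (x k))) fun j => ((hstep j).2 x h0 h1).trans ?_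
    exact le_of_eq (by ring)

lemma HalfSpaceSol.exists_reflDominates_Icc {t : ℝ}
    (hu : HalfSpaceSol k lam₁ Lam₁ C u (fun x => v x ^ p))
    (hv : HalfSpaceSol k lam₂ Lam₂ C v (fun x => u x ^ q))
    (hlam₁ : 0 < lam₁) (hL₁ : lam₁ ≤ Lam₁) (hlam₂ : 0 < lam₂) (hL₂ : lam₂ ≤ Lam₂)
    (hp : 1 ≤ p) (hq : 1 < q) (hC : 0 ≤ C) (hK : 0 < K)
    (huK : ∀ x y, u x - u y ≤ K * ‖x - y‖) (hvK : ∀ x y, v x - v y ≤ K * ‖x - y‖)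
    (hPu : ReflDominates k u t) (hPv : ReflDominates k v t) :
    ∃ δ, 0 < δ ∧ ∀ t' ∈ Icc t (t + δ), ReflDominates k u t' ∧ ReflDominates k v t' := by
  set H := t + 1
  set B := 2 + H ^ 2 with hB
  have hB0 : 0 < B := by positivity
  set A := 1 + (p * C ^ (p - 1) * B + 1) / lam₁ with hA
  have hA1 : 1 ≤ A := le_add_of_nonneg_right (by positivity)
  have hAl : p * C ^ (p - 1) * B + 1 ≤ 3 / 2 * A * lam₁ := by
    have h1 : A * lam₁ = lam₁ + (p * C ^ (p - 1) * B + 1) := by rw [hA]; field_simp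
    have h2 : 0 ≤ p * C ^ (p - 1) * B := by positivity
    nlinarith
  obtain ⟨ε, hε0, hε⟩ : ∃ ε : ℝ, 0 < ε ∧ q * ε ^ (q - 1) * (A * B) ≤ lam₂ := by
    refine ⟨(lam₂ / (q * (A * B))) ^ (q - 1)⁻¹, by positivity, le_of_eq ?_⟩
    rw [Real.rpow_inv_rpow (by positivity) (by linarith)]
    field_simp
  set Γ := 4 / 3 * (q * C ^ (q - 1) * (A * B) + 1) / (Real.exp (-1) * lam₂) with hΓ
  have hΓ0 : 0 < Γ := by positivity
  have hΓl : q * C ^ (q - 1) * (A * B) + 1 ≤ 3 / 4 * (Γ * Real.exp (-1)) * lam₂ := by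
    refine le_of_eq ?_
    rw [hΓ]
    field_simp
  set κ := 1 / (Γ + 1) with hκ
  have hκ0 : 0 < κ := by positivity
  have hΓκ : Γ * κ ^ 2 ≤ 1 := by
    rw [hκ, div_pow, one_pow, mul_one_div, div_le_iff₀ (by positivity)]
    nlinarith
  obtain ⟨δ, hδ0, hδ1, hδ⟩ := hv.exists_near_plane hlam₂ hL₂ (by linarith) hK hu.cont hu.nonneg
    hu.zero huK hvK hε0 hκ0 hPu hPv
  refine ⟨δ, hδ0, fun t' ht' => ?_⟩
  obtain ⟨h1, h2⟩ := hu.sub_planeRefl_nonpos hv (H := H) hlam₁ hL₁ hlam₂ hL₂ hp hq.le hC hΓ0.le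
    hκ0 hΓκ (by simp only [H]; linarith [ht'.2]) hA1 hAl hε hΓl (hδ t' ht')
  exact ⟨hu.reflDominates_of_strip h1, hv.reflDominates_of_strip h2⟩

lemma reflDominates_iff {t : ℝ} : ReflDominates k u t ↔ ∀ x, x k = 0 → ∀ s, 0 ≤ s →
    u (x + (t - s) • EuclideanSpace.single k (1 : ℝ)) ≤
      u (x + (t + s) • EuclideanSpace.single k (1 : ℝ)) := by
  refine ⟨fun h x hx s hs => ?_, fun h x hx => ?_⟩
  · convert h (x + (t - s) • EuclideanSpace.single k (1 : ℝ)) ?_ using 2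
    · rw [planeRefl_eq, add_smul_single_apply, hx, add_assoc, ← add_smul]
      congr 2
      ring
    · rw [add_smul_single_apply, hx]
      linarith
  · convert h (x + (-x k) • EuclideanSpace.single k (1 : ℝ)) (by
      rw [add_smul_single_apply]
      ring) (t - x k) (by linarith) using 2
    · rw [add_assoc, ← add_smul]
      simp
    · rw [planeRefl_eq, add_assoc, ← add_smul]
      congr 2
      ring

lemma isClosed_reflDominates (hu : Continuous u) : IsClosed {t | ReflDominates k u t} := by
  simp only [reflDominates_iff, ofPred_forall]
  refine isClosed_iInter fun x => isClosed_iInter fun _ => isClosed_iInter fun s =>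
    isClosed_iInter fun _ => isClosed_le ?_ ?_ <;> exact hu.comp (by fun_prop)

lemma HalfSpaceSol.reflDominates
    (hu : HalfSpaceSol k lam₁ Lam₁ C u (fun x => v x ^ p))
    (hv : HalfSpaceSol k lam₂ Lam₂ C v (fun x => u x ^ q))
    (hlam₁ : 0 < lam₁) (hL₁ : lam₁ ≤ Lam₁) (hlam₂ : 0 < lam₂) (hL₂ : lam₂ ≤ Lam₂)
    (hp : 1 ≤ p) (hq : 1 < q) (hC : 0 ≤ C) {t : ℝ} (ht : 0 ≤ t) :
    ReflDominates k u t ∧ ReflDominates k v t := by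
  have hlip : ∃ K, 0 < K ∧ (∀ x y, u x - u y ≤ K * ‖x - y‖) ∧ ∀ x y, v x - v y ≤ K * ‖x - y‖ := by
    obtain ⟨K₁, hK₁, h₁⟩ := hu.exists_lipschitz hlam₁ hL₁ hC (C₀ := C ^ p) (by positivity)
      (hv.cont.rpow_const fun _ => Or.inr (by linarith)) (fun x => Real.rpow_nonneg (hv.nonneg x) p)
      fun x => Real.rpow_le_rpow (hv.nonneg x) (hv.le x) (by linarith)
    obtain ⟨K₂, hK₂, h₂⟩ := hv.exists_lipschitz hlam₂ hL₂ hC (C₀ := C ^ q) (by positivity)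
      (hu.cont.rpow_const fun _ => Or.inr (by linarith)) (fun x => Real.rpow_nonneg (hu.nonneg x) q)
      fun x => Real.rpow_le_rpow (hu.nonneg x) (hu.le x) (by linarith)
    refine ⟨K₁ + K₂, by positivity, fun x y => (h₁ x y).trans ?_, fun x y => (h₂ x y).trans ?_⟩ <;>
      gcongr <;> linarith
  obtain ⟨K, hK, huK, hvK⟩ := hlip
  have hcl : IsClosed ({t | ReflDominates k u t} ∩ {t | ReflDominates k v t} ∩ Icc 0 t) :=
    ((isClosed_reflDominates hu.cont).inter (isClosed_reflDominates hv.cont)).inter isClosed_Icc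
  refine hcl.Icc_subset_of_forall_exists_gt ⟨?_, ?_⟩ (fun s hs y hy => ?_) ⟨ht, le_rfl⟩
  · exact hu.reflDominates_of_strip fun x h0 h1 => by linarith
  · exact hv.reflDominates_of_strip fun x h0 h1 => by linarith
  · obtain ⟨δ, hδ, h⟩ := hu.exists_reflDominates_Icc hv hlam₁ hL₁ hlam₂ hL₂ hp hq hC hK huK hvK
      hs.1.1 hs.1.2
    have hy' : s < y := hy
    have hm : s < min y (s + δ) := lt_min hy' (by linarith)
    exact ⟨min y (s + δ), h _ ⟨hm.le, min_le_right _ _⟩, hm, min_le_left _ _⟩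

/-- Bounded positive solutions in the half space are nondecreasing in the normal direction. -/
theorem HalfSpaceSol.monotone
    (hu : HalfSpaceSol k lam₁ Lam₁ C u (fun x => v x ^ p))
    (hv : HalfSpaceSol k lam₂ Lam₂ C v (fun x => u x ^ q))
    (hlam₁ : 0 < lam₁) (hL₁ : lam₁ ≤ Lam₁) (hlam₂ : 0 < lam₂) (hL₂ : lam₂ ≤ Lam₂)
    (hp : 1 ≤ p) (hq : 1 ≤ q) (hpq : 1 < p * q) (hC : 0 ≤ C) (x : Euc n) {s : ℝ} (hs : 0 ≤ s) :
    u x ≤ u (x + s • EuclideanSpace.single k (1 : ℝ)) ∧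
      v x ≤ v (x + s • EuclideanSpace.single k (1 : ℝ)) := by
  have hdom : ∀ t, 0 ≤ t → ReflDominates k u t ∧ ReflDominates k v t := by
    intro t ht
    rcases eq_or_lt_of_le hq with h1 | h1
    · rw [← h1, mul_one] at hpq
      exact (hv.reflDominates hu hlam₂ hL₂ hlam₁ hL₁ hq hpq hC ht).symm
    · exact hu.reflDominates hv hlam₁ hL₁ hlam₂ hL₂ hp h1 hC ht
  rcases le_or_gt (x k) 0 with hx | hx
  · rw [hu.zero x hx, hv.zero x hx]
    exact ⟨hu.nonneg _, hv.nonneg _⟩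
  · obtain ⟨h1, h2⟩ := hdom (x k + s / 2) (by linarith)
    have h3 := h1 x (by linarith)
    have h4 := h2 x (by linarith)
    have h5 : 2 * (x k + s / 2 - x k) = s := by ring
    rw [planeRefl_eq, h5] at h3 h4
    exact ⟨h3, h4⟩

end MovingPlane

section Radial

variable {n : ℕ} {lam Lam : ℝ} {u g : Euc n → ℝ}

/-- The extremal coefficients for radially decreasing, convex functions. -/
lemma exists_isCoef_radial (hn : 0 < n) (hlL : lam ≤ Lam) {w : Euc n} (hw : w ≠ 0) :
    ∃ (b : EucBasis n) (a : Fin n → ℝ), IsCoef lam Lam a ∧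
      ∑ i, a i * inner ℝ (b i) w ^ 2 = Lam * ‖w‖ ^ 2 ∧ ∑ i, a i = Lam + (n - 1) * lam := by
  classical
  have hw0 : ‖w‖ ≠ 0 := norm_ne_zero_iff.2 hw
  set i₀ : Fin n := ⟨0, hn⟩
  have horth : Orthonormal ℝ (({i₀} : Set (Fin n)).domRestrict fun _ => ‖w‖⁻¹ • w) := by
    refine ⟨fun i => ?_, fun i j hij => absurd (Subsingleton.elim i j) hij⟩
    change ‖‖w‖⁻¹ • w‖ = 1
    rw [norm_smul, norm_inv, norm_norm, inv_mul_cancel₀ hw0]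
  obtain ⟨b, hb⟩ := horth.exists_orthonormalBasis_extension_of_card_eq (by simp)
  have hb0 : b i₀ = ‖w‖⁻¹ • w := hb i₀ rfl
  have hwb : w = ‖w‖ • b i₀ := by rw [hb0, smul_smul, mul_inv_cancel₀ hw0, one_smul]
  have hin : ∀ i, i ≠ i₀ → inner ℝ (b i) w = (0 : ℝ) := fun i hi => by
    rw [hwb, inner_smul_right, b.orthonormal.2 hi, mul_zero]
  have hin0 : inner ℝ (b i₀) w = ‖w‖ := by
    conv_lhs => rw [hwb]
    rw [inner_smul_right, real_inner_self_eq_norm_sq, b.orthonormal.1, one_pow, mul_one]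
  refine ⟨b, fun i => if i = i₀ then Lam else lam, fun i => ?_, ?_, ?_⟩
  · dsimp only
    split_ifs <;> simp [hlL]
  · rw [Finset.sum_eq_single i₀ (fun i _ hi => by rw [hin i hi]; ring) (by simp)]
    simp [hin0]
  · have : ∀ i, (if i = i₀ then Lam else lam) = (if i = i₀ then Lam - lam else 0) + lam := by
      intro i
      split_ifs <;> ring
    simp only [this, Finset.sum_add_distrib, Finset.sum_ite_eq', Finset.mem_univ, if_true,
      Finset.sum_const, Finset.card_univ, Fintype.card_fin, nsmul_eq_mul]
    ring

/-- Comparison of a supersolution with a radial function in an annulus. -/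
lemma PucciSupersol.ge_radial {y : Euc n} {α γ : ℝ} {F F' F'' : ℝ → ℝ} (hn : 0 < n)
    (hlam : 0 < lam) (hlL : lam ≤ Lam) (hα : 0 < α)
    (hu : PucciSupersol lam Lam {x | α < ‖x - y‖ ^ 2 ∧ ‖x - y‖ ^ 2 < γ} u g) (huc : Continuous u)
    (hF : ∀ s, 0 < s → ContDiffAt ℝ 2 F s) (hF1 : ∀ s, 0 < s → HasDerivAt F (F' s) s)
    (hF2 : ∀ s, 0 < s → HasDerivAt F' (F'' s) s)
    (hop : ∀ x, α < ‖x - y‖ ^ 2 → ‖x - y‖ ^ 2 < γ → 0 ≤ 4 * F'' (‖x - y‖ ^ 2) *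
      (Lam * ‖x - y‖ ^ 2) + 2 * F' (‖x - y‖ ^ 2) * (Lam + (n - 1) * lam) + g x)
    (hα' : ∀ x, ‖x - y‖ ^ 2 = α → F α ≤ u x) (hγ : ∀ x, ‖x - y‖ ^ 2 = γ → F γ ≤ u x) :
    ∀ x, α ≤ ‖x - y‖ ^ 2 → ‖x - y‖ ^ 2 ≤ γ → F (‖x - y‖ ^ 2) ≤ u x := by
  set D : Set (Euc n) := {x | α < ‖x - y‖ ^ 2 ∧ ‖x - y‖ ^ 2 < γ} with hDdef
  have hsq := contDiff_norm_sub_sq y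
  have hD : IsOpen D := (isOpen_lt continuous_const hsq.continuous).inter
    (isOpen_lt hsq.continuous continuous_const)
  have hDc : closure D ⊆ {x | α ≤ ‖x - y‖ ^ 2 ∧ ‖x - y‖ ^ 2 ≤ γ} :=
    closure_minimal (fun x hx => ⟨hx.1.le, hx.2.le⟩)
      ((isClosed_le continuous_const hsq.continuous).inter
        (isClosed_le hsq.continuous continuous_const))
  have hsm : ∀ x ∈ closure D, ContDiffAt ℝ 2 (fun x => F (‖x - y‖ ^ 2)) x := fun x hx =>
    (hF _ (hα.trans_le (hDc hx).1)).comp x hsq.contDiffAt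
  have hb : Bornology.IsBounded D := by
    refine isBounded_closedBall.subset (t := closedBall y (Real.sqrt γ)) fun x hx => ?_
    rw [mem_closedBall, dist_eq_norm]
    exact Real.le_sqrt_of_sq_le hx.2.le
  have key := hu.ge_of_linOp (ψ := fun x => F (‖x - y‖ ^ 2)) hn hlam hD hb huc.continuousOn
    (fun x hx => (hsm x hx).continuousAt.continuousWithinAt)
    (fun x hx => hsm x (subset_closure hx)) (fun x hx => ?_) (fun x hx => ?_)
  · intro x h1 h2
    rcases eq_or_lt_of_le h1 with h3 | h3
    · rw [← h3]
      exact hα' x h3.symm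
    rcases eq_or_lt_of_le h2 with h4 | h4
    · rw [h4]
      exact hγ x h4
    exact key x ⟨h3, h4⟩
  · have hs : 0 < ‖x - y‖ ^ 2 := hα.trans hx.1
    obtain ⟨b, a, ha, h1, h2⟩ := exists_isCoef_radial hn hlL (w := x - y) (by
      rintro h
      simp [h] at hs)
    refine ⟨b, a, ha, ?_⟩
    rw [linOp_radial (hsm x (subset_closure hx))
      ((eventually_gt_nhds hs).mono fun s h => hF1 s h) (hF2 _ hs), h1, h2]
    exact hop x hx.1 hx.2
  · have hxc := hDc (frontier_subset_closure hx)
    have hxD : x ∉ D := fun h => hx.2 (by rwa [hD.interior_eq])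
    rcases eq_or_lt_of_le hxc.1 with h1 | h1
    · rw [← h1]
      exact hα' x h1.symm
    · have h2 : ‖x - y‖ ^ 2 = γ := le_antisymm hxc.2 (not_lt.1 fun h => hxD ⟨h1, h⟩)
      rw [h2]
      exact hγ x h2

lemma hasDerivAt_rpow_neg (β : ℝ) {s : ℝ} (hs : 0 < s) :
    HasDerivAt (fun s : ℝ => s ^ (-β)) (-β * s ^ (-β - 1)) s :=
  Real.hasDerivAt_rpow_const (Or.inl hs.ne')

/-- A nonnegative supersolution decays at most like the fundamental solution. -/
lemma PucciSupersol.ge_rpow {y : Euc n} {ρ c β : ℝ} (hn : 0 < n) (hlam : 0 < lam)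
    (hlL : lam ≤ Lam) (hβ : 0 < β) (hcrit : (n - 1) * lam ≤ Lam * (2 * β + 1)) (hc : 0 ≤ c)
    (hρ : 0 < ρ) (hu : PucciSupersol lam Lam (ball y ρ) u g) (huc : Continuous u)
    (hu0 : ∀ x, 0 ≤ u x) (hg : ∀ x, 0 ≤ g x) (hc1 : ∀ x ∈ closedBall y 1, c ≤ u x) :
    ∀ x, 1 ≤ ‖x - y‖ ^ 2 → 4 * ‖x - y‖ ^ 2 ≤ ρ ^ 2 →
      c * (1 - 4 ^ (-β)) * (‖x - y‖ ^ 2) ^ (-β) ≤ u x := by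
  have key := PucciSupersol.ge_radial (y := y) (α := 1) (γ := ρ ^ 2) (u := u) (g := g)
    (F := fun s => c * (s ^ (-β) - (ρ ^ 2) ^ (-β))) (F' := fun s => c * (-β * s ^ (-β - 1)))
    (F'' := fun s => c * (-β * ((-β - 1) * s ^ (-β - 1 - 1)))) hn hlam hlL one_pos
    (hu.mono_set fun x hx => ?_) huc (fun s hs => ?_)
    (fun s hs => ((hasDerivAt_rpow_neg β hs).sub_const _).const_mul c)
    (fun s hs => ((Real.hasDerivAt_rpow_const (Or.inl hs.ne')).const_mul (-β)).const_mul c)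
    (fun x h1 h2 => ?_) (fun x hx => ?_) (fun x hx => ?_)
  · intro x h1 h2
    refine le_trans ?_ (key x h1 (by linarith))
    have h3 : (ρ ^ 2) ^ (-β) ≤ 4 ^ (-β) * (‖x - y‖ ^ 2) ^ (-β) := by
      rw [← Real.mul_rpow (by norm_num) (by positivity)]
      exact Real.rpow_le_rpow_of_nonpos (by positivity) h2 (by linarith)
    nlinarith
  · rw [mem_ball, dist_eq_norm, ← sq_lt_sq₀ (norm_nonneg _) hρ.le]
    exact hx.2
  · exact contDiffAt_const.mul ((Real.contDiffAt_rpow_const_of_ne hs.ne').sub contDiffAt_const)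
  · have hs : 0 < ‖x - y‖ ^ 2 := by linarith
    set s := ‖x - y‖ ^ 2
    have h3 : s ^ (-β - 1 - 1) * s = s ^ (-β - 1) := by
      rw [← Real.rpow_add_one hs.ne', sub_add_cancel]
    have h4 : 0 ≤ c * β * s ^ (-β - 1) := by positivity
    have h5 : 4 * (c * (-β * ((-β - 1) * s ^ (-β - 1 - 1)))) * (Lam * s) =
        c * β * s ^ (-β - 1) * (4 * (β + 1) * Lam) := by
      rw [← h3]
      ring
    rw [h5]
    have := hg x
    nlinarith [mul_nonneg h4 (sub_nonneg.2 hcrit)]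
  · refine le_trans ?_ (hc1 x ?_)
    · have : 0 ≤ (ρ ^ 2) ^ (-β) := by positivity
      rw [Real.one_rpow]
      nlinarith
    · rw [mem_closedBall, dist_eq_norm, ← sq_le_sq₀ (norm_nonneg _) zero_le_one, hx, one_pow]
  · rw [sub_self, mul_zero]
    exact hu0 x

/-- The logarithmic improvement of the decay in the critical case. -/
lemma PucciSupersol.ge_rpow_mul_log {y : Euc n} {T s₀ κ c β : ℝ} (hn : 0 < n) (hlam : 0 < lam)
    (hlL : lam ≤ Lam) (hβ : 0 < β) (hcrit : (n - 1) * lam ≤ Lam * (2 * β + 1)) (hκ : 0 ≤ κ)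
    (hs₀ : Real.exp (1 / β) ≤ s₀) (hT : s₀ ≤ T)
    (hu : PucciSupersol lam Lam {x | s₀ < ‖x - y‖ ^ 2 ∧ ‖x - y‖ ^ 2 < 4 * T} u g)
    (huc : Continuous u) (hu0 : ∀ x, 0 ≤ u x)
    (hg : ∀ x, s₀ < ‖x - y‖ ^ 2 → ‖x - y‖ ^ 2 < 4 * T → c * (‖x - y‖ ^ 2) ^ (-β - 1) ≤ g x)
    (hκc : 4 * β * Lam * κ ≤ c)
    (hbd : ∀ x, ‖x - y‖ ^ 2 = s₀ → κ * (s₀ ^ (-β) * Real.log s₀) ≤ u x) :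
    ∀ x, ‖x - y‖ ^ 2 = T →
      κ * T ^ (-β) * ((1 - 4 ^ (-β)) * Real.log T - 4 ^ (-β) * Real.log 4) ≤ u x := by
  have hs0 : 0 < s₀ := (Real.exp_pos _).trans_le hs₀
  have hT0 : 0 < T := hs0.trans_le hT
  have hlog : ∀ s, s₀ ≤ s → 1 ≤ β * Real.log s := fun s hs => by
    have := Real.log_le_log (Real.exp_pos _) (hs₀.trans hs)
    rw [Real.log_exp, div_le_iff₀ hβ] at this
    linarith
  have key := PucciSupersol.ge_radial (y := y) (α := s₀) (γ := 4 * T) (u := u) (g := g)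
    (F := fun s => κ * (s ^ (-β) * Real.log s - (4 * T) ^ (-β) * Real.log (4 * T)))
    (F' := fun s => κ * (-β * s ^ (-β - 1) * Real.log s + s ^ (-β) * s⁻¹))
    (F'' := fun s => κ * ((-β * ((-β - 1) * s ^ (-β - 1 - 1)) * Real.log s +
      -β * s ^ (-β - 1) * s⁻¹) + (-β * s ^ (-β - 1) * s⁻¹ + s ^ (-β) * -(s ^ 2)⁻¹)))
    hn hlam hlL hs0 hu huc (fun s hs => ?_)
    (fun s hs => (((hasDerivAt_rpow_neg β hs).mul (Real.hasDerivAt_log hs.ne')).sub_const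
      _).const_mul κ)
    (fun s hs => ((((Real.hasDerivAt_rpow_const (Or.inl hs.ne')).const_mul (-β)).mul
      (Real.hasDerivAt_log hs.ne')).add ((hasDerivAt_rpow_neg β hs).mul
        (hasDerivAt_inv hs.ne'))).const_mul κ)
    (fun x h1 h2 => ?_) (fun x hx => ?_) (fun x hx => ?_)
  · intro x hx
    refine le_trans (le_of_eq ?_) (key x (by rw [hx]; exact hT) (by linarith))
    rw [hx, Real.mul_rpow (by norm_num) hT0.le, Real.log_mul (by norm_num) hT0.ne']
    ring
  · exact contDiffAt_const.mul (((Real.contDiffAt_rpow_const_of_ne hs.ne').mul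
      (Real.contDiffAt_log.2 hs.ne')).sub contDiffAt_const)
  · have hs : 0 < ‖x - y‖ ^ 2 := hs0.trans h1
    have hgx := hg x h1 h2
    have hl := hlog _ h1.le
    set s := ‖x - y‖ ^ 2
    have e1 : s ^ (-β) = s ^ (-β - 1) * s := by
      rw [← Real.rpow_add_one hs.ne', sub_add_cancel]
    have e2 : s ^ (-β - 1 - 1) = s ^ (-β - 1) * s⁻¹ := Real.rpow_sub_one hs.ne' _
    rw [e1, e2]
    have hP : 0 < s ^ (-β - 1) := by positivity
    set P := s ^ (-β - 1)
    have e3 : 4 * (κ * ((-β * ((-β - 1) * (P * s⁻¹)) * Real.log s + -β * P * s⁻¹) +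
        (-β * P * s⁻¹ + P * s * -(s ^ 2)⁻¹))) * (Lam * s) +
        2 * (κ * (-β * P * Real.log s + P * s * s⁻¹)) * (Lam + (n - 1) * lam) =
        κ * P * (4 * Lam * (β * (β + 1) * Real.log s - (2 * β + 1)) +
          2 * (1 - β * Real.log s) * (Lam + (n - 1) * lam)) := by
      field_simp
      ring
    rw [e3]
    have h3 : -(4 * β * Lam) ≤ 4 * Lam * (β * (β + 1) * Real.log s - (2 * β + 1)) +
          2 * (1 - β * Real.log s) * (Lam + (n - 1) * lam) := by
      nlinarith [mul_nonneg (sub_nonneg.2 hl) (sub_nonneg.2 hcrit)]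
    have h4 : κ * P * -(4 * β * Lam) ≤ κ * P * (4 * Lam * (β * (β + 1) * Real.log s - (2 * β + 1)) +
          2 * (1 - β * Real.log s) * (Lam + (n - 1) * lam)) := by gcongr
    have h5 : 4 * β * Lam * κ * P ≤ c * P := by gcongr
    linarith
  · refine le_trans ?_ (hbd x hx)
    have h1 : 0 ≤ Real.log (4 * T) := by
      have := hlog (4 * T) (by linarith)
      exact (pos_of_mul_pos_right (by linarith) hβ.le).le
    have h2 : 0 ≤ (4 * T) ^ (-β) * Real.log (4 * T) := by positivity
    nlinarith
  · rw [sub_self, mul_zero]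
    exact hu0 x

/-- A nonnegative supersolution attains its minimum over a ball on the boundary. -/
lemma PucciSupersol.ge_of_sphere {y : Euc n} {τ c : ℝ} (hn : 0 < n) (hlam : 0 < lam)
    (hlL : lam ≤ Lam) (hτ : 0 < τ) (hu : PucciSupersol lam Lam (ball y τ) u g) (huc : Continuous u)
    (hg : ∀ x, 0 ≤ g x) (hc : ∀ x ∈ sphere y τ, c ≤ u x) : ∀ x ∈ closedBall y τ, c ≤ u x := by
  have key := hu.ge_of_linOp (ψ := fun _ => c) hn hlam isOpen_ball isBounded_ball huc.continuousOn
    continuousOn_const (fun _ _ => contDiffAt_const)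
    (fun x _ => ⟨EuclideanSpace.basisFun (Fin n) ℝ, fun _ => lam, fun _ => ⟨le_rfl, hlL⟩, by
      rw [linOp_const, zero_add]
      exact hg x⟩)
    (fun x hx => hc x (by rwa [frontier_ball y hτ.ne'] at hx))
  intro x hx
  rcases eq_or_lt_of_le (mem_closedBall.1 hx) with h | h
  · exact hc x h
  · exact key x h

end Radial

section Liouville

variable {n : ℕ} {k : Fin n} {lam₁ Lam₁ lam₂ Lam₂ C p q : ℝ} {u v : Euc n → ℝ}

lemma pos_coord_of_norm_sub_lt {x y : Euc n} (h : ‖x - y‖ < y k) : 0 < x k := by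
  have h1 := (neg_abs_le _).trans' (neg_le_neg ((abs_coord_le_norm (x - y) k)))
  rw [PiLp.sub_apply] at h1
  linarith

/-- A lower bound for one component on a ball far from the boundary improves itself through the
system. -/
lemma HalfSpaceSol.exists_self_improve
    (hu : HalfSpaceSol k lam₁ Lam₁ C u (fun x => v x ^ p))
    (hv : HalfSpaceSol k lam₂ Lam₂ C v (fun x => u x ^ q))
    (hlam₁ : 0 < lam₁) (hL₁ : lam₁ ≤ Lam₁) (hlam₂ : 0 < lam₂) (hL₂ : lam₂ ≤ Lam₂)
    (hp : 0 < p) (hq : 0 < q) :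
    ∃ c, 0 < c ∧ ∀ (y : Euc n) (τ μ : ℝ), 0 < τ → 2 * τ ≤ y k → 0 < μ →
      (∀ x ∈ closedBall y τ, μ ≤ u x) →
      ∀ x ∈ closedBall y τ, c * (μ ^ (p * q) * (τ ^ 2) ^ (p + 1)) ≤ u x := by
  have hn : 0 < n := k.pos
  have hn' : (0 : ℝ) < n := by positivity
  have hLp₁ : 0 < Lam₁ := hlam₁.trans_le hL₁
  have hLp₂ : 0 < Lam₂ := hlam₂.trans_le hL₂
  have hG := growthConst_pos hn hlam₁ hL₁
  set G := growthConst n lam₁ Lam₁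
  set A := 3 / (8 * n * Lam₂) with hA
  set B := 3 / (32 * n * Lam₁) with hB
  have hA0 : 0 < A := by positivity
  have hB0 : 0 < B := by positivity
  refine ⟨G * (G * (A ^ p * B)), by positivity, fun y τ μ hτ hy hμ hlow => ?_⟩
  have hball : ball y (2 * τ) ⊆ {x | 0 < x k} := fun x hx =>
    pos_coord_of_norm_sub_lt ((mem_ball_iff_norm.1 hx).trans_le hy)
  have hv1 : ∀ z ∈ closedBall y (τ / 2), A * (μ ^ q * τ ^ 2) ≤ v z := by
    intro z hz
    have := PucciSupersol.ge_paraboloid hn hlam₂ hL₂ (c := μ ^ q) (by positivity) hτ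
      (hv.super.mono_set ((ball_subset_ball (by linarith)).trans hball)) hv.cont.continuousOn
      (fun z _ => hv.nonneg z)
      (fun z hz => Real.rpow_le_rpow hμ.le (hlow z (ball_subset_closedBall hz)) hq.le) z
      (closedBall_subset_ball (by linarith) hz)
    refine le_trans ?_ this
    rw [mem_closedBall_iff_norm] at hz
    have h1 : ‖z - y‖ ^ 2 ≤ (τ / 2) ^ 2 := pow_le_pow_left₀ (norm_nonneg _) hz 2
    calc A * (μ ^ q * τ ^ 2) = μ ^ q / (2 * n * Lam₂) * (τ ^ 2 - (τ / 2) ^ 2) := by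
          rw [hA]
          field_simp
          ring
      _ ≤ _ := by gcongr
  set m := A ^ p * B * (μ ^ (p * q) * (τ ^ 2) ^ (p + 1)) with hm
  have hm0 : 0 < m := by positivity
  have hu1 : ∀ z ∈ closedBall y (τ / 4), m ≤ u z := by
    intro z hz
    have := PucciSupersol.ge_paraboloid hn hlam₁ hL₁ (c := (A * (μ ^ q * τ ^ 2)) ^ p)
      (by positivity) (half_pos hτ)
      (hu.super.mono_set ((ball_subset_ball (by linarith)).trans hball)) hu.cont.continuousOn
      (fun z _ => hu.nonneg z)
      (fun z hz => Real.rpow_le_rpow (by positivity) (hv1 z (ball_subset_closedBall hz)) hp.le) z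
      (closedBall_subset_ball (by linarith) hz)
    refine le_trans ?_ this
    rw [mem_closedBall_iff_norm] at hz
    have h1 : ‖z - y‖ ^ 2 ≤ (τ / 4) ^ 2 := pow_le_pow_left₀ (norm_nonneg _) hz 2
    calc m = (A * (μ ^ q * τ ^ 2)) ^ p / (2 * n * Lam₁) * ((τ / 2) ^ 2 - (τ / 4) ^ 2) := by
          rw [hm, Real.mul_rpow hA0.le (by positivity), Real.mul_rpow (by positivity)
            (by positivity), ← Real.rpow_mul hμ.le, mul_comm q p, Real.rpow_add_one (by positivity),
            hB]
          field_simp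
          ring
      _ ≤ _ := by gcongr
  have hneg : PucciSubsol lam₁ Lam₁ {x | 0 < x k} (fun x => -u x) fun _ => 0 :=
    hu.super.neg_subsol hL₁ fun x _ => Real.rpow_nonneg (hv.nonneg x) p
  have hnc : Continuous fun x => -u x := hu.cont.neg
  have hn0 : ∀ x, -u x ≤ 0 := fun x => neg_nonpos.2 (hu.nonneg x)
  have h2 := PucciSubsol.le_on_double hn hlam₁ hL₁ (ρ := τ / 4) (by positivity) hm0
    (hneg.mono_set ((ball_subset_ball (by linarith)).trans hball)) hnc.continuousOn
    (fun x _ => hn0 x) (fun x hx => neg_le_neg (hu1 x hx))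
  have h3 := PucciSubsol.le_on_double hn hlam₁ hL₁ (ρ := 2 * (τ / 4)) (by positivity)
    (mul_pos hG hm0) (hneg.mono_set ((ball_subset_ball (by linarith)).trans hball))
    hnc.continuousOn (fun x _ => hn0 x) h2
  intro x hx
  have h4 := h3 x (closedBall_subset_closedBall (by linarith) hx)
  rw [hm] at h4
  linarith

/-- A priori bound: a bounded solution cannot be too large on a ball away from the boundary. -/
lemma HalfSpaceSol.exists_lower_bound_lt
    (hu : HalfSpaceSol k lam₁ Lam₁ C u (fun x => v x ^ p))
    (hv : HalfSpaceSol k lam₂ Lam₂ C v (fun x => u x ^ q))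
    (hlam₁ : 0 < lam₁) (hL₁ : lam₁ ≤ Lam₁) (hlam₂ : 0 < lam₂) (hL₂ : lam₂ ≤ Lam₂)
    (hp : 0 < p) (hq : 0 < q) (hpq : 1 < p * q) :
    ∃ c, 0 < c ∧ ∀ (y : Euc n) (τ μ : ℝ), 0 < τ → 2 * τ ≤ y k → 0 < μ →
      (∀ x ∈ closedBall y τ, μ ≤ u x) → c * (μ ^ (p * q - 1) * (τ ^ 2) ^ (p + 1)) < 2 := by
  obtain ⟨c, hc, H⟩ := hu.exists_self_improve hv hlam₁ hL₁ hlam₂ hL₂ hp hq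
  refine ⟨c, hc, fun y τ μ hτ hy hμ hlow => ?_⟩
  by_contra! hlarge
  have hit : ∀ j : ℕ, ∀ x ∈ closedBall y τ, 2 ^ j * μ ≤ u x := by
    intro j
    induction j with
    | zero => simpa using hlow
    | succ j ih =>
      intro x hx
      have hj : μ ≤ 2 ^ j * μ := le_mul_of_one_le_left hμ.le (one_le_pow₀ one_le_two)
      refine le_trans ?_ (H y τ (2 ^ j * μ) hτ hy (by positivity) ih x hx)
      have h1 : (2 ^ j * μ) ^ (p * q) = (2 ^ j * μ) ^ (p * q - 1) * (2 ^ j * μ) := by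
        rw [← Real.rpow_add_one (by positivity), sub_add_cancel]
      have h2 : μ ^ (p * q - 1) ≤ (2 ^ j * μ) ^ (p * q - 1) :=
        Real.rpow_le_rpow hμ.le hj (by linarith)
      have h3 : 2 ≤ c * ((2 ^ j * μ) ^ (p * q - 1) * (τ ^ 2) ^ (p + 1)) :=
        hlarge.trans (by gcongr)
      have h4 : 0 < 2 ^ j * μ := by positivity
      rw [h1, pow_succ]
      nlinarith
  obtain ⟨j, hj⟩ := pow_unbounded_of_one_lt (C / μ) (one_lt_two (α := ℝ))
  have h1 := hit j y (mem_closedBall_self hτ.le)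
  rw [div_lt_iff₀ hμ] at hj
  linarith [hu.le y]

end Liouville

section Liouville

variable {n : ℕ} {k : Fin n} {lam₁ Lam₁ lam₂ Lam₂ C p q β : ℝ} {u v : Euc n → ℝ}

lemma exists_rpow_le_of_monotone {lam Lam : ℝ} {g : Euc n → ℝ}
    (hu : HalfSpaceSol k lam Lam C u g) (hlam : 0 < lam) (hL : lam ≤ Lam)
    (hmono : ∀ (x : Euc n) (s : ℝ), 0 ≤ s → u x ≤ u (x + s • EuclideanSpace.single k (1 : ℝ)))
    (hg : ∀ x, 0 ≤ g x) (hβ : 0 < β) (hcrit : (n - 1) * lam ≤ Lam * (2 * β + 1)) :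
    ∃ c, 0 < c ∧ ∀ ρ : ℝ, 2 ≤ ρ → ∀ x, 1 ≤ ‖x - ρ • EuclideanSpace.single k (1 : ℝ)‖ ^ 2 →
      4 * ‖x - ρ • EuclideanSpace.single k (1 : ℝ)‖ ^ 2 ≤ ρ ^ 2 →
      c * (‖x - ρ • EuclideanSpace.single k (1 : ℝ)‖ ^ 2) ^ (-β) ≤ u x := by
  have hn : 0 < n := k.pos
  set e : Euc n := EuclideanSpace.single k (1 : ℝ) with he
  have hek : ∀ s : ℝ, (s • e) k = s := fun s => by simp [he]
  have hK : IsCompact (closedBall ((2 : ℝ) • e) 1) := isCompact_closedBall _ _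
  obtain ⟨z₀, hz₀, hmin⟩ := hK.exists_isMinOn ⟨_, mem_closedBall_self zero_le_one⟩
    hu.cont.continuousOn
  have hz₀k : 0 < z₀ k := by
    refine pos_coord_of_norm_sub_lt (y := (2 : ℝ) • e) ?_
    rw [hek]
    exact (mem_closedBall_iff_norm.1 hz₀).trans_lt one_lt_two
  have hc := hu.pos z₀ hz₀k
  have h4 : (4 : ℝ) ^ (-β) < 1 := Real.rpow_lt_one_of_one_lt_of_neg (by norm_num) (by linarith)
  refine ⟨u z₀ * (1 - 4 ^ (-β)), mul_pos hc (sub_pos.2 h4), fun ρ hρ => ?_⟩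
  refine PucciSupersol.ge_rpow hn hlam hL hβ hcrit hc.le (by linarith)
    (hu.super.mono_set fun x hx => ?_) hu.cont hu.nonneg hg fun x hx => ?_
  · refine pos_coord_of_norm_sub_lt (y := ρ • e) ?_
    rw [hek]
    exact mem_ball_iff_norm.1 hx
  · have h1 := hmono (x - (ρ - 2) • e) (ρ - 2) (by linarith)
    rw [sub_add_cancel] at h1
    refine (hmin ?_).trans h1
    rw [mem_closedBall_iff_norm] at hx ⊢
    rwa [sub_sub, ← add_smul, sub_add_cancel]

/-- Transfer of the power decay bound from `u` to `v`. -/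
lemma HalfSpaceSol.rpow_le_of_rpow_le {y : Euc n} {c₁ : ℝ}
    (hv : HalfSpaceSol k lam₂ Lam₂ C v (fun x => u x ^ q))
    (hlam₂ : 0 < lam₂) (hL₂ : lam₂ ≤ Lam₂) (hp : 0 < p) (hq : 0 < q) (hβ : 0 < β)
    (hβpq : β * (p * q - 1) = p + 1) (hc₁ : 0 < c₁) (hy : 0 ≤ y k)
    (hlow : ∀ x, 1 ≤ ‖x - y‖ ^ 2 → 4 * ‖x - y‖ ^ 2 ≤ y k ^ 2 →
      c₁ * (‖x - y‖ ^ 2) ^ (-β) ≤ u x) {x : Euc n} (hx : 4 ≤ ‖x - y‖ ^ 2)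
    (hxy : 16 * ‖x - y‖ ^ 2 ≤ y k ^ 2) :
    ((c₁ * (9 / 4) ^ (-β)) ^ q / (8 * n * Lam₂)) ^ p * (‖x - y‖ ^ 2) ^ (-β - 1) ≤ v x ^ p := by
  have hn : 0 < n := k.pos
  have hn' : (0 : ℝ) < n := by positivity
  have hLp₂ : 0 < Lam₂ := hlam₂.trans_le hL₂
  set r := ‖x - y‖ with hr
  have hr2 : 2 ≤ r := by nlinarith [norm_nonneg (x - y)]
  have hr4 : 4 * r ≤ y k := abs_le_of_sq_le_sq' (by linarith) hy |>.2
  have hz : ∀ z ∈ closedBall x (r / 2), r / 2 ≤ ‖z - y‖ ∧ ‖z - y‖ ≤ 3 / 2 * r := by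
    intro z hz
    rw [mem_closedBall_iff_norm] at hz
    have h1 := norm_sub_norm_le (x - y) (x - z)
    have h2 := norm_add_le (z - x) (x - y)
    rw [sub_sub_sub_cancel_left, norm_sub_rev x z] at h1
    rw [sub_add_sub_cancel] at h2
    constructor <;> linarith
  have hvx : (c₁ * (9 / 4 * r ^ 2) ^ (-β)) ^ q / (2 * n * Lam₂) * (r / 2) ^ 2 ≤ v x := by
    have := PucciSupersol.ge_paraboloid hn hlam₂ hL₂
      (c := (c₁ * (9 / 4 * r ^ 2) ^ (-β)) ^ q) (by positivity) (ρ := r / 2) (by linarith)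
      (hv.super.mono_set fun z h => pos_coord_of_norm_sub_lt (y := y) (by
        linarith [(hz z (ball_subset_closedBall h)).2])) hv.cont.continuousOn
      (fun z _ => hv.nonneg z) (fun z h => ?_) x (mem_ball_self (by linarith))
    · simpa using this
    · obtain ⟨h1, h2⟩ := hz z (ball_subset_closedBall h)
      refine Real.rpow_le_rpow (by positivity) ?_ hq.le
      have h3 : 1 ≤ ‖z - y‖ ^ 2 := by nlinarith
      have h4 : ‖z - y‖ ^ 2 ≤ 9 / 4 * r ^ 2 := by nlinarith
      refine le_trans ?_ (hlow z h3 (by nlinarith))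
      refine mul_le_mul_of_nonneg_left ?_ hc₁.le
      exact Real.rpow_le_rpow_of_nonpos (by linarith) h4 (by linarith)
  refine le_trans (le_of_eq ?_) (Real.rpow_le_rpow (by positivity) hvx hp.le)
  have hs : 0 < r ^ 2 := by positivity
  have h1 : (c₁ * (9 / 4 * r ^ 2) ^ (-β)) ^ q / (2 * n * Lam₂) * (r / 2) ^ 2 =
      (c₁ * (9 / 4) ^ (-β)) ^ q / (8 * n * Lam₂) * (r ^ 2) ^ (-β * q + 1) := by
    rw [Real.mul_rpow (by norm_num) hs.le, ← mul_assoc, Real.mul_rpow (by positivity)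
      (by positivity), ← Real.rpow_mul hs.le, Real.rpow_add_one hs.ne']
    field_simp
    ring
  rw [h1, Real.mul_rpow (x := _ / _) (by positivity) (by positivity), ← Real.rpow_mul hs.le]
  congr 2
  linarith

/-- Nonexistence of bounded solutions of the system in a half space, in the case where the first
equation carries the critical exponent condition. -/
theorem HalfSpaceSol.nonexistence
    (hu : HalfSpaceSol k lam₁ Lam₁ C u (fun x => v x ^ p))
    (hv : HalfSpaceSol k lam₂ Lam₂ C v (fun x => u x ^ q))
    (hlam₁ : 0 < lam₁) (hL₁ : lam₁ ≤ Lam₁) (hlam₂ : 0 < lam₂) (hL₂ : lam₂ ≤ Lam₂)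
    (hp : 1 ≤ p) (hq : 1 ≤ q) (hpq : 1 < p * q) (hC : 0 ≤ C)
    (hcrit : (n - 1) * lam₁ ≤ Lam₁ * (2 * ((p + 1) / (p * q - 1)) + 1)) : False := by
  have hn : 0 < n := k.pos
  have hn' : (0 : ℝ) < n := by positivity
  have hLp₁ : 0 < Lam₁ := hlam₁.trans_le hL₁
  have hLp₂ : 0 < Lam₂ := hlam₂.trans_le hL₂
  have hpq0 : 0 < p * q - 1 := by linarith
  have hp0 : 0 < p := by linarith
  have hq0 : 0 < q := by linarith
  set β := (p + 1) / (p * q - 1) with hβdef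
  have hβ : 0 < β := by positivity
  have hβpq : β * (p * q - 1) = p + 1 := div_mul_cancel₀ _ hpq0.ne'
  obtain ⟨c₁, hc₁, hlow⟩ := exists_rpow_le_of_monotone hu hlam₁ hL₁
    (fun x s hs => (hu.monotone hv hlam₁ hL₁ hlam₂ hL₂ hp hq hpq hC x hs).1)
    (fun x => Real.rpow_nonneg (hv.nonneg x) p) hβ hcrit
  set c₃ := ((c₁ * (9 / 4) ^ (-β)) ^ q / (8 * n * Lam₂)) ^ p with hc₃def
  have hc₃ : 0 < c₃ := by positivity
  obtain ⟨c₆, hc₆, hbound⟩ := hu.exists_lower_bound_lt hv hlam₁ hL₁ hlam₂ hL₂ hp0 hq0 hpq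
  set s₀ := max 4 (Real.exp (1 / β)) with hs₀def
  have hs₀4 : 4 ≤ s₀ := le_max_left _ _
  have hlog₀ : 0 < Real.log s₀ := Real.log_pos (by linarith)
  set κ := min (c₃ / (4 * β * Lam₁)) (c₁ / Real.log s₀) with hκdef
  have hκ : 0 < κ := lt_min (by positivity) (by positivity)
  have hκ3 : 4 * β * Lam₁ * κ ≤ c₃ := by
    have h := min_le_left (c₃ / (4 * β * Lam₁)) (c₁ / Real.log s₀)
    rw [← hκdef, le_div_iff₀ (by positivity)] at h
    linarith
  have hκ1 : κ * Real.log s₀ ≤ c₁ := by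
    have h := min_le_right (c₃ / (4 * β * Lam₁)) (c₁ / Real.log s₀)
    rwa [← hκdef, le_div_iff₀ hlog₀] at h
  have h4 : (4 : ℝ) ^ (-β) < 1 := Real.rpow_lt_one_of_one_lt_of_neg (by norm_num) (by linarith)
  set ω : ℝ → ℝ := fun T => κ * ((1 - 4 ^ (-β)) * Real.log T - 4 ^ (-β) * Real.log 4) with hω
  have hωlim : Tendsto ω atTop atTop :=
    (tendsto_atTop_add_const_right _ _
      (Real.tendsto_log_atTop.const_mul_atTop (sub_pos.2 h4))).const_mul_atTop hκ
  have hlim : Tendsto (fun T => c₆ * ω T ^ (p * q - 1)) atTop atTop :=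
    ((tendsto_rpow_atTop hpq0).comp hωlim).const_mul_atTop hc₆
  obtain ⟨T, hT1, hT2, hT3⟩ := ((hlim.eventually_ge_atTop 2).and
    ((hωlim.eventually_gt_atTop 0).and (eventually_ge_atTop s₀))).exists
  have hT0 : 0 < T := by linarith
  set τ := Real.sqrt T with hτdef
  have hτ : 0 < τ := Real.sqrt_pos.2 hT0
  have hτ2 : τ ^ 2 = T := Real.sq_sqrt hT0.le
  have hτ1 : 2 ≤ τ := Real.le_sqrt_of_sq_le (by linarith)
  set y : Euc n := (8 * τ) • EuclideanSpace.single k (1 : ℝ) with hydef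
  have hyk : y k = 8 * τ := by simp [hydef]
  have hyk2 : y k ^ 2 = 64 * T := by rw [hyk, mul_pow, hτ2]; norm_num
  have hlow' : ∀ x, 1 ≤ ‖x - y‖ ^ 2 → 4 * ‖x - y‖ ^ 2 ≤ y k ^ 2 →
      c₁ * (‖x - y‖ ^ 2) ^ (-β) ≤ u x := fun x h1 h2 =>
    hlow (8 * τ) (by linarith) x h1 (by rwa [hyk] at h2)
  have hsphere : ∀ x ∈ sphere y τ, T ^ (-β) * ω T ≤ u x := by
    intro x hx
    rw [mem_sphere_iff_norm] at hx
    have := PucciSupersol.ge_rpow_mul_log (u := u) (y := y) (T := T) hn hlam₁ hL₁ hβ hcrit hκ.le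
      (le_max_right 4 (Real.exp (1 / β))) hT3 (hu.super.mono_set fun x hx => ?_) hu.cont hu.nonneg
      (fun x h1 h2 => hv.rpow_le_of_rpow_le hlam₂ hL₂ hp0 hq0 hβ hβpq hc₁ (by linarith) hlow'
        (hs₀4.trans h1.le) (by linarith)) hκ3 (fun x hx => ?_) x (by rw [hx, hτ2])
    · refine le_trans (le_of_eq ?_) this
      rw [hω]
      ring
    · refine pos_coord_of_norm_sub_lt (y := y) ?_
      rw [hyk]
      exact lt_of_pow_lt_pow_left₀ 2 (by positivity) (by rw [mul_pow, hτ2]; linarith [hx.2])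
    · refine le_trans ?_ (hlow' x (by linarith) (by linarith))
      rw [hx]
      have : 0 < s₀ ^ (-β) := by positivity
      nlinarith
  have hin := PucciSupersol.ge_of_sphere hn hlam₁ hL₁ hτ (hu.super.mono_set fun x hx =>
    pos_coord_of_norm_sub_lt (y := y) (by
      rw [hyk]
      exact (mem_ball_iff_norm.1 hx).trans (by linarith))) hu.cont
    (fun x => Real.rpow_nonneg (hv.nonneg x) p) hsphere
  have h1 := hbound y τ _ hτ (by linarith) (by positivity) hin
  refine absurd h1 (not_lt.2 (hT1.trans (le_of_eq ?_)))
  rw [hτ2, Real.mul_rpow (by positivity) hT2.le, ← Real.rpow_mul hT0.le, mul_right_comm,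
    ← Real.rpow_add hT0, neg_mul, hβpq, neg_add_cancel, Real.rpow_zero, one_mul]

end Liouville

/-- Projection onto the closed half space `0 ≤ x k`. -/
noncomputable def halfSpaceProj {n : ℕ} (k : Fin n) (x : Euc n) : Euc n :=
  x + (max (x k) 0 - x k) • EuclideanSpace.single k (1 : ℝ)

lemma halfSpaceProj_apply {n : ℕ} (k : Fin n) (x : Euc n) :
    halfSpaceProj k x k = max (x k) 0 := by
  rw [halfSpaceProj, add_smul_single_apply]
  ring

lemma halfSpaceProj_of_nonneg {n : ℕ} {k : Fin n} {x : Euc n} (hx : 0 ≤ x k) :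
    halfSpaceProj k x = x := by
  rw [halfSpaceProj, max_eq_left hx, sub_self, zero_smul, add_zero]

lemma continuous_halfSpaceProj {n : ℕ} (k : Fin n) : Continuous (halfSpaceProj k) :=
  continuous_id.add ((((continuous_coord k).max continuous_const).sub
    (continuous_coord k)).smul continuous_const)

/-- A solution on the closed half space, extended by zero. -/
lemma halfSpaceSol_comp_proj {n : ℕ} {k : Fin n} {lam Lam C r : ℝ} {u v : Euc n → ℝ}
    (huc : ContinuousOn u {x | 0 ≤ x k}) (hC : ∀ x : Euc n, 0 ≤ x k → |u x| ≤ C)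
    (hpos : ∀ x : Euc n, 0 < x k → 0 < u x) (hzero : ∀ x : Euc n, x k = 0 → u x = 0)
    (hsuper : PucciSupersol lam Lam {x | 0 < x k} u (fun x => v x ^ r))
    (hsub : PucciSubsol lam Lam {x | 0 < x k} u (fun x => v x ^ r)) :
    HalfSpaceSol k lam Lam C (fun x => u (halfSpaceProj k x))
      (fun x => v (halfSpaceProj k x) ^ r) := by
  have hmem : ∀ x, 0 ≤ halfSpaceProj k x k := fun x => by simp [halfSpaceProj_apply]
  have heq : ∀ w : Euc n → ℝ, ∀ x ∈ {x : Euc n | 0 < x k}, w x = w (halfSpaceProj k x) :=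
    fun w x hx => by rw [halfSpaceProj_of_nonneg (le_of_lt hx)]
  refine ⟨huc.comp_continuous (continuous_halfSpaceProj k) hmem,
    fun x => (le_abs_self _).trans (hC _ (hmem x)),
    fun x hx => hzero _ (by rw [halfSpaceProj_apply, max_eq_right hx]),
    fun x hx => (heq u x hx).symm ▸ hpos x hx,
    hsub.congr (isOpen_halfSpace k) (heq u) (heq _),
    hsuper.congr (isOpen_halfSpace k) (heq u) (heq _)⟩

lemma coef_crit_of_dimension_le {n : ℕ} {lam Lam N a : ℝ} (hLam : 0 < Lam)
    (hN : N = lam / Lam * ((n : ℝ) - 1) + 1) (h : N - 2 ≤ 2 * a) :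
    (n - 1) * lam ≤ Lam * (2 * a + 1) := by
  have h1 : (n - 1) * lam = Lam * (N - 1) := by
    rw [hN]
    field_simp
    ring
  rw [h1]
  exact mul_le_mul_of_nonneg_left (by linarith) hLam.le

theorem stmt4 (n : ℕ) (hn : 2 ≤ n)
    (lam1 Lam1 lam2 Lam2 : ℝ) (hlam1 : 0 < lam1) (hLam1 : lam1 ≤ Lam1)
    (hlam2 : 0 < lam2) (hLam2 : lam2 ≤ Lam2)
    (N1 N2 : ℝ) (hN1 : N1 = lam1 / Lam1 * ((n : ℝ) - 1) + 1)
    (hN2 : N2 = lam2 / Lam2 * ((n : ℝ) - 1) + 1)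
    (hN1' : 2 < N1) (hN2' : 2 < N2)
    (p q : ℝ) (hp : 1 ≤ p) (hq : 1 ≤ q) (hpq : 1 < p * q)
    (hcrit : N1 - 2 ≤ 2 * (p + 1) / (p * q - 1) ∨ N2 - 2 ≤ 2 * (q + 1) / (p * q - 1))
    (u1 u2 : EuclideanSpace ℝ (Fin n) → ℝ)
    (hu1 : ContinuousOn u1 {x | 0 ≤ x ⟨n - 1, by omega⟩})
    (hu2 : ContinuousOn u2 {x | 0 ≤ x ⟨n - 1, by omega⟩})
    (hbdd1 : ∃ C : ℝ, ∀ x : EuclideanSpace ℝ (Fin n), 0 ≤ x ⟨n - 1, by omega⟩ → |u1 x| ≤ C)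
    (hbdd2 : ∃ C : ℝ, ∀ x : EuclideanSpace ℝ (Fin n), 0 ≤ x ⟨n - 1, by omega⟩ → |u2 x| ≤ C)
    (hpos1 : ∀ x : EuclideanSpace ℝ (Fin n), 0 < x ⟨n - 1, by omega⟩ → 0 < u1 x)
    (hpos2 : ∀ x : EuclideanSpace ℝ (Fin n), 0 < x ⟨n - 1, by omega⟩ → 0 < u2 x)
    (hbdry1 : ∀ x : EuclideanSpace ℝ (Fin n), x ⟨n - 1, by omega⟩ = 0 → u1 x = 0)
    (hbdry2 : ∀ x : EuclideanSpace ℝ (Fin n), x ⟨n - 1, by omega⟩ = 0 → u2 x = 0)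
    (hsuper1 : PucciSupersol lam1 Lam1 {x | 0 < x ⟨n - 1, by omega⟩} u1 (fun x => u2 x ^ p))
    (hsub1 : PucciSubsol lam1 Lam1 {x | 0 < x ⟨n - 1, by omega⟩} u1 (fun x => u2 x ^ p))
    (hsuper2 : PucciSupersol lam2 Lam2 {x | 0 < x ⟨n - 1, by omega⟩} u2 (fun x => u1 x ^ q))
    (hsub2 : PucciSubsol lam2 Lam2 {x | 0 < x ⟨n - 1, by omega⟩} u2 (fun x => u1 x ^ q)) :
    False := by
  obtain ⟨C₁, hC₁⟩ := hbdd1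
  obtain ⟨C₂, hC₂⟩ := hbdd2
  have hC : 0 ≤ max C₁ C₂ :=
    (abs_nonneg _).trans ((hC₁ 0 (by simp)).trans (le_max_left _ _))
  have h1 := halfSpaceSol_comp_proj (C := max C₁ C₂) hu1
    (fun x hx => (hC₁ x hx).trans (le_max_left _ _)) hpos1 hbdry1 hsuper1 hsub1
  have h2 := halfSpaceSol_comp_proj (C := max C₁ C₂) hu2
    (fun x hx => (hC₂ x hx).trans (le_max_right _ _)) hpos2 hbdry2 hsuper2 hsub2
  rcases hcrit with h | h
  · refine h1.nonexistence h2 hlam1 hLam1 hlam2 hLam2 hp hq hpq hC ?_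
    exact coef_crit_of_dimension_le (hlam1.trans_le hLam1) hN1 (by rwa [← mul_div_assoc])
  · rw [mul_comm p q] at hpq h
    refine h2.nonexistence h1 hlam2 hLam2 hlam1 hLam1 hq hp hpq hC ?_
    exact coef_crit_of_dimension_le (hlam2.trans_le hLam2) hN2 (by rwa [← mul_div_assoc])
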